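/- arXiv:2207.06125 — 3 statements merged into one kernel-verified Lean document; each statement's English description precedes it below -/
import Mathlib

section
/- Assume (H_c). For each ε > 0 define a^ε : Ω → ℝ by a^ε(u,s) := a(u,s) + εs, and let σ^ε := inf{σ > 0 : the equation u_t = (a^ε(u,u_x))_x + f(u) admits a classic traveling wave moving at speed σ}. Then lim_{ε→0⁺} σ^ε = σ_s. -/
open Set Filter Topology
open scoped ENNReal

noncomputable section

/-- The strip `Ω` between `-ω` and `ω` over `[0,1]`:
`Ω = {(u,s) : u ∈ [0,1], -ω(u) < s < ω(u)}`. -/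
def OmegaSet (ω : ℝ → ℝ≥0∞) : Set (ℝ × ℝ) :=
  {p | p.1 ∈ Set.Icc (0:ℝ) 1 ∧ ENNReal.ofReal |p.2| < ω p.1}

/-- The set `𝒟` between `a₋ = -a₊` and `a₊` over `[0,1]`. -/
def DSet (aplus : ℝ → ℝ≥0∞) : Set (ℝ × ℝ) :=
  {p | p.1 ∈ Set.Icc (0:ℝ) 1 ∧ ENNReal.ofReal |p.2| < aplus p.1}

/-- Standing data and hypotheses: a lower semicontinuous width `ω : [0,1] → (0,∞]`,
a regular flux `a` on `Ω` (odd in `s`, C¹, with `∂a/∂s > 0`), the maximal fluxes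
`a₊(u) = lim_{s→ω(u)⁻} a(u,s)` (equivalently, the supremum over `0 < s < ω(u)`),
which are `+∞` whenever `ω(u) < ∞`, the partial inverse `g` on `𝒟` defined by
`a(u, g(u,v)) = v`, and a logistic-type reaction term `f`. -/
structure FluxData where
  ω : ℝ → ℝ≥0∞
  a : ℝ → ℝ → ℝ
  aplus : ℝ → ℝ≥0∞
  g : ℝ → ℝ → ℝ
  f : ℝ → ℝ
  ω_pos : ∀ u ∈ Set.Icc (0:ℝ) 1, 0 < ω u
  ω_lsc : LowerSemicontinuousOn ω (Set.Icc (0:ℝ) 1)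
  a_odd : ∀ u s, (u, s) ∈ OmegaSet ω → a u (-s) = - a u s
  a_C1 : ContDiffOn ℝ 1 (fun p : ℝ × ℝ => a p.1 p.2) (OmegaSet ω)
  a_deriv_pos : ∀ u s, (u, s) ∈ OmegaSet ω → ∃ d : ℝ, 0 < d ∧ HasDerivAt (a u) d s
  aplus_def : ∀ u ∈ Set.Icc (0:ℝ) 1,
      aplus u = ⨆ s ∈ {s : ℝ | 0 < s ∧ (u, s) ∈ OmegaSet ω}, ENNReal.ofReal (a u s)
  aplus_pos : ∀ u ∈ Set.Icc (0:ℝ) 1, 0 < aplus u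
  aplus_top : ∀ u ∈ Set.Icc (0:ℝ) 1, ω u < ⊤ → aplus u = ⊤
  g_spec : ∀ p ∈ DSet aplus, (p.1, g p.1 p.2) ∈ OmegaSet ω ∧ a p.1 (g p.1 p.2) = p.2
  f_C1 : ContDiffOn ℝ 1 f (Set.Icc (0:ℝ) 1)
  f_zero : f 0 = 0
  f_one : f 1 = 0
  f_pos : ∀ u ∈ Set.Ioo (0:ℝ) 1, 0 < f u

/-- A classic traveling wave of `u_t = (b(u,u_x))_x + f(u)` moving at speed `σ`:
a C² increasing profile `u` with values in `(0,1)`, `0 < u' < ω(u)`, connecting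
`0` at `-∞` to `1` at `+∞`, such that `ξ ↦ b(u(ξ),u'(ξ))` is differentiable and
`(b(u,u'))' - σ u' + f(u) = 0`. -/
def IsClassicTW (F : FluxData) (b : ℝ → ℝ → ℝ) (σ : ℝ) (u : ℝ → ℝ) : Prop :=
  ContDiff ℝ 2 u ∧
  (∀ ξ : ℝ, u ξ ∈ Set.Ioo (0:ℝ) 1) ∧
  (∀ ξ : ℝ, 0 < deriv u ξ ∧ ENNReal.ofReal (deriv u ξ) < F.ω (u ξ)) ∧
  Filter.Tendsto u Filter.atBot (nhds 0) ∧
  Filter.Tendsto u Filter.atTop (nhds 1) ∧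
  (∀ ξ : ℝ, HasDerivAt (fun t => b (u t) (deriv u t)) (σ * deriv u ξ - F.f (u ξ)) ξ)

/-- A right solution with speed `σ`: `V : (α,1] → ℝ`, continuous on `(α,1]`,
C¹ on `(α,1)`, `V(1) = 0`, and on `(α,1)` : `V > 0`, `(u,V(u)) ∈ 𝒟` and
`V' = σ - f(u)/g(u,V(u))`. -/
def IsRightSolution (F : FluxData) (σ α : ℝ) (V : ℝ → ℝ) : Prop :=
  α ∈ Set.Ico (0:ℝ) 1 ∧
  ContinuousOn V (Set.Ioc α 1) ∧
  V 1 = 0 ∧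
  ∀ u ∈ Set.Ioo α 1, 0 < V u ∧ (u, V u) ∈ DSet F.aplus ∧
    HasDerivAt V (σ - F.f u / F.g u (V u)) u

open Classical in
/-- `ℋ(u,V) = 1/g(u,V)` if `0 < V < a₊(u)`, and `0` if `V ≥ a₊(u)`. -/
def Hfun (F : FluxData) (u V : ℝ) : ℝ :=
  if ENNReal.ofReal V < F.aplus u then 1 / F.g u V else 0

/-- The solution `𝒱_σ` of the extended problem: continuous on `[0,1]`, C¹ on `(0,1)`,
`𝒱(1) = 0`, `𝒱 > 0` on `(0,1)` and `𝒱' = σ - f(u)·ℋ(u,𝒱(u))` on `(0,1)`. -/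
def IsVsol (F : FluxData) (σ : ℝ) (V : ℝ → ℝ) : Prop :=
  ContinuousOn V (Set.Icc (0:ℝ) 1) ∧ V 1 = 0 ∧
  (∀ u ∈ Set.Ioo (0:ℝ) 1, 0 < V u) ∧
  (∀ u ∈ Set.Ioo (0:ℝ) 1, HasDerivAt V (σ - F.f u * Hfun F u (V u)) u)

/-- A continuous function which is nondecreasing wherever it is positive stays above its
positive initial value. -/
theorem le_of_deriv_nonneg_of_pos {h : ℝ → ℝ} {p q : ℝ} (hpq : p ≤ q)
    (hcont : ContinuousOn h (Icc p q))
    (hd : ∀ x ∈ Ioo p q, 0 < h x → ∃ d, 0 ≤ d ∧ HasDerivAt h d x) (hp : 0 < h p) :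
    h p ≤ h q := by
  have hS : IsCompact (Icc p q ∩ h ⁻¹' Ici (h p)) :=
    isCompact_Icc.of_isClosed_subset
      (hcont.preimage_isClosed_of_isClosed isClosed_Icc isClosed_Ici) inter_subset_left
  obtain ⟨m, ⟨hm, hhm⟩, hmax⟩ := hS.exists_isGreatest ⟨p, left_mem_Icc.2 hpq, le_refl (h p)⟩
  rcases eq_or_lt_of_le hm.2 with rfl | hmq
  · exact hhm
  exfalso
  have hpos : 0 < h m := hp.trans_le hhm
  have hev : ∀ᶠ x in 𝓝[Icc p q] m, 0 < h x := (hcont m hm).eventually (lt_mem_nhds hpos)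
  rw [eventually_nhdsWithin_iff, Metric.eventually_nhds_iff] at hev
  obtain ⟨δ, hδ, hball⟩ := hev
  set q' := min q (m + δ / 2) with hq'
  have hmq' : m < q' := lt_min hmq (by linarith)
  have hq'q : q' ≤ q := min_le_left _ _
  have hq'δ : q' ≤ m + δ / 2 := min_le_right _ _
  have hposI : ∀ x ∈ Ioo m q', 0 < h x := fun x hx => by
    apply hball
    · rw [Real.dist_eq, abs_of_pos (by linarith [hx.1])]
      linarith [hx.2]
    · exact ⟨hm.1.trans hx.1.le, hx.2.le.trans hq'q⟩
  have hder : ∀ x ∈ Ioo m q', ∃ d, 0 ≤ d ∧ HasDerivAt h d x := fun x hx =>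
    hd x ⟨hm.1.trans_lt hx.1, hx.2.trans_le hq'q⟩ (hposI x hx)
  have hmono : MonotoneOn h (Icc m q') := by
    apply monotoneOn_of_deriv_nonneg (convex_Icc _ _)
    · exact hcont.mono (Icc_subset_Icc hm.1 hq'q)
    · rw [interior_Icc]
      intro x hx
      obtain ⟨d, -, hd⟩ := hder x hx
      exact hd.differentiableAt.differentiableWithinAt
    · rw [interior_Icc]
      intro x hx
      obtain ⟨d, h0, hd⟩ := hder x hx
      rwa [hd.deriv]
  have hle : h m ≤ h q' :=
    hmono (left_mem_Icc.2 hmq'.le) (right_mem_Icc.2 hmq'.le) hmq'.le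
  have hmem : q' ≤ m := hmax ⟨⟨hm.1.trans hmq'.le, hq'q⟩, le_trans hhm hle⟩
  exact absurd hmem (not_le.2 hmq')

/-- The autonomous equation `u' = p(u)` on `(0,1)` has a heteroclinic orbit from `0` to `1`
when `p` is positive and vanishes at most linearly at the endpoints. -/
theorem exists_heteroclinic {p : ℝ → ℝ} {B : ℝ} (hp : ContDiffOn ℝ 1 p (Ioo 0 1)) (hB : 0 < B)
    (hpos : ∀ w ∈ Ioo (0 : ℝ) 1, 0 < p w) (hp0 : ∀ w ∈ Ioo (0 : ℝ) 1, p w ≤ B * w)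
    (hp1 : ∀ w ∈ Ioo (0 : ℝ) 1, p w ≤ B * (1 - w)) :
    ∃ u : ℝ → ℝ, ContDiff ℝ 2 u ∧ (∀ ξ, u ξ ∈ Ioo (0 : ℝ) 1) ∧ (∀ ξ, HasDerivAt u (p (u ξ)) ξ) ∧
      Tendsto u atBot (𝓝 0) ∧ Tendsto u atTop (𝓝 1) := by
  have hh : (1 / 2 : ℝ) ∈ Ioo (0 : ℝ) 1 := by norm_num
  have hinv : ContinuousOn (fun w => (p w)⁻¹) (Ioo 0 1) :=
    hp.continuousOn.inv₀ fun w hw => (hpos w hw).ne'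
  obtain ⟨T, hT⟩ : ∃ T : ℝ → ℝ, ∀ w ∈ Ioo (0 : ℝ) 1, HasDerivAt T (p w)⁻¹ w := by
    refine ⟨fun w => ∫ x in (1 / 2 : ℝ)..w, (p x)⁻¹, fun w hw => ?_⟩
    have hsub : uIcc (1 / 2) w ⊆ Ioo (0 : ℝ) 1 := ordConnected_Ioo.uIcc_subset hh hw
    exact intervalIntegral.integral_hasDerivAt_right (hinv.mono hsub).intervalIntegrable
      (hinv.stronglyMeasurableAtFilter isOpen_Ioo w hw) (hinv.continuousAt (isOpen_Ioo.mem_nhds hw))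
  have hTc : ContinuousOn T (Ioo 0 1) := fun w hw => (hT w hw).continuousAt.continuousWithinAt
  have hTm : StrictMonoOn T (Ioo 0 1) := by
    refine strictMonoOn_of_deriv_pos (convex_Ioo _ _) hTc fun w hw => ?_
    rw [interior_Ioo] at hw
    rw [(hT w hw).deriv]
    exact inv_pos.2 (hpos w hw)
  have hlog0 : MonotoneOn (fun w => T w - B⁻¹ * Real.log w) (Ioo 0 1) := by
    have hd : ∀ w ∈ Ioo (0 : ℝ) 1,
        HasDerivAt (fun w => T w - B⁻¹ * Real.log w) ((p w)⁻¹ - B⁻¹ * w⁻¹) w := fun w hw =>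
      (hT w hw).sub ((Real.hasDerivAt_log hw.1.ne').const_mul _)
    refine monotoneOn_of_deriv_nonneg (convex_Ioo _ _)
      (fun w hw => (hd w hw).continuousAt.continuousWithinAt) ?_ ?_
    · rw [interior_Ioo]
      exact fun w hw => (hd w hw).differentiableAt.differentiableWithinAt
    · rw [interior_Ioo]
      intro w hw
      rw [(hd w hw).deriv, ← mul_inv]
      exact sub_nonneg.2 (inv_anti₀ (hpos w hw) (hp0 w hw))
  have hlog1 : MonotoneOn (fun w => T w + B⁻¹ * Real.log (1 - w)) (Ioo 0 1) := by
    have hd : ∀ w ∈ Ioo (0 : ℝ) 1,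
        HasDerivAt (fun w => T w + B⁻¹ * Real.log (1 - w)) ((p w)⁻¹ + B⁻¹ * (-1 / (1 - w))) w :=
      fun w hw => (hT w hw).add
        ((((hasDerivAt_id w).const_sub 1).log (sub_pos.2 hw.2).ne').const_mul _)
    refine monotoneOn_of_deriv_nonneg (convex_Ioo _ _)
      (fun w hw => (hd w hw).continuousAt.continuousWithinAt) ?_ ?_
    · rw [interior_Ioo]
      exact fun w hw => (hd w hw).differentiableAt.differentiableWithinAt
    · rw [interior_Ioo]
      intro w hw
      rw [(hd w hw).deriv]
      have h1 : B⁻¹ * (-1 / (1 - w)) = -(B * (1 - w))⁻¹ := by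
        rw [mul_inv]; ring
      rw [h1, ← sub_eq_add_neg]
      exact sub_nonneg.2 (inv_anti₀ (hpos w hw) (hp1 w hw))
  have hlow : ∀ y, ∃ w ∈ Ioo (0 : ℝ) 1, T w ≤ y := by
    intro y
    have h1 : Tendsto (fun w => T (1 / 2) - B⁻¹ * Real.log (1 / 2) + B⁻¹ * Real.log w)
        (𝓝[>] 0) atBot :=
      tendsto_atBot_add_const_left _ _
        ((tendsto_const_mul_atBot_of_pos (inv_pos.2 hB)).2 Real.tendsto_log_nhdsGT_zero)
    obtain ⟨w, hw1, hw2⟩ := ((h1.eventually_le_atBot y).and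
      (Ioo_mem_nhdsGT (show (0 : ℝ) < 1 / 2 by norm_num))).exists
    have hw : w ∈ Ioo (0 : ℝ) 1 := ⟨hw2.1, hw2.2.trans (by norm_num)⟩
    have := hlog0 hw hh hw2.2.le
    exact ⟨w, hw, by simp only at this; linarith⟩
  have hhigh : ∀ y, ∃ w ∈ Ioo (0 : ℝ) 1, y ≤ T w := by
    intro y
    have h1 : Tendsto (fun w => T (1 / 2) + B⁻¹ * Real.log (1 - 1 / 2) + -B⁻¹ * Real.log w)
        (𝓝[>] 0) atTop :=
      tendsto_atTop_add_const_left _ _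
        ((tendsto_const_mul_atTop_of_neg (neg_lt_zero.2 (inv_pos.2 hB))).2
          Real.tendsto_log_nhdsGT_zero)
    obtain ⟨w, hw1, hw2⟩ := ((h1.eventually_ge_atTop y).and
      (Ioo_mem_nhdsGT (show (0 : ℝ) < 1 / 2 by norm_num))).exists
    have hw : 1 - w ∈ Ioo (0 : ℝ) 1 := ⟨by linarith [hw2.2], by linarith [hw2.1]⟩
    have := hlog1 hh hw (by linarith [hw2.2])
    refine ⟨1 - w, hw, ?_⟩
    simp only [sub_sub_cancel] at this
    linarith
  have hsurj : ∀ y, ∃ w ∈ Ioo (0 : ℝ) 1, T w = y := by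
    intro y
    obtain ⟨w₁, hw₁, h₁⟩ := hlow y
    obtain ⟨w₂, hw₂, h₂⟩ := hhigh y
    exact isPreconnected_Ioo.intermediate_value hw₁ hw₂ hTc ⟨h₁, h₂⟩
  choose u hu hTu using hsurj
  have hum : StrictMono u := fun x y hxy =>
    (hTm.lt_iff_lt (hu x) (hu y)).1 (by rwa [hTu, hTu])
  have huT : ∀ w ∈ Ioo (0 : ℝ) 1, u (T w) = w := fun w hw => hTm.injOn (hu _) hw (hTu _)
  have hd : ∀ ξ, HasDerivAt u (p (u ξ)) ξ := by
    intro ξ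
    have hc : ContinuousAt u ξ := by
      refine (hum.strictMonoOn univ).continuousAt_of_image_mem_nhds univ_mem
        (mem_of_superset (isOpen_Ioo.mem_nhds (hu ξ)) fun w hw => ⟨T w, trivial, huT w hw⟩)
    have := HasDerivAt.of_local_left_inverse hc (hT _ (hu ξ)) (inv_pos.2 (hpos _ (hu ξ))).ne'
      (Eventually.of_forall hTu)
    rwa [inv_inv] at this
  have hderiv : deriv u = p ∘ u := funext fun ξ => (hd ξ).deriv
  have hdiff : Differentiable ℝ u := fun ξ => (hd ξ).differentiableAt
  have hC1 : ContDiff ℝ 1 u := contDiff_one_iff_deriv.2 ⟨hdiff, by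
    rw [hderiv]; exact hp.continuousOn.comp_continuous hdiff.continuous hu⟩
  have hC2 : ContDiff ℝ (1 + 1) u := contDiff_succ_iff_deriv.2 ⟨hdiff, by simp, by
    rw [hderiv]; exact hp.comp_contDiff hC1 hu⟩
  refine ⟨u, by simpa [one_add_one_eq_two] using hC2, hu, hd, ?_, ?_⟩
  · refine tendsto_order.2 ⟨fun b hb => Eventually.of_forall fun ξ => hb.trans (hu ξ).1,
      fun b hb => ?_⟩
    obtain ⟨w, hw0, hw1⟩ := exists_between (lt_min hb one_pos)
    have hw : w ∈ Ioo (0 : ℝ) 1 := ⟨hw0, hw1.trans_le (min_le_right _ _)⟩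
    filter_upwards [eventually_le_atBot (T w)] with ξ hξ
    exact ((hum.monotone hξ).trans_eq (huT w hw)).trans_lt (hw1.trans_le (min_le_left _ _))
  · refine tendsto_order.2 ⟨fun b hb => ?_,
      fun b hb => Eventually.of_forall fun ξ => (hu ξ).2.trans hb⟩
    obtain ⟨w, hw0, hw1⟩ := exists_between (max_lt hb one_pos)
    have hw : w ∈ Ioo (0 : ℝ) 1 := ⟨(le_max_right _ _).trans_lt hw0, hw1⟩
    filter_upwards [eventually_ge_atTop (T w)] with ξ hξ
    exact ((le_max_left _ _).trans_lt hw0).trans_le ((huT w hw).symm.trans_le (hum.monotone hξ))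

namespace FluxData

variable (F : FluxData)

theorem mem_of_le {u s t : ℝ} (ht : (u, t) ∈ OmegaSet F.ω) (hs : 0 ≤ s) (hst : s ≤ t) :
    (u, s) ∈ OmegaSet F.ω := by
  refine ⟨ht.1, lt_of_le_of_lt (ENNReal.ofReal_le_ofReal ?_) ht.2⟩
  simp only
  rw [abs_of_nonneg hs, abs_of_nonneg (hs.trans hst)]
  exact hst

theorem zero_mem {u : ℝ} (hu : u ∈ Icc (0 : ℝ) 1) : (u, (0 : ℝ)) ∈ OmegaSet F.ω :=
  ⟨hu, by simpa using F.ω_pos u hu⟩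

theorem mem_iff {u s : ℝ} (hu : u ∈ Icc (0 : ℝ) 1) (hs : 0 ≤ s) :
    (u, s) ∈ OmegaSet F.ω ↔ ENNReal.ofReal s < F.ω u := by
  simp [OmegaSet, hu.1, hu.2, abs_of_nonneg hs]

theorem exists_gt_mem {u s : ℝ} (hs : 0 ≤ s) (h : (u, s) ∈ OmegaSet F.ω) :
    ∃ t, s < t ∧ (u, t) ∈ OmegaSet F.ω := by
  have hu : u ∈ Icc (0 : ℝ) 1 := h.1
  obtain ⟨t, ht0, hst, ht⟩ := ENNReal.lt_iff_exists_real_btwn.1 ((F.mem_iff hu hs).1 h)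
  exact ⟨t, (ENNReal.ofReal_lt_ofReal_iff_of_nonneg hs).1 hst, (F.mem_iff hu ht0).2 ht⟩

theorem a_zero {u : ℝ} (hu : u ∈ Icc (0 : ℝ) 1) : F.a u 0 = 0 := by
  have := F.a_odd u 0 (F.zero_mem hu)
  rw [neg_zero] at this
  linarith

theorem continuousOn_section {u t : ℝ} (ht : (u, t) ∈ OmegaSet F.ω) :
    ContinuousOn (F.a u) (Icc 0 t) := fun s hs => by
  obtain ⟨d, -, hd⟩ := F.a_deriv_pos u s (F.mem_of_le ht hs.1 hs.2)
  exact hd.continuousAt.continuousWithinAt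

theorem a_lt_a {u s t : ℝ} (hs : 0 ≤ s) (hst : s < t) (ht : (u, t) ∈ OmegaSet F.ω) :
    F.a u s < F.a u t := by
  have hm : StrictMonoOn (F.a u) (Icc 0 t) := by
    apply strictMonoOn_of_deriv_pos (convex_Icc _ _) (F.continuousOn_section ht)
    rw [interior_Icc]
    intro x hx
    obtain ⟨d, h0, hd⟩ := F.a_deriv_pos u x (F.mem_of_le ht hx.1.le hx.2.le)
    rwa [hd.deriv]
  exact hm ⟨hs, hst.le⟩ ⟨hs.trans hst.le, le_rfl⟩ hst

theorem a_le_a {u s t : ℝ} (hs : 0 ≤ s) (hst : s ≤ t) (ht : (u, t) ∈ OmegaSet F.ω) :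
    F.a u s ≤ F.a u t := by
  rcases eq_or_lt_of_le hst with rfl | h
  · exact le_rfl
  · exact (F.a_lt_a hs h ht).le

theorem a_nonneg {u s : ℝ} (hs : 0 ≤ s) (h : (u, s) ∈ OmegaSet F.ω) : 0 ≤ F.a u s := by
  rw [← F.a_zero h.1]
  exact F.a_le_a le_rfl hs h

theorem ofReal_a_lt_aplus {u s : ℝ} (hs : 0 ≤ s) (h : (u, s) ∈ OmegaSet F.ω) :
    ENNReal.ofReal (F.a u s) < F.aplus u := by
  obtain ⟨t, hst, ht⟩ := F.exists_gt_mem hs h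
  have h1 : ENNReal.ofReal (F.a u s) < ENNReal.ofReal (F.a u t) :=
    (ENNReal.ofReal_lt_ofReal_iff_of_nonneg (F.a_nonneg hs h)).2 (F.a_lt_a hs hst ht)
  refine h1.trans_le ?_
  rw [F.aplus_def u h.1]
  exact le_iSup₂ (f := fun s (_ : s ∈ {s : ℝ | 0 < s ∧ (u, s) ∈ OmegaSet F.ω}) =>
    ENNReal.ofReal (F.a u s)) t ⟨hs.trans_lt hst, ht⟩

theorem g_spec_of_pos {u v : ℝ} (hu : u ∈ Icc (0 : ℝ) 1) (hv : 0 < v)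
    (h : ENNReal.ofReal v < F.aplus u) :
    0 < F.g u v ∧ (u, F.g u v) ∈ OmegaSet F.ω ∧ F.a u (F.g u v) = v := by
  have hD : (u, v) ∈ DSet F.aplus := ⟨hu, by simpa [abs_of_pos hv] using h⟩
  obtain ⟨hm, ha⟩ := F.g_spec _ hD
  simp only at hm ha
  refine ⟨?_, hm, ha⟩
  by_contra hneg
  push Not at hneg
  have hm' : (u, -F.g u v) ∈ OmegaSet F.ω := ⟨hm.1, by simpa using hm.2⟩
  have h1 := F.a_odd u _ hm
  have h2 := F.a_nonneg (neg_nonneg.2 hneg) hm'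
  linarith

theorem eventually_mem {u s : ℝ} (hs : 0 ≤ s) (h : (u, s) ∈ OmegaSet F.ω) :
    ∀ᶠ w in 𝓝[Icc 0 1] u, (w, s) ∈ OmegaSet F.ω := by
  have h1 := F.ω_lsc u h.1 _ ((F.mem_iff h.1 hs).1 h)
  filter_upwards [h1, self_mem_nhdsWithin] with w hw hwI
  exact (F.mem_iff hwI hs).2 hw

theorem continuousWithinAt_a {u s : ℝ} (hs : 0 ≤ s) (h : (u, s) ∈ OmegaSet F.ω) :
    ContinuousWithinAt (fun w => F.a w s) (Icc 0 1) u := by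
  have hc := F.a_C1.continuousOn (u, s) h
  have ht : Tendsto (fun w : ℝ => (w, s)) (𝓝[Icc 0 1] u) (𝓝[OmegaSet F.ω] (u, s)) := by
    apply tendsto_nhdsWithin_of_tendsto_nhds_of_eventually_within _ _ (F.eventually_mem hs h)
    have : Continuous (fun w : ℝ => (w, s)) := by fun_prop
    exact this.continuousAt.tendsto.mono_left nhdsWithin_le_nhds
  exact hc.tendsto.comp ht

theorem mem_nhds_Omega {u s : ℝ} (hu : u ∈ Ioo (0 : ℝ) 1) (hs : 0 ≤ s)
    (h : (u, s) ∈ OmegaSet F.ω) : OmegaSet F.ω ∈ 𝓝 (u, s) := by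
  obtain ⟨t, hst, ht⟩ := F.exists_gt_mem hs h
  have h1 := F.eventually_mem (hs.trans hst.le) ht
  have hI : 𝓝[Icc 0 1] u = 𝓝 u := nhdsWithin_eq_nhds.2 (Icc_mem_nhds hu.1 hu.2)
  rw [hI] at h1
  have h2 : ∀ᶠ x in 𝓝 s, |x| < t :=
    continuous_abs.continuousAt.eventually (gt_mem_nhds (by rwa [abs_of_nonneg hs]))
  rw [nhds_prod_eq]
  filter_upwards [h1.prod_mk h2] with p hp
  refine ⟨hp.1.1, lt_of_le_of_lt (ENNReal.ofReal_le_ofReal ?_) hp.1.2⟩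
  exact hp.2.le.trans (le_abs_self _)

/-- The inverse in `s` of the perturbed flux `a(u,s) + ε s`. -/
def perturbedInv (ε u v : ℝ) : ℝ :=
  Classical.epsilon fun s => 0 ≤ s ∧ (u, s) ∈ OmegaSet F.ω ∧ F.a u s + ε * s = v

variable {ε : ℝ}

theorem exists_perturbed_ge {u v : ℝ} (hε : 0 < ε) (hu : u ∈ Icc (0 : ℝ) 1) (hv : 0 ≤ v) :
    ∃ s, 0 ≤ s ∧ (u, s) ∈ OmegaSet F.ω ∧ v ≤ F.a u s + ε * s := by
  by_cases hω : F.ω u < ⊤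
  · have h1 : ENNReal.ofReal v < F.aplus u := by
      rw [F.aplus_top u hu hω]; exact ENNReal.ofReal_lt_top
    rw [F.aplus_def u hu, lt_iSup_iff] at h1
    obtain ⟨s, h1⟩ := h1
    rw [lt_iSup_iff] at h1
    obtain ⟨⟨hs, hm⟩, h1⟩ := h1
    refine ⟨s, hs.le, hm, ?_⟩
    have := (ENNReal.ofReal_lt_ofReal_iff_of_nonneg hv).1 h1
    nlinarith
  · have hm : (u, v / ε) ∈ OmegaSet F.ω := by
      rw [F.mem_iff hu (by positivity)]
      rw [not_lt_top_iff.1 hω]; exact ENNReal.ofReal_lt_top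
    refine ⟨v / ε, by positivity, hm, ?_⟩
    have := F.a_nonneg (by positivity) hm
    rw [mul_div_cancel₀ _ hε.ne']
    linarith

theorem perturbedInv_spec {u v : ℝ} (hε : 0 < ε) (hu : u ∈ Icc (0 : ℝ) 1) (hv : 0 ≤ v) :
    0 ≤ F.perturbedInv ε u v ∧ (u, F.perturbedInv ε u v) ∈ OmegaSet F.ω ∧
      F.a u (F.perturbedInv ε u v) + ε * F.perturbedInv ε u v = v := by
  apply Classical.epsilon_spec (p := fun s => 0 ≤ s ∧ (u, s) ∈ OmegaSet F.ω ∧ F.a u s + ε * s = v)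
  obtain ⟨t, ht0, ht, hvt⟩ := F.exists_perturbed_ge hε hu hv
  have hc : ContinuousOn (fun s => F.a u s + ε * s) (Icc 0 t) :=
    (F.continuousOn_section ht).add (by fun_prop)
  obtain ⟨s, hs, hsv⟩ := intermediate_value_Icc ht0 hc
    (show v ∈ Icc _ _ from ⟨by simpa [F.a_zero hu] using hv, hvt⟩)
  exact ⟨s, hs.1, F.mem_of_le ht hs.1 hs.2, hsv⟩

theorem lt_perturbedInv {u v s : ℝ} (hε : 0 < ε) (hu : u ∈ Icc (0 : ℝ) 1) (hv : 0 ≤ v)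
    (hs : (u, s) ∈ OmegaSet F.ω) (h : F.a u s + ε * s < v) : s < F.perturbedInv ε u v := by
  obtain ⟨h0, hm, he⟩ := F.perturbedInv_spec hε hu hv
  by_contra hle
  push Not at hle
  have := F.a_le_a h0 hle hs
  nlinarith

theorem perturbedInv_lt {u v s : ℝ} (hε : 0 < ε) (hu : u ∈ Icc (0 : ℝ) 1) (hv : 0 ≤ v)
    (hs0 : 0 ≤ s) (h : v < F.a u s + ε * s) : F.perturbedInv ε u v < s := by
  obtain ⟨h0, hm, he⟩ := F.perturbedInv_spec hε hu hv
  by_contra hle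
  push Not at hle
  have := F.a_le_a hs0 hle hm
  nlinarith

theorem perturbedInv_pos {u v : ℝ} (hε : 0 < ε) (hu : u ∈ Icc (0 : ℝ) 1) (hv : 0 < v) :
    0 < F.perturbedInv ε u v :=
  F.lt_perturbedInv hε hu hv.le (F.zero_mem hu) (by simpa [F.a_zero hu] using hv)

theorem perturbedInv_le {u v : ℝ} (hε : 0 < ε) (hu : u ∈ Icc (0 : ℝ) 1) (hv : 0 ≤ v) :
    F.perturbedInv ε u v ≤ v / ε := by
  obtain ⟨h0, hm, he⟩ := F.perturbedInv_spec hε hu hv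
  rw [le_div_iff₀ hε]
  have := F.a_nonneg h0 hm
  linarith

theorem perturbedInv_mono {u v w : ℝ} (hε : 0 < ε) (hu : u ∈ Icc (0 : ℝ) 1) (hv : 0 ≤ v)
    (hvw : v ≤ w) : F.perturbedInv ε u v ≤ F.perturbedInv ε u w := by
  obtain ⟨h0, hm, he⟩ := F.perturbedInv_spec hε hu hv
  obtain ⟨h0', hm', he'⟩ := F.perturbedInv_spec hε hu (hv.trans hvw)
  by_contra! hlt
  have := F.a_le_a h0' hlt.le hm
  nlinarith

theorem perturbedInv_sub_le {u v w : ℝ} (hε : 0 < ε) (hu : u ∈ Icc (0 : ℝ) 1) (hv : 0 ≤ v)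
    (hw : 0 ≤ w) : |F.perturbedInv ε u v - F.perturbedInv ε u w| ≤ |v - w| / ε := by
  wlog hvw : v ≤ w generalizing v w
  · rw [abs_sub_comm, abs_sub_comm v]
    exact this hw hv (le_of_not_ge hvw)
  obtain ⟨h0, hm, he⟩ := F.perturbedInv_spec hε hu hv
  obtain ⟨h0', hm', he'⟩ := F.perturbedInv_spec hε hu hw
  have hmono := F.perturbedInv_mono hε hu hv hvw
  rw [abs_sub_comm, abs_sub_comm v, abs_of_nonneg (sub_nonneg.2 hmono),
    abs_of_nonneg (sub_nonneg.2 hvw), le_div_iff₀ hε]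
  have := F.a_le_a h0 hmono hm'
  linarith

theorem continuousOn_perturbedInv {v : ℝ} (hε : 0 < ε) (hv : 0 ≤ v) :
    ContinuousOn (fun u => F.perturbedInv ε u v) (Icc 0 1) := by
  intro u hu
  obtain ⟨h0, hm, he⟩ := F.perturbedInv_spec hε hu hv
  refine tendsto_order.2 ⟨fun b hb => ?_, fun b hb => ?_⟩
  · rcases lt_or_ge b 0 with hb0 | hb0
    · filter_upwards [self_mem_nhdsWithin] with w hw
      exact hb0.trans_le (F.perturbedInv_spec hε hw hv).1
    · have hmb := F.mem_of_le hm hb0 hb.le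
      have hlt : F.a u b + ε * b < v := by
        have := F.a_le_a hb0 hb.le hm
        nlinarith
      have hc := (F.continuousWithinAt_a hb0 hmb).add
        (continuousWithinAt_const (b := ε * b) (s := Icc (0 : ℝ) 1) (x := u))
      filter_upwards [hc.eventually (gt_mem_nhds hlt), F.eventually_mem hb0 hmb] with w hw hwm
      exact F.lt_perturbedInv hε hwm.1 hv hwm hw
  · obtain ⟨t, hst, ht⟩ := F.exists_gt_mem h0 hm
    have hbm : (u, min b t) ∈ OmegaSet F.ω :=
      F.mem_of_le ht (h0.trans (le_min hb.le hst.le)) (min_le_right _ _)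
    have hlt : F.perturbedInv ε u v < min b t := lt_min hb hst
    have hb0 : 0 ≤ min b t := h0.trans hlt.le
    have hlt' : v < F.a u (min b t) + ε * min b t := by
      have := F.a_lt_a h0 hlt hbm
      nlinarith
    have hc := (F.continuousWithinAt_a hb0 hbm).add
      (continuousWithinAt_const (b := ε * min b t) (s := Icc (0 : ℝ) 1) (x := u))
    filter_upwards [hc.eventually (lt_mem_nhds hlt'), self_mem_nhdsWithin] with w hw hwI
    exact (F.perturbedInv_lt hε hwI hv hb0 hw).trans_le (min_le_left _ _)

theorem continuousOn_perturbedInv_comp {V : ℝ → ℝ} {s : Set ℝ} (hε : 0 < ε)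
    (hs : s ⊆ Icc 0 1) (hV : ContinuousOn V s) (hV0 : ∀ u ∈ s, 0 ≤ V u) :
    ContinuousOn (fun u => F.perturbedInv ε u (V u)) s := by
  intro u hu
  have h1 : Tendsto (fun w => F.perturbedInv ε w (V u)) (𝓝[s] u)
      (𝓝 (F.perturbedInv ε u (V u))) :=
    ((F.continuousOn_perturbedInv hε (hV0 u hu)).mono hs) u hu
  have h2 : Tendsto (fun w => F.perturbedInv ε w (V w) - F.perturbedInv ε w (V u)) (𝓝[s] u)
      (𝓝 0) := by
    have h3 : Tendsto (fun w => |V w - V u| / ε) (𝓝[s] u) (𝓝 0) := by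
      have := (((hV u hu).tendsto.sub_const (V u)).abs).div_const ε
      simpa using this
    refine squeeze_zero_norm' ?_ h3
    filter_upwards [self_mem_nhdsWithin] with w hw
    exact F.perturbedInv_sub_le hε (hs hw) (hV0 w hw) (hV0 u hu)
  simpa [ContinuousWithinAt] using h2.add h1

theorem exists_local_bounds {u₀ : ℝ} (hu₀ : u₀ ∈ Icc (0 : ℝ) 1) :
    ∃ r > 0, ∃ c > 0, ∃ C > 0, ∀ᶠ u in 𝓝[Icc 0 1] u₀, (u, r) ∈ OmegaSet F.ω ∧
      ∀ s t, 0 ≤ s → s ≤ t → t ≤ r →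
        c * (t - s) ≤ F.a u t - F.a u s ∧ F.a u t - F.a u s ≤ C * (t - s) := by
  have h0 := F.zero_mem hu₀
  have hC := F.a_C1 (u₀, 0) h0
  rw [show (1 : WithTop ℕ∞) = 0 + 1 from rfl,
    contDiffWithinAt_succ_iff_hasFDerivWithinAt' (by simp)] at hC
  obtain ⟨U, hU, -, -, f', hf', hf'c⟩ := hC
  rw [insert_eq_of_mem h0] at hU
  have key : ∀ u s, 0 ≤ s → (u, s) ∈ OmegaSet F.ω → (u, s) ∈ U →
      ∃ d > 0, HasDerivAt (F.a u) d s ∧ f' (u, s) (0, 1) = d := by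
    intro u s hs hm hmU
    obtain ⟨d, hd0, hd⟩ := F.a_deriv_pos u s hm
    refine ⟨d, hd0, hd, ?_⟩
    obtain ⟨t, hst, ht⟩ := F.exists_gt_mem hs hm
    have hcurve : HasDerivWithinAt (fun x : ℝ => (u, x)) ((0 : ℝ), (1 : ℝ)) (Icc s t) s :=
      ((hasDerivAt_const s u).prodMk (hasDerivAt_id s)).hasDerivWithinAt
    have hcomp := (hf' (u, s) hmU).comp_hasDerivWithinAt s hcurve
      (fun x hx => F.mem_of_le ht (hs.trans hx.1) hx.2)
    exact (uniqueDiffOn_Icc hst s ⟨le_rfl, hst.le⟩).eq_deriv _ hcomp hd.hasDerivWithinAt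
  obtain ⟨d₀, hd₀, -, hfd₀⟩ := key u₀ 0 le_rfl h0 (mem_of_mem_nhdsWithin h0 hU)
  have hcont : Tendsto (fun p => f' p (0, 1)) (𝓝[OmegaSet F.ω] (u₀, 0)) (𝓝 d₀) := by
    rw [← hfd₀]
    exact (hf'c.continuousWithinAt.clm_apply continuousWithinAt_const).tendsto
  have hev : ∀ᶠ p in 𝓝[OmegaSet F.ω] (u₀, 0),
      p ∈ U ∧ d₀ / 2 < f' p (0, 1) ∧ f' p (0, 1) < 2 * d₀ :=
    (eventually_mem_set.2 hU).and ((hcont.eventually (lt_mem_nhds (by linarith))).and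
      (hcont.eventually (gt_mem_nhds (by linarith))))
  rw [eventually_nhdsWithin_iff, Metric.eventually_nhds_iff] at hev
  obtain ⟨δ, hδ, hball⟩ := hev
  obtain ⟨t₁, ht₁, hmt₁⟩ := F.exists_gt_mem le_rfl h0
  have hr : 0 < min (δ / 2) t₁ := lt_min (by linarith) ht₁
  have hrm : (u₀, min (δ / 2) t₁) ∈ OmegaSet F.ω := F.mem_of_le hmt₁ hr.le (min_le_right _ _)
  have hrδ : min (δ / 2) t₁ ≤ δ / 2 := min_le_left _ _
  generalize min (δ / 2) t₁ = r at hr hrm hrδ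
  refine ⟨r, hr, d₀ / 2, by linarith, 2 * d₀, by linarith, ?_⟩
  have hnear : ∀ᶠ u in 𝓝[Icc 0 1] u₀, dist u u₀ < δ :=
    nhdsWithin_le_nhds (Metric.ball_mem_nhds u₀ hδ)
  filter_upwards [F.eventually_mem hr.le hrm, hnear] with u hu hud
  refine ⟨hu, fun s t hs hst htr => ?_⟩
  have hder : ∀ x ∈ Icc s t, ∃ d, HasDerivAt (F.a u) d x ∧ d₀ / 2 < d ∧ d < 2 * d₀ := by
    intro x hx
    have hx0 : 0 ≤ x := hs.trans hx.1
    have hm : (u, x) ∈ OmegaSet F.ω := F.mem_of_le hu hx0 (hx.2.trans htr)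
    have hb := hball (y := (u, x)) (by
      rw [Prod.dist_eq]
      refine max_lt hud ?_
      rw [Real.dist_eq, sub_zero, abs_of_nonneg hx0]
      linarith [hx.2]) hm
    obtain ⟨d, -, hd, he⟩ := key u x hx0 hm hb.1
    rw [he] at hb
    exact ⟨d, hd, hb.2⟩
  have hc : ContinuousOn (F.a u) (Icc s t) := fun x hx => by
    obtain ⟨d, hd, -⟩ := hder x hx
    exact hd.continuousAt.continuousWithinAt
  have hdiff : DifferentiableOn ℝ (F.a u) (interior (Icc s t)) := fun x hx => by
    obtain ⟨d, hd, -⟩ := hder x (interior_subset hx)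
    exact hd.differentiableAt.differentiableWithinAt
  constructor
  · refine (convex_Icc s t).mul_sub_le_image_sub_of_le_deriv hc hdiff (fun x hx => ?_) s
      (left_mem_Icc.2 hst) t (right_mem_Icc.2 hst) hst
    obtain ⟨d, hd, h⟩ := hder x (interior_subset hx)
    rw [hd.deriv]; exact h.1.le
  · refine (convex_Icc s t).image_sub_le_mul_sub_of_deriv_le hc hdiff (fun x hx => ?_) s
      (left_mem_Icc.2 hst) t (right_mem_Icc.2 hst) hst
    obtain ⟨d, hd, h⟩ := hder x (interior_subset hx)
    rw [hd.deriv]; exact h.2.le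

theorem exists_uniform_bounds :
    ∃ r > 0, ∃ c > 0, ∃ C > 0, ∀ u ∈ Icc (0 : ℝ) 1, (u, r) ∈ OmegaSet F.ω ∧
      ∀ s t, 0 ≤ s → s ≤ t → t ≤ r →
        c * (t - s) ≤ F.a u t - F.a u s ∧ F.a u t - F.a u s ≤ C * (t - s) := by
  refine isCompact_Icc.induction_on (p := fun S => ∃ r > 0, ∃ c > 0, ∃ C > 0,
    ∀ u ∈ S, (u, r) ∈ OmegaSet F.ω ∧ ∀ s t, 0 ≤ s → s ≤ t → t ≤ r →
      c * (t - s) ≤ F.a u t - F.a u s ∧ F.a u t - F.a u s ≤ C * (t - s)) ?_ ?_ ?_ ?_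
  · exact ⟨1, one_pos, 1, one_pos, 1, one_pos, fun u hu => hu.elim⟩
  · rintro S T hST ⟨r, hr, c, hc, C, hC, h⟩
    exact ⟨r, hr, c, hc, C, hC, fun u hu => h u (hST hu)⟩
  · rintro S T ⟨r, hr, c, hc, C, hC, h⟩ ⟨r', hr', c', hc', C', hC', h'⟩
    refine ⟨min r r', lt_min hr hr', min c c', lt_min hc hc', max C C', lt_max_of_lt_left hC, ?_⟩
    rintro u (hu | hu)
    · refine ⟨F.mem_of_le (h u hu).1 (lt_min hr hr').le (min_le_left _ _), fun s t hs hst ht => ?_⟩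
      obtain ⟨h1, h2⟩ := (h u hu).2 s t hs hst (ht.trans (min_le_left _ _))
      exact ⟨(mul_le_mul_of_nonneg_right (min_le_left _ _) (sub_nonneg.2 hst)).trans h1,
        h2.trans (mul_le_mul_of_nonneg_right (le_max_left _ _) (sub_nonneg.2 hst))⟩
    · refine ⟨F.mem_of_le (h' u hu).1 (lt_min hr hr').le (min_le_right _ _), fun s t hs hst ht => ?_⟩
      obtain ⟨h1, h2⟩ := (h' u hu).2 s t hs hst (ht.trans (min_le_right _ _))
      exact ⟨(mul_le_mul_of_nonneg_right (min_le_right _ _) (sub_nonneg.2 hst)).trans h1,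
        h2.trans (mul_le_mul_of_nonneg_right (le_max_right _ _) (sub_nonneg.2 hst))⟩
  · intro u hu
    obtain ⟨r, hr, c, hc, C, hC, h⟩ := F.exists_local_bounds hu
    exact ⟨_, h, r, hr, c, hc, C, hC, fun u hu => hu⟩

/-- On `[0,1]` the reaction term is bounded, and its derivative is bounded. -/
theorem exists_reaction_bounds :
    ∃ M > 0, ∃ L > 0, (∀ u ∈ Icc (0 : ℝ) 1, 0 ≤ F.f u ∧ F.f u ≤ M) ∧
      ∀ u ∈ Ioo (0 : ℝ) 1, ∃ d, |d| ≤ L ∧ HasDerivAt F.f d u := by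
  obtain ⟨M, hM⟩ := isCompact_Icc.exists_bound_of_continuousOn F.f_C1.continuousOn
  obtain ⟨L, hL⟩ := isCompact_Icc.exists_bound_of_continuousOn
    (F.f_C1.continuousOn_derivWithin (uniqueDiffOn_Icc zero_lt_one) le_rfl)
  refine ⟨max M 1, by positivity, max L 1, by positivity, fun u hu => ⟨?_, ?_⟩, fun u hu => ?_⟩
  · rcases eq_or_lt_of_le hu.1 with rfl | h0
    · exact F.f_zero.ge
    rcases eq_or_lt_of_le hu.2 with rfl | h1
    · exact F.f_one.ge
    exact (F.f_pos u ⟨h0, h1⟩).le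
  · exact (le_abs_self _).trans ((hM u hu).trans (le_max_left _ _))
  · have hI : Icc (0 : ℝ) 1 ∈ 𝓝 u := Icc_mem_nhds hu.1 hu.2
    refine ⟨derivWithin F.f (Icc 0 1) u, (hL u (Ioo_subset_Icc_self hu)).trans (le_max_left _ _), ?_⟩
    exact ((F.f_C1.differentiableOn (by simp) u
      (Ioo_subset_Icc_self hu)).hasDerivWithinAt).hasDerivAt hI

theorem mul_f_le_of_deriv_le {V : ℝ → ℝ} {α β k L : ℝ} (hα : 0 ≤ α) (hβ : β ≤ 1) (hk : 0 < k)
    (hL : ∀ u ∈ Ioo (0 : ℝ) 1, ∃ d, |d| ≤ L ∧ HasDerivAt F.f d u)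
    (hV : ContinuousOn V (Icc α β)) (hend : k * F.f β ≤ V β)
    (hd : ∀ u ∈ Ioo α β, V u < k * F.f u → ∃ d, HasDerivAt V d u ∧ d ≤ -(k * L)) :
    ∀ u ∈ Icc α β, k * F.f u ≤ V u := by
  intro u hu
  by_contra! hlt
  have hcont : ContinuousOn (fun x => k * F.f x - V x) (Icc u β) :=
    (continuousOn_const.mul (F.f_C1.continuousOn.mono
      (Icc_subset_Icc (hα.trans hu.1) hβ))).sub (hV.mono (Icc_subset_Icc_left hu.1))
  have := le_of_deriv_nonneg_of_pos hu.2 hcont (fun x hx hpos => by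
    obtain ⟨d, hdV, hdL⟩ := hd x ⟨hu.1.trans_lt hx.1, hx.2⟩ (sub_pos.1 hpos)
    obtain ⟨e, he, hdf⟩ := hL x ⟨(hα.trans hu.1).trans_lt hx.1, hx.2.trans_le hβ⟩
    refine ⟨k * e - d, ?_, (hdf.const_mul k).sub hdV⟩
    have := neg_le_of_abs_le he
    nlinarith) (sub_pos.2 hlt)
  linarith

theorem Hfun_nonneg {u v : ℝ} (hu : u ∈ Icc (0 : ℝ) 1) (hv : 0 < v) : 0 ≤ Hfun F u v := by
  unfold Hfun
  split_ifs with h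
  · exact (one_div_pos.2 (F.g_spec_of_pos hu hv h).1).le
  · exact le_rfl

theorem exists_mul_f_le_Vsol {σ : ℝ} {W : ℝ → ℝ} (hσ : 0 ≤ σ) (hW : IsVsol F σ W) :
    ∃ k > 0, ∀ u ∈ Icc (0 : ℝ) 1, k * F.f u ≤ W u := by
  obtain ⟨r, hr, c, hc, C, hC, hb⟩ := F.exists_uniform_bounds
  obtain ⟨M, hM, L, hL, hfM, hfL⟩ := F.exists_reaction_bounds
  obtain ⟨hWc, hW1, hWpos, hWd⟩ := hW
  set k := min (c * r / M) (min 1 (c / (σ + L))) with hkdef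
  have hk : 0 < k := by positivity
  have hk1 : k * M ≤ c * r := (le_div_iff₀ hM).1 (min_le_left _ _)
  have hk2 : k ≤ 1 := (min_le_right _ _).trans (min_le_left _ _)
  have hk3 : k * (σ + L) ≤ c :=
    (le_div_iff₀ (by positivity)).1 ((min_le_right _ _).trans (min_le_right _ _))
  clear_value k
  refine ⟨k, hk, F.mul_f_le_of_deriv_le le_rfl le_rfl hk hfL hWc (by simp [F.f_one, hW1]) ?_⟩
  intro u hu hlt
  have huI := Ioo_subset_Icc_self hu
  refine ⟨_, hWd u hu, ?_⟩
  have hpos := hWpos u hu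
  have hf := F.f_pos u hu
  obtain ⟨hrm, hbu⟩ := hb u huI
  have har : c * r ≤ F.a u r := by
    have := (hbu 0 r le_rfl hr.le le_rfl).1
    simpa [F.a_zero huI] using this
  have hWa : W u < F.a u r := by nlinarith [(hfM u huI).2]
  have hlt' : ENNReal.ofReal (W u) < F.aplus u :=
    (ENNReal.ofReal_le_ofReal hWa.le).trans_lt (F.ofReal_a_lt_aplus hr.le hrm)
  obtain ⟨hg0, hgm, hga⟩ := F.g_spec_of_pos huI hpos hlt'
  have hgr : F.g u (W u) ≤ r := by
    by_contra! h
    have := F.a_lt_a hr.le h hgm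
    linarith
  have hcg : c * F.g u (W u) ≤ W u := by
    have := (hbu 0 _ le_rfl hg0.le hgr).1
    rwa [F.a_zero huI, hga, sub_zero, sub_zero] at this
  have hH : c / k ≤ F.f u * Hfun F u (W u) := by
    rw [Hfun, if_pos hlt', mul_one_div, div_le_div_iff₀ hk hg0]
    linarith
  have hck : σ + L ≤ c / k := by
    rw [le_div_iff₀ hk]; linarith
  nlinarith

/-- The perturbed slope controls the limit slope near the endpoints, where `f` is small. -/
theorem perturbed_slope_le_of_small {ε δ r c C k u v : ℝ} (hδ : 0 < δ) (hr : 0 < r) (hc : 0 < c)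
    (hC : 0 < C) (hk : 0 < k) (hu : u ∈ Ioo (0 : ℝ) 1) (hrm : (u, r) ∈ OmegaSet F.ω)
    (hb : ∀ s t, 0 ≤ s → s ≤ t → t ≤ r →
      c * (t - s) ≤ F.a u t - F.a u s ∧ F.a u t - F.a u s ≤ C * (t - s))
    (hv : 0 < v) (hkv : k * F.f u ≤ v) (hfs : F.f u < δ * r / 2) (hε : 0 < ε) (hεc : ε < c)
    (hεδ : ε * C ≤ δ * c * k) :
    F.f u / F.perturbedInv ε u v ≤ δ + F.f u * Hfun F u v := by
  have huI := Ioo_subset_Icc_self hu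
  have hf := F.f_pos u hu
  have hH := F.Hfun_nonneg huI hv
  obtain ⟨-, hsm, hsv⟩ := F.perturbedInv_spec hε huI hv.le
  have hs := F.perturbedInv_pos hε huI hv
  generalize F.perturbedInv ε u v = s at hsm hsv hs ⊢
  by_cases hsδ : F.f u / s ≤ δ
  · nlinarith
  push Not at hsδ
  rw [lt_div_iff₀ hs] at hsδ
  have hsr : s < r / 2 := by
    by_contra! h
    nlinarith
  have hva : v < F.a u r := by
    have := (hb s r hs.le (by linarith) le_rfl).1
    nlinarith
  have hlt : ENNReal.ofReal v < F.aplus u :=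
    (ENNReal.ofReal_le_ofReal hva.le).trans_lt (F.ofReal_a_lt_aplus hr.le hrm)
  obtain ⟨hg0, hgm, hga⟩ := F.g_spec_of_pos huI hv hlt
  rw [Hfun, if_pos hlt]
  generalize F.g u v = t at hg0 hgm hga ⊢
  have htr : t ≤ r := by
    by_contra! h
    have := F.a_lt_a hr.le h hgm
    linarith
  have hst : s ≤ t := by
    by_contra! h
    have := F.a_lt_a hg0.le h hsm
    nlinarith
  have h1 := (hb s t hs.le hst htr).1
  have h2 := (hb 0 t le_rfl hg0.le htr).2
  rw [F.a_zero huI, hga, sub_zero, sub_zero] at h2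
  rw [mul_one_div, div_le_iff₀ hs, add_mul, div_mul_eq_mul_div]
  have h3 : c * (t - s) ≤ ε * s := by linarith
  have h4 : k * F.f u ≤ C * t := by linarith
  have h5 : c * k * (F.f u * (t - s)) ≤ c * k * (δ * s * t) := by
    calc c * k * (F.f u * (t - s)) = k * F.f u * (c * (t - s)) := by ring
      _ ≤ C * t * (ε * s) := mul_le_mul h4 h3 (by nlinarith) (by positivity)
      _ = (ε * C) * (s * t) := by ring
      _ ≤ δ * c * k * (s * t) := mul_le_mul_of_nonneg_right hεδ (by positivity)
      _ = c * k * (δ * s * t) := by ring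
  have h6 := (div_le_iff₀ hg0).2 (le_of_mul_le_mul_left h5 (by positivity))
  have h7 : F.f u = F.f u * (t - s) / t + F.f u * s / t := by
    field_simp
    ring
  linarith

theorem eventually_perturbed_slope_le {W : ℝ → ℝ} {u₀ δ M : ℝ} (hδ : 0 < δ) (hM : 0 < M)
    (hfM : ∀ u ∈ Icc (0 : ℝ) 1, 0 ≤ F.f u ∧ F.f u ≤ M) (hu₀ : u₀ ∈ Icc (0 : ℝ) 1)
    (hW : ContinuousOn W (Icc 0 1)) (hW0 : 0 < W u₀) :
    ∃ ε₀ > 0, ∀ᶠ u in 𝓝[Icc 0 1] u₀, ∀ ε ∈ Ioo 0 ε₀,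
      F.f u / F.perturbedInv ε u (W u) ≤ δ + F.f u * Hfun F u (W u) := by
  have step : ∀ t₁ > 0, (u₀, t₁) ∈ OmegaSet F.ω → F.a u₀ t₁ < W u₀ → ∃ ε₀ > 0,
      ∀ᶠ u in 𝓝[Icc 0 1] u₀, u ∈ Icc (0 : ℝ) 1 ∧ 0 < W u ∧
        ∀ ε ∈ Ioo 0 ε₀, t₁ < F.perturbedInv ε u (W u) := by
    intro t₁ ht₁ hm hlt
    refine ⟨(W u₀ - F.a u₀ t₁) / 2 / t₁, div_pos (by linarith) ht₁, ?_⟩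
    have hc : Tendsto (fun u => W u - F.a u t₁) (𝓝[Icc 0 1] u₀) (𝓝 (W u₀ - F.a u₀ t₁)) :=
      (hW u₀ hu₀).tendsto.sub (F.continuousWithinAt_a ht₁.le hm).tendsto
    filter_upwards [F.eventually_mem ht₁.le hm, (hW u₀ hu₀).eventually (lt_mem_nhds hW0),
      hc.eventually (lt_mem_nhds (show (W u₀ - F.a u₀ t₁) / 2 < _ by linarith))]
      with u hum hWu hlt'
    refine ⟨hum.1, hWu, fun ε hε => F.lt_perturbedInv hε.1 hum.1 hWu.le hum ?_⟩
    have := (lt_div_iff₀ ht₁).1 hε.2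
    linarith
  by_cases hlt : ENNReal.ofReal (W u₀) < F.aplus u₀
  · obtain ⟨hg0, hgm, hga⟩ := F.g_spec_of_pos hu₀ hW0 hlt
    generalize F.g u₀ (W u₀) = t₀ at hg0 hgm hga
    obtain ⟨t, ht₀t, htm⟩ := F.exists_gt_mem hg0.le hgm
    have hcont : ContinuousAt (fun x => M * (1 / (t₀ - x) - 1 / (t₀ + x))) 0 := by
      have h1 : t₀ - 0 ≠ 0 := by simpa using hg0.ne'
      have h2 : t₀ + 0 ≠ 0 := by simpa using hg0.ne'
      fun_prop (disch := assumption)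
    have hev : ∀ᶠ x in 𝓝 (0 : ℝ), M * (1 / (t₀ - x) - 1 / (t₀ + x)) < δ ∧ x < t₀ ∧
        x < t - t₀ :=
      (hcont.eventually (gt_mem_nhds (by simpa using hδ))).and
        ((gt_mem_nhds hg0).and (gt_mem_nhds (sub_pos.2 ht₀t)))
    obtain ⟨x, ⟨hx1, hx2, hx3⟩, hx0⟩ :=
      ((hev.filter_mono nhdsWithin_le_nhds).and
        (self_mem_nhdsWithin : Ioi (0 : ℝ) ∈ 𝓝[>] (0 : ℝ))).exists
    replace hx0 : 0 < x := hx0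
    have ht₁ : 0 < t₀ - x := by linarith
    have hm₂ : (u₀, t₀ + x) ∈ OmegaSet F.ω := F.mem_of_le htm (by linarith) (by linarith)
    have hm₁ : (u₀, t₀ - x) ∈ OmegaSet F.ω := F.mem_of_le hgm (by linarith) (by linarith)
    have ha1 : F.a u₀ (t₀ - x) < W u₀ := hga ▸ F.a_lt_a ht₁.le (by linarith) hgm
    have ha2 : W u₀ < F.a u₀ (t₀ + x) := by
      have := F.a_lt_a hg0.le (show t₀ < t₀ + x by linarith) hm₂
      linarith
    obtain ⟨ε₀, hε₀, hev⟩ := step _ ht₁ hm₁ ha1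
    refine ⟨ε₀, hε₀, ?_⟩
    have hc : Tendsto (fun u => F.a u (t₀ + x) - W u) (𝓝[Icc 0 1] u₀)
        (𝓝 (F.a u₀ (t₀ + x) - W u₀)) :=
      (F.continuousWithinAt_a (by linarith) hm₂).tendsto.sub (hW u₀ hu₀).tendsto
    filter_upwards [hev, F.eventually_mem (by linarith) hm₂,
      hc.eventually (lt_mem_nhds (sub_pos.2 ha2))] with u ⟨huI, hWu, hs⟩ hum hWa ε hε
    have hs' := hs ε hε
    generalize F.perturbedInv ε u (W u) = s at hs'
    have hlt' : ENNReal.ofReal (W u) < F.aplus u :=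
      (ENNReal.ofReal_le_ofReal (sub_pos.1 hWa).le).trans_lt
        (F.ofReal_a_lt_aplus (by linarith) hum)
    obtain ⟨hg0', hgm', hga'⟩ := F.g_spec_of_pos huI hWu hlt'
    rw [Hfun, if_pos hlt']
    generalize F.g u (W u) = τ at hg0' hgm' hga'
    have hτ : τ ≤ t₀ + x := by
      by_contra! h
      have := F.a_lt_a (by linarith) h hgm'
      linarith
    obtain ⟨hf0, hf1⟩ := hfM u huI
    have h1 : 1 / s ≤ 1 / (t₀ - x) := one_div_le_one_div_of_le ht₁ hs'.le
    have h2 : 1 / (t₀ + x) ≤ 1 / τ := one_div_le_one_div_of_le hg0' hτ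
    have h3 : 0 ≤ 1 / (t₀ - x) - 1 / (t₀ + x) :=
      sub_nonneg.2 (one_div_le_one_div_of_le ht₁ (by linarith))
    have h4 := mul_le_mul_of_nonneg_right hf1 h3
    have h5 := mul_le_mul_of_nonneg_left (sub_le_sub h1 h2) hf0
    rw [div_eq_mul_one_div]
    linarith
  · have hω : F.ω u₀ = ⊤ := by
      by_contra h
      exact hlt (by rw [F.aplus_top u₀ hu₀ (lt_top_iff_ne_top.2 h)]; exact ENNReal.ofReal_lt_top)
    have hMδ : 0 < M / δ := by positivity
    have hm : (u₀, M / δ) ∈ OmegaSet F.ω := by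
      rw [F.mem_iff hu₀ hMδ.le, hω]; exact ENNReal.ofReal_lt_top
    have ha : F.a u₀ (M / δ) < W u₀ :=
      (ENNReal.ofReal_lt_ofReal_iff_of_nonneg (F.a_nonneg hMδ.le hm)).1
        ((F.ofReal_a_lt_aplus hMδ.le hm).trans_le (not_lt.1 hlt))
    obtain ⟨ε₀, hε₀, hev⟩ := step _ hMδ hm ha
    refine ⟨ε₀, hε₀, ?_⟩
    filter_upwards [hev] with u ⟨huI, hWu, hs⟩ ε hε
    have hs' := hs ε hε
    obtain ⟨hf0, hf1⟩ := hfM u huI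
    have h1 : F.f u / F.perturbedInv ε u (W u) ≤ δ := by
      rw [div_le_iff₀ (hMδ.trans hs')]
      have := (div_lt_iff₀ hδ).1 hs'
      linarith
    have h2 := mul_nonneg hf0 (F.Hfun_nonneg huI hWu)
    linarith

theorem eventually_forall_perturbed_slope_le {σ δ : ℝ} {W : ℝ → ℝ} (hσ : 0 ≤ σ) (hδ : 0 < δ)
    (hW : IsVsol F σ W) :
    ∃ ε₀ > 0, ∀ ε ∈ Ioo 0 ε₀, ∀ u ∈ Ioo (0 : ℝ) 1,
      F.f u / F.perturbedInv ε u (W u) ≤ δ + F.f u * Hfun F u (W u) := by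
  obtain ⟨k, hk, hkW⟩ := F.exists_mul_f_le_Vsol hσ hW
  obtain ⟨r, hr, c, hc, C, hC, hb⟩ := F.exists_uniform_bounds
  obtain ⟨M, hM, L, hL, hfM, hfL⟩ := F.exists_reaction_bounds
  obtain ⟨hWc, hW1, hWpos, hWd⟩ := hW
  have hK : IsCompact (Icc (0 : ℝ) 1 ∩ F.f ⁻¹' Ici (δ * r / 2)) :=
    isCompact_Icc.of_isClosed_subset
      (F.f_C1.continuousOn.preimage_isClosed_of_isClosed isClosed_Icc isClosed_Ici)
      inter_subset_left
  have hin : ∃ ε₀ > 0, ∀ u ∈ Icc (0 : ℝ) 1 ∩ F.f ⁻¹' Ici (δ * r / 2), ∀ ε ∈ Ioo 0 ε₀,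
      F.f u / F.perturbedInv ε u (W u) ≤ δ + F.f u * Hfun F u (W u) := by
    refine hK.induction_on (p := fun S => ∃ ε₀ > 0, ∀ u ∈ S, ∀ ε ∈ Ioo 0 ε₀,
      F.f u / F.perturbedInv ε u (W u) ≤ δ + F.f u * Hfun F u (W u)) ?_ ?_ ?_ ?_
    · exact ⟨1, one_pos, fun u hu => hu.elim⟩
    · rintro S T hST ⟨ε₀, hε₀, h⟩
      exact ⟨ε₀, hε₀, fun u hu => h u (hST hu)⟩
    · rintro S T ⟨ε₁, hε₁, h₁⟩ ⟨ε₂, hε₂, h₂⟩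
      refine ⟨min ε₁ ε₂, lt_min hε₁ hε₂, ?_⟩
      rintro u (hu | hu) ε hε
      · exact h₁ u hu ε ⟨hε.1, hε.2.trans_le (min_le_left _ _)⟩
      · exact h₂ u hu ε ⟨hε.1, hε.2.trans_le (min_le_right _ _)⟩
    · rintro u ⟨huI, huf⟩
      have hfu : 0 < F.f u := lt_of_lt_of_le (by positivity) huf
      have hWu : 0 < W u := lt_of_lt_of_le (by positivity) (hkW u huI)
      obtain ⟨ε₀, hε₀, hev⟩ := F.eventually_perturbed_slope_le hδ hM hfM huI hWc hWu
      exact ⟨_, nhdsWithin_mono u inter_subset_left hev, ε₀, hε₀, fun u hu => hu⟩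
  obtain ⟨ε₀, hε₀, hin⟩ := hin
  refine ⟨min ε₀ (min c (δ * c * k / C)), by positivity, fun ε hε u hu => ?_⟩
  have huI := Ioo_subset_Icc_self hu
  rcases lt_or_ge (F.f u) (δ * r / 2) with hsm | hlg
  · have h1 := hε.2.trans_le ((min_le_right _ _).trans (min_le_left _ _))
    have h2 := hε.2.trans_le ((min_le_right _ _).trans (min_le_right _ _))
    exact F.perturbed_slope_le_of_small hδ hr hc hC hk hu (hb u huI).1 (hb u huI).2
      (hWpos u hu) (hkW u huI) hsm hε.1 h1 ((lt_div_iff₀ hC).1 h2).le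
  · exact hin u ⟨huI, hlg⟩ ε ⟨hε.1, hε.2.trans_le (min_le_left _ _)⟩

theorem exists_slope_bounds {κ : ℝ} (hε : 0 < ε) (hκ : 0 < κ) :
    ∃ K > 0, ∃ B > 0, ∀ u ∈ Icc (0 : ℝ) 1, ∀ v, κ ≤ v →
      |F.f u / F.perturbedInv ε u v| ≤ B ∧
      ∀ w, κ ≤ w → |F.f u / F.perturbedInv ε u v - F.f u / F.perturbedInv ε u w| ≤ K * |v - w| := by
  obtain ⟨M, hM, L, hL, hfM, hfL⟩ := F.exists_reaction_bounds
  obtain ⟨u₀, hu₀, hmin⟩ := isCompact_Icc.exists_isMinOn (nonempty_Icc.2 zero_le_one)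
    (F.continuousOn_perturbedInv hε hκ.le)
  set m := F.perturbedInv ε u₀ κ with hm_def
  have hm : 0 < m := F.perturbedInv_pos hε hu₀ hκ
  have hge : ∀ u ∈ Icc (0 : ℝ) 1, ∀ v, κ ≤ v → m ≤ F.perturbedInv ε u v := fun u hu v hv =>
    (hmin hu).trans (F.perturbedInv_mono hε hu hκ.le hv)
  clear_value m
  refine ⟨M / (ε * m ^ 2), by positivity, M / m, by positivity, fun u hu v hv => ⟨?_, ?_⟩⟩
  · have h1 := hge u hu v hv
    rw [abs_of_nonneg (div_nonneg (hfM u hu).1 (hm.le.trans h1))]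
    exact div_le_div₀ hM.le (hfM u hu).2 hm h1
  · intro w hw
    have h1 := hge u hu v hv
    have h2 := hge u hu w hw
    have h3 := F.perturbedInv_sub_le hε hu (hκ.le.trans hw) (hκ.le.trans hv)
    obtain ⟨hf0, hf1⟩ := hfM u hu
    generalize F.perturbedInv ε u v = x at h1 h3 ⊢
    generalize F.perturbedInv ε u w = y at h2 h3 ⊢
    have hx : 0 < x := hm.trans_le h1
    have hy : 0 < y := hm.trans_le h2
    have h4 : F.f u / x - F.f u / y = F.f u * (y - x) / (x * y) := by
      field_simp
    rw [h4, abs_div, abs_mul, abs_of_nonneg hf0, abs_of_pos (mul_pos hx hy)]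
    calc F.f u * |y - x| / (x * y) ≤ M * (|w - v| / ε) / (m * m) := by gcongr
      _ = M / (ε * m ^ 2) * |v - w| := by
        rw [abs_sub_comm w v]
        field_simp

theorem exists_truncated_sol {α β κ σ w₀ : ℝ} (hε : 0 < ε) (hκ : 0 < κ) (hα : 0 ≤ α)
    (hαβ : α ≤ β) (hβ : β ≤ 1) :
    ∃ V : ℝ → ℝ, ContinuousOn V (Icc α β) ∧ V β = w₀ ∧
      ∀ u ∈ Ioo α β, HasDerivAt V (σ - F.f u / F.perturbedInv ε u (max (V u) κ)) u := by
  obtain ⟨K, hK, B, hB, hKB⟩ := F.exists_slope_bounds hε hκ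
  have hsub : Icc α β ⊆ Icc 0 1 := Icc_subset_Icc hα hβ
  have hL : 0 ≤ |σ| + B := by positivity
  have hPL : IsPicardLindelof
      (fun u v => σ - F.f u / F.perturbedInv ε u (max v κ)) (⟨β, right_mem_Icc.2 hαβ⟩ : Icc α β) w₀
      (⟨(|σ| + B) * (β - α), mul_nonneg hL (sub_nonneg.2 hαβ)⟩) 0 ⟨|σ| + B, hL⟩ ⟨K, hK.le⟩ := by
    refine ⟨fun u hu => LipschitzOnWith.of_dist_le_mul fun v _ w _ => ?_, fun v _ => ?_,
      fun u hu v _ => ?_, ?_⟩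
    · rw [Real.dist_eq, Real.dist_eq, sub_sub_sub_cancel_left, abs_sub_comm]
      refine ((hKB u (hsub hu) _ (le_max_right v κ)).2 _ (le_max_right w κ)).trans ?_
      exact mul_le_mul_of_nonneg_left (abs_max_sub_max_le_abs v w κ) hK.le
    · refine continuousOn_const.sub ((F.f_C1.continuousOn.mono hsub).div
        ((F.continuousOn_perturbedInv hε (hκ.le.trans (le_max_right v κ))).mono hsub) fun u hu => ?_)
      exact (F.perturbedInv_pos hε (hsub hu) (hκ.trans_le (le_max_right v κ))).ne'
    · rw [Real.norm_eq_abs]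
      exact (abs_sub _ _).trans (add_le_add_right (hKB u (hsub hu) _ (le_max_right v κ)).1 _)
    · simp only [sub_self, max_eq_right (sub_nonneg.2 hαβ), NNReal.coe_zero, sub_zero]
      exact le_rfl
  obtain ⟨V, hV0, hV⟩ := hPL.exists_eq_forall_mem_Icc_hasDerivWithinAt₀
  exact ⟨V, fun u hu => (hV u hu).continuousWithinAt, hV0, fun u hu =>
    (hV u (Ioo_subset_Icc_self hu)).hasDerivAt (Icc_mem_nhds hu.1 hu.2)⟩

theorem le_slope_of_le_mul_f {k u v : ℝ} (hε : 0 < ε) (hk : 0 < k) (hu : u ∈ Ioo (0 : ℝ) 1)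
    (hv : 0 < v) (hvk : v ≤ k * F.f u) : ε / k ≤ F.f u / F.perturbedInv ε u v := by
  have huI := Ioo_subset_Icc_self hu
  rw [div_le_div_iff₀ hk (F.perturbedInv_pos hε huI hv)]
  have := (le_div_iff₀ hε).1 (F.perturbedInv_le hε huI hv.le)
  linarith

theorem slope_antitone {u v w : ℝ} (hε : 0 < ε) (hu : u ∈ Ioo (0 : ℝ) 1)
    (hv : 0 < v) (hvw : v ≤ w) :
    F.f u / F.perturbedInv ε u w ≤ F.f u / F.perturbedInv ε u v := by
  have huI := Ioo_subset_Icc_self hu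
  exact div_le_div_of_nonneg_left (F.f_pos u hu).le (F.perturbedInv_pos hε huI hv)
    (F.perturbedInv_mono hε huI hv.le hvw)

/-- Solvability of `V' = σ - f/G(u,V)` below a supersolution, on compact subintervals. -/
theorem exists_sol_on_Icc {α β k L σ : ℝ} {W : ℝ → ℝ} (hε : 0 < ε) (hk : 0 < k)
    (hL : ∀ u ∈ Ioo (0 : ℝ) 1, ∃ d, |d| ≤ L ∧ HasDerivAt F.f d u) (hkL : k * L + σ ≤ ε / k)
    (hα : 0 < α) (hαβ : α ≤ β) (hβ : β < 1) (hW : ContinuousOn W (Icc 0 1))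
    (hWpos : ∀ u ∈ Ioo (0 : ℝ) 1, 0 < W u)
    (hWd : ∀ u ∈ Ioo (0 : ℝ) 1, ∃ d, HasDerivAt W d u ∧ d ≤ σ - F.f u / F.perturbedInv ε u (W u))
    (hkW : k * F.f β ≤ W β) :
    ∃ V : ℝ → ℝ, ContinuousOn V (Icc α β) ∧ V β = W β ∧
      (∀ u ∈ Icc α β, k * F.f u ≤ V u ∧ V u ≤ W u) ∧
      ∀ u ∈ Ioo α β, HasDerivAt V (σ - F.f u / F.perturbedInv ε u (V u)) u := by
  have hsub : Icc α β ⊆ Ioo 0 1 := fun u hu => ⟨hα.trans_le hu.1, hu.2.trans_lt hβ⟩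
  have hsub' : Icc α β ⊆ Icc 0 1 := hsub.trans Ioo_subset_Icc_self
  obtain ⟨u₀, hu₀, hmin⟩ := isCompact_Icc.exists_isMinOn (nonempty_Icc.2 hαβ)
    (F.f_C1.continuousOn.mono hsub')
  have hκ : 0 < k * F.f u₀ := mul_pos hk (F.f_pos _ (hsub hu₀))
  have hκf : ∀ u ∈ Icc α β, k * F.f u₀ ≤ k * F.f u := fun u hu =>
    mul_le_mul_of_nonneg_left (hmin hu) hk.le
  generalize k * F.f u₀ = κ at hκ hκf
  obtain ⟨V, hVc, hVβ, hVd⟩ := F.exists_truncated_sol (σ := σ) (w₀ := W β) hε hκ hα.le hαβ hβ.le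
  have hlow : ∀ u ∈ Icc α β, k * F.f u ≤ V u := by
    refine F.mul_f_le_of_deriv_le hα.le hβ.le hk hL hVc (by rwa [hVβ]) fun u hu hlt =>
      ⟨_, hVd u hu, ?_⟩
    have hu' := Ioo_subset_Icc_self hu
    have := F.le_slope_of_le_mul_f hε hk (hsub hu') (hκ.trans_le (le_max_right (V u) κ))
      (max_le hlt.le (hκf u hu'))
    linarith
  refine ⟨V, hVc, hVβ, fun u hu => ⟨hlow u hu, ?_⟩, fun u hu => ?_⟩
  · by_contra! hlt
    have hss : Icc u β ⊆ Icc α β := Icc_subset_Icc_left hu.1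
    have := le_of_deriv_nonneg_of_pos (h := fun x => V x - W x) hu.2
      ((hVc.mono hss).sub (hW.mono (hss.trans hsub'))) (fun x hx hpos => by
        have hx' : x ∈ Ioo α β := ⟨hu.1.trans_lt hx.1, hx.2⟩
        have hx01 := hsub (Ioo_subset_Icc_self hx')
        obtain ⟨d, hd, hdle⟩ := hWd x hx01
        refine ⟨_, ?_, (hVd x hx').sub hd⟩
        have := F.slope_antitone hε hx01 (hWpos x hx01)
          ((sub_pos.1 hpos).le.trans (le_max_left (V x) κ))
        linarith) (sub_pos.2 hlt)
    simp only [hVβ] at this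
    linarith
  · have hu' := Ioo_subset_Icc_self hu
    have := hVd u hu
    rwa [max_eq_left ((hκf u hu').trans (hlow u hu'))] at this

theorem sub_le_sub_of_sol {p q σ : ℝ} {V₁ V₂ : ℝ → ℝ} (hε : 0 < ε) (hp : 0 < p) (hpq : p ≤ q)
    (hq : q < 1) (hc₁ : ContinuousOn V₁ (Icc p q)) (hc₂ : ContinuousOn V₂ (Icc p q))
    (hpos : ∀ u ∈ Ioo p q, 0 < V₂ u)
    (hd₁ : ∀ u ∈ Ioo p q, HasDerivAt V₁ (σ - F.f u / F.perturbedInv ε u (V₁ u)) u)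
    (hd₂ : ∀ u ∈ Ioo p q, HasDerivAt V₂ (σ - F.f u / F.perturbedInv ε u (V₂ u)) u)
    (hlt : 0 < V₁ p - V₂ p) : V₁ p - V₂ p ≤ V₁ q - V₂ q := by
  refine le_of_deriv_nonneg_of_pos (h := fun x => V₁ x - V₂ x) hpq (hc₁.sub hc₂)
    (fun x hx hx0 => ⟨_, ?_, (hd₁ x hx).sub (hd₂ x hx)⟩) hlt
  have := F.slope_antitone hε ⟨hp.trans hx.1, hx.2.trans hq⟩ (hpos x hx) (sub_pos.1 hx0).le
  linarith

theorem exists_perturbed_sol {σ : ℝ} {W : ℝ → ℝ} (hε : 0 < ε) (hσ : 0 < σ)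
    (hW : ContinuousOn W (Icc 0 1)) (hW1 : W 1 = 0) (hWpos : ∀ u ∈ Ioo (0 : ℝ) 1, 0 < W u)
    (hWd : ∀ u ∈ Ioo (0 : ℝ) 1,
      ∃ d, HasDerivAt W d u ∧ d ≤ σ - F.f u / F.perturbedInv ε u (W u)) :
    ∃ V : ℝ → ℝ, ∃ k > 0, ∀ u ∈ Ioo (0 : ℝ) 1, k * F.f u ≤ V u ∧ V u ≤ W u ∧
      HasDerivAt V (σ - F.f u / F.perturbedInv ε u (V u)) u := by
  obtain ⟨M, hM, L, hL, hfM, hfL⟩ := F.exists_reaction_bounds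
  obtain ⟨k, hk, hkL⟩ : ∃ k > 0, k * L + σ ≤ ε / k := by
    refine ⟨min 1 (ε / (L + σ)), by positivity, ?_⟩
    have h1 := min_le_left 1 (ε / (L + σ))
    have h2 := (le_div_iff₀ (by positivity)).1 (min_le_right 1 (ε / (L + σ)))
    have h3 : 0 < min 1 (ε / (L + σ)) := by positivity
    generalize min 1 (ε / (L + σ)) = k at *
    rw [le_div_iff₀ h3]
    nlinarith [mul_nonneg h3.le hL.le]
  have hkW : ∀ u ∈ Icc (0 : ℝ) 1, k * F.f u ≤ W u := by
    refine F.mul_f_le_of_deriv_le le_rfl le_rfl hk hfL hW (by simp [F.f_one, hW1]) ?_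
    intro u hu hlt
    obtain ⟨d, hd, hdle⟩ := hWd u hu
    refine ⟨d, hd, ?_⟩
    have := F.le_slope_of_le_mul_f hε hk hu (hWpos u hu) hlt.le
    linarith
  set α : ℕ → ℝ := fun n => 1 / ((n : ℝ) + 2) with hα_def
  have hα0 : ∀ n, 0 < α n := fun n => by simp only [hα_def]; positivity
  have hαh : ∀ n, α n ≤ 1 / 2 := fun n => by
    simp only [hα_def]
    exact one_div_le_one_div_of_le two_pos (by linarith [(Nat.cast_nonneg n : (0 : ℝ) ≤ n)])
  have hαanti : ∀ m n, n ≤ m → α m ≤ α n := fun m n h => by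
    simp only [hα_def]
    have : (n : ℝ) ≤ m := by exact_mod_cast h
    exact one_div_le_one_div_of_le (by positivity) (by linarith)
  have hαlim : Tendsto α atTop (𝓝 0) :=
    (tendsto_const_nhds.div_atTop (tendsto_natCast_atTop_atTop.atTop_add tendsto_const_nhds))
  clear_value α
  have hsol := fun n => F.exists_sol_on_Icc hε hk hfL hkL (hα0 n)
    (show α n ≤ 1 - α n by linarith [hαh n]) (show 1 - α n < 1 by linarith [hα0 n]) hW hWpos hWd
    (hkW _ ⟨by linarith [hαh n], by linarith [hα0 n]⟩)
  choose V hVc hVβ hVb hVd using hsol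
  have hVpos : ∀ n, ∀ u ∈ Icc (α n) (1 - α n), 0 < V n u := fun n u hu =>
    (mul_pos hk (F.f_pos u ⟨(hα0 n).trans_le hu.1, hu.2.trans_lt (by linarith [hα0 n])⟩)).trans_le
      (hVb n u hu).1
  have hcauchy : ∀ n m, n ≤ m → ∀ u ∈ Icc (α n) (1 - α n), |V n u - V m u| ≤ W (1 - α n) := by
    intro n m hnm u hu
    have hmn := hαanti m n hnm
    have hs : Icc u (1 - α n) ⊆ Icc (α n) (1 - α n) := Icc_subset_Icc_left hu.1
    have hs' : Icc (α n) (1 - α n) ⊆ Icc (α m) (1 - α m) := Icc_subset_Icc hmn (by linarith)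
    have hsd : ∀ x ∈ Ioo u (1 - α n), x ∈ Ioo (α n) (1 - α n) ∧ x ∈ Ioo (α m) (1 - α m) :=
      fun x hx => ⟨⟨hu.1.trans_lt hx.1, hx.2⟩,
        ⟨hmn.trans_lt (hu.1.trans_lt hx.1), hx.2.trans_le (by linarith)⟩⟩
    have hr : 1 - α n ∈ Icc (α n) (1 - α n) := right_mem_Icc.2 (hu.1.trans hu.2)
    have h1 := hVpos m _ (hs' hr)
    have h2 := (hVb m _ (hs' hr)).2
    have hu0 : 0 < u := (hα0 n).trans_le hu.1
    have hq : 1 - α n < 1 := by linarith [hα0 n]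
    have hA := F.sub_le_sub_of_sol (σ := σ) hε hu0 hu.2 hq ((hVc n).mono hs)
      ((hVc m).mono (hs.trans hs'))
      (fun x hx => hVpos m x (Ioo_subset_Icc_self (hsd x hx).2))
      (fun x hx => hVd n x (hsd x hx).1) (fun x hx => hVd m x (hsd x hx).2)
    have hB := F.sub_le_sub_of_sol (σ := σ) hε hu0 hu.2 hq ((hVc m).mono (hs.trans hs'))
      ((hVc n).mono hs)
      (fun x hx => hVpos n x (Ioo_subset_Icc_self (hsd x hx).1))
      (fun x hx => hVd m x (hsd x hx).2) (fun x hx => hVd n x (hsd x hx).1)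
    rw [hVβ n] at hA hB
    rw [abs_le]
    constructor
    · by_contra! h
      linarith [hB (by linarith)]
    · by_contra! h
      linarith [hA (by linarith)]
  have hWlim : Tendsto (fun n => W (1 - α n)) atTop (𝓝 0) := by
    have h1 : Tendsto (fun n => 1 - α n) atTop (𝓝[Icc 0 1] 1) := by
      refine tendsto_nhdsWithin_iff.2 ⟨?_, Eventually.of_forall fun n =>
        ⟨by linarith [hαh n], by linarith [hα0 n]⟩⟩
      simpa using hαlim.const_sub 1
    have := (hW 1 (right_mem_Icc.2 zero_le_one)).tendsto.comp h1
    rwa [hW1] at this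
  have hmemev : ∀ p q : ℝ, 0 < p → q < 1 → ∀ᶠ n in atTop, Icc p q ⊆ Icc (α n) (1 - α n) := by
    intro p q hp hq
    filter_upwards [hαlim.eventually (gt_mem_nhds hp),
      hαlim.eventually (gt_mem_nhds (sub_pos.2 hq))] with n h1 h2
    exact Icc_subset_Icc h1.le (by linarith)
  have hlim : ∀ u ∈ Ioo (0 : ℝ) 1, ∃ l, Tendsto (fun n => V n u) atTop (𝓝 l) := by
    intro u hu
    refine cauchySeq_tendsto_of_complete (Metric.cauchySeq_iff'.2 fun e he => ?_)
    obtain ⟨N, hN1, hN2⟩ := ((hmemev u u hu.1 hu.2).and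
      (hWlim.eventually (gt_mem_nhds he))).exists
    refine ⟨N, fun n hn => ?_⟩
    rw [dist_comm, Real.dist_eq]
    exact (hcauchy N n hn u (hN1 (by simp))).trans_lt hN2
  choose! V₀ hV₀ using hlim
  have hb : ∀ u ∈ Ioo (0 : ℝ) 1, k * F.f u ≤ V₀ u ∧ V₀ u ≤ W u := by
    intro u hu
    have hev := hmemev u u hu.1 hu.2
    exact ⟨ge_of_tendsto (hV₀ u hu) (hev.mono fun n hn => (hVb n u (hn (by simp))).1),
      le_of_tendsto (hV₀ u hu) (hev.mono fun n hn => (hVb n u (hn (by simp))).2)⟩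
  refine ⟨V₀, k, hk, fun u hu => ⟨(hb u hu).1, (hb u hu).2, ?_⟩⟩
  obtain ⟨p, hp0, hpu⟩ := exists_between hu.1
  obtain ⟨q, huq, hq1⟩ := exists_between hu.2
  have hsub : Icc p q ⊆ Ioo 0 1 := fun x hx => ⟨hp0.trans_le hx.1, hx.2.trans_lt hq1⟩
  obtain ⟨u₀, hu₀, hmin⟩ := isCompact_Icc.exists_isMinOn (nonempty_Icc.2 (hpu.trans huq).le)
    (F.f_C1.continuousOn.mono (hsub.trans Ioo_subset_Icc_self))
  have hκ : 0 < k * F.f u₀ := mul_pos hk (F.f_pos _ (hsub hu₀))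
  have hκf : ∀ x ∈ Icc p q, k * F.f u₀ ≤ k * F.f x := fun x hx =>
    mul_le_mul_of_nonneg_left (hmin hx) hk.le
  generalize k * F.f u₀ = κ at hκ hκf
  obtain ⟨K, hK, B, hB, hKB⟩ := F.exists_slope_bounds hε hκ
  refine hasDerivAt_of_tendstoLocallyUniformlyOn (l := atTop) (f := V)
    (f' := fun n x => σ - F.f x / F.perturbedInv ε x (V n x))
    (g' := fun x => σ - F.f x / F.perturbedInv ε x (V₀ x)) (s := Ioo p q) isOpen_Ioo ?_ ?_
    (fun x hx => hV₀ x (hsub (Ioo_subset_Icc_self hx))) ⟨hpu, huq⟩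
  · refine TendstoUniformlyOn.tendstoLocallyUniformlyOn (Metric.tendstoUniformlyOn_iff.2 ?_)
    intro e he
    filter_upwards [hmemev p q hp0 hq1, hWlim.eventually (gt_mem_nhds (div_pos he hK))]
      with n hn hWn x hx
    have hx' := Ioo_subset_Icc_self hx
    have hx01 := hsub hx'
    rw [Real.dist_eq, sub_sub_sub_cancel_left]
    refine ((hKB x (Ioo_subset_Icc_self hx01) _ ((hκf x hx').trans (hVb n x (hn hx')).1)).2 _
      ((hκf x hx').trans (hb x hx01).1)).trans_lt ?_
    have h1 : |V n x - V₀ x| ≤ W (1 - α n) :=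
      le_of_tendsto ((tendsto_const_nhds.sub (hV₀ x hx01)).abs)
        ((eventually_ge_atTop n).mono fun m hm => hcauchy n m hm x (hn hx'))
    have h2 := (lt_div_iff₀ hK).1 (h1.trans_lt hWn)
    linarith
  · filter_upwards [hmemev p q hp0 hq1] with n hn x hx
    refine hVd n x ?_
    have h1 := (hn (left_mem_Icc.2 (hpu.trans huq).le)).1
    have h2 := (hn (right_mem_Icc.2 (hpu.trans huq).le)).2
    exact ⟨h1.trans_lt hx.1, hx.2.trans_le h2⟩

theorem contDiffAt_a {u s : ℝ} (hu : u ∈ Ioo (0 : ℝ) 1) (hs : 0 ≤ s)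
    (h : (u, s) ∈ OmegaSet F.ω) : ContDiffAt ℝ 1 (fun q : ℝ × ℝ => F.a q.1 q.2) (u, s) :=
  F.a_C1.contDiffAt (F.mem_nhds_Omega hu hs h)

theorem contDiffAt_perturbedInv_comp {V : ℝ → ℝ} {w : ℝ} (hε : 0 < ε) (hw : w ∈ Ioo (0 : ℝ) 1)
    (hV : ContDiffAt ℝ 1 V w) (hVpos : ∀ x ∈ Ioo (0 : ℝ) 1, 0 < V x)
    (hVc : ContinuousOn V (Ioo 0 1)) :
    ContDiffAt ℝ 1 (fun x => F.perturbedInv ε x (V x)) w := by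
  have hspec := fun x (hx : x ∈ Ioo (0 : ℝ) 1) =>
    F.perturbedInv_spec hε (Ioo_subset_Icc_self hx) (hVpos x hx).le
  have hcont : ContinuousAt (fun x => F.perturbedInv ε x (V x)) w :=
    (F.continuousOn_perturbedInv_comp hε Ioo_subset_Icc_self hVc
      fun x hx => (hVpos x hx).le).continuousAt (isOpen_Ioo.mem_nhds hw)
  obtain ⟨h0, hm, he⟩ := hspec w hw
  set s := F.perturbedInv ε w (V w) with hs
  set Φ : ℝ × ℝ → ℝ := fun q => F.a q.1 q.2 + ε * q.2 - V q.1 with hΦ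
  have hΦC : ContDiffAt ℝ 1 Φ (w, s) :=
    ((F.contDiffAt_a hw h0 hm).add (contDiffAt_const.mul contDiffAt_snd)).sub
      (ContDiffAt.comp (w, s) (g := V) hV contDiffAt_fst)
  have hinv : (fderiv ℝ Φ (w, s) ∘L .inr ℝ ℝ ℝ).IsInvertible := by
    obtain ⟨d, hd0, hd⟩ := F.a_deriv_pos w s hm
    have h1 : HasDerivAt (fun t => Φ (w, t)) (d + ε) s := by
      simpa [hΦ] using (hd.add ((hasDerivAt_id s).const_mul ε)).sub_const (V w)
    have h2 : HasFDerivAt (fun t => Φ (w, t)) (fderiv ℝ Φ (w, s) ∘L .inr ℝ ℝ ℝ) s :=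
      (hΦC.differentiableAt one_ne_zero).hasFDerivAt.comp s (hasFDerivAt_prodMk_right w s)
    have h3 := h2.unique h1.hasFDerivAt
    rw [h3]
    have hne : d + ε ≠ 0 := by positivity
    exact ⟨ContinuousLinearEquiv.unitsEquivAut ℝ (Units.mk0 _ hne), by
      ext; simp⟩
  have hev := hΦC.eventually_apply_eq_iff_implicitFunction one_ne_zero hinv
  have ht : Tendsto (fun x => (x, F.perturbedInv ε x (V x))) (𝓝 w) (𝓝 (w, s)) :=
    continuousAt_id.prodMk hcont
  refine (hΦC.contDiffAt_implicitFunction one_ne_zero hinv).congr_of_eventuallyEq ?_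
  filter_upwards [ht.eventually hev, isOpen_Ioo.mem_nhds hw] with x hx hx01
  refine (hx.1 ?_).symm
  simp only [hΦ, (hspec x hx01).2.2, sub_self, he]

theorem exists_linear_bound {V W : ℝ → ℝ} {σ k : ℝ} (hε : 0 < ε) (hk : 0 < k)
    (hW : ContinuousOn W (Icc 0 1)) (hW0 : W 0 = 0) (hW1 : W 1 = 0)
    (hV : ∀ u ∈ Ioo (0 : ℝ) 1, k * F.f u ≤ V u ∧ V u ≤ W u ∧
      HasDerivAt V (σ - F.f u / F.perturbedInv ε u (V u)) u) :
    ∃ D > 0, ∀ u ∈ Ioo (0 : ℝ) 1, V u ≤ D * u ∧ V u ≤ D * (1 - u) := by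
  obtain ⟨r, hr, c, hc, C, hC, hb⟩ := F.exists_uniform_bounds
  obtain ⟨M, hM, L, hL, hfM, hfL⟩ := F.exists_reaction_bounds
  set D := |σ| + ((C + ε) / k + M / r) with hD
  have hDpos : 0 < D := by positivity
  have hder : ∀ u ∈ Ioo (0 : ℝ) 1, ‖σ - F.f u / F.perturbedInv ε u (V u)‖ ≤ D := by
    intro u hu
    have huI := Ioo_subset_Icc_self hu
    have hf := F.f_pos u hu
    have hVu := (mul_pos hk hf).trans_le (hV u hu).1
    have hp := F.perturbedInv_pos hε huI hVu
    obtain ⟨-, hm, he⟩ := F.perturbedInv_spec hε huI hVu.le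
    have h1 : F.f u / F.perturbedInv ε u (V u) ≤ (C + ε) / k + M / r := by
      generalize F.perturbedInv ε u (V u) = s at *
      rcases le_or_gt s r with hsr | hsr
      · have h2 := ((hb u huI).2 0 s le_rfl hp.le hsr).2
        rw [F.a_zero huI, sub_zero, sub_zero] at h2
        have h3 : F.f u / s ≤ (C + ε) / k := by
          rw [div_le_div_iff₀ hp hk]
          linarith [(hV u hu).1]
        have : 0 ≤ M / r := by positivity
        linarith
      · have h3 : F.f u / s ≤ M / r := div_le_div₀ hM.le (hfM u huI).2 hr hsr.le
        have : 0 ≤ (C + ε) / k := by positivity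
        linarith
    rw [Real.norm_eq_abs]
    refine (abs_sub _ _).trans (add_le_add_right ?_ _)
    rwa [abs_of_pos (div_pos hf hp)]
  have hlip : ∀ x ∈ Ioo (0 : ℝ) 1, ∀ y ∈ Ioo (0 : ℝ) 1, |V y - V x| ≤ D * |y - x| :=
    fun x hx y hy => (convex_Ioo (0 : ℝ) 1).norm_image_sub_le_of_norm_hasDerivWithin_le
      (fun u hu => (hV u hu).2.2.hasDerivWithinAt) hder hx hy
  refine ⟨D, hDpos, fun u hu => ⟨?_, ?_⟩⟩
  · have hlim : Tendsto (fun x => W x + D * u) (𝓝[Ioo 0 u] 0) (𝓝 (0 + D * u)) := by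
      refine Tendsto.add_const _ ?_
      have := (hW 0 (left_mem_Icc.2 zero_le_one)).tendsto
      rw [hW0] at this
      exact this.mono_left (nhdsWithin_mono _ fun x hx => ⟨hx.1.le, (hx.2.trans hu.2).le⟩)
    have : (𝓝[Ioo 0 u] (0 : ℝ)).NeBot := left_nhdsWithin_Ioo_neBot hu.1
    rw [zero_add] at hlim
    refine ge_of_tendsto hlim ?_
    filter_upwards [self_mem_nhdsWithin] with x hx
    have hx' : x ∈ Ioo (0 : ℝ) 1 := ⟨hx.1, hx.2.trans hu.2⟩
    have h1 := (le_abs_self _).trans (hlip x hx' u hu)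
    rw [abs_of_pos (sub_pos.2 hx.2)] at h1
    nlinarith [(hV x hx').2.1, hx.1]
  · have hlim : Tendsto (fun x => W x + D * (1 - u)) (𝓝[Ioo u 1] 1) (𝓝 (0 + D * (1 - u))) := by
      refine Tendsto.add_const _ ?_
      have := (hW 1 (right_mem_Icc.2 zero_le_one)).tendsto
      rw [hW1] at this
      exact this.mono_left (nhdsWithin_mono _ fun x hx => ⟨(hu.1.trans hx.1).le, hx.2.le⟩)
    have : (𝓝[Ioo u 1] (1 : ℝ)).NeBot := right_nhdsWithin_Ioo_neBot hu.2
    rw [zero_add] at hlim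
    refine ge_of_tendsto hlim ?_
    filter_upwards [self_mem_nhdsWithin] with x hx
    have hx' : x ∈ Ioo (0 : ℝ) 1 := ⟨hu.1.trans hx.1, hx.2⟩
    have h1 := (le_abs_self _).trans (hlip x hx' u hu)
    rw [abs_of_neg (sub_neg.2 hx.1)] at h1
    nlinarith [(hV x hx').2.1, hx.2]

theorem exists_classicTW_of_sol {V W : ℝ → ℝ} {σ k : ℝ} (hε : 0 < ε) (hk : 0 < k)
    (hW : ContinuousOn W (Icc 0 1)) (hW0 : W 0 = 0) (hW1 : W 1 = 0)
    (hV : ∀ u ∈ Ioo (0 : ℝ) 1, k * F.f u ≤ V u ∧ V u ≤ W u ∧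
      HasDerivAt V (σ - F.f u / F.perturbedInv ε u (V u)) u) :
    ∃ u : ℝ → ℝ, IsClassicTW F (fun w s => F.a w s + ε * s) σ u := by
  have hVpos : ∀ w ∈ Ioo (0 : ℝ) 1, 0 < V w := fun w hw =>
    (mul_pos hk (F.f_pos w hw)).trans_le (hV w hw).1
  have hspec := fun w (hw : w ∈ Ioo (0 : ℝ) 1) =>
    F.perturbedInv_spec hε (Ioo_subset_Icc_self hw) (hVpos w hw).le
  have hp := fun w (hw : w ∈ Ioo (0 : ℝ) 1) =>
    F.perturbedInv_pos hε (Ioo_subset_Icc_self hw) (hVpos w hw)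
  have hVc : ContinuousOn V (Ioo 0 1) := fun w hw =>
    (hV w hw).2.2.continuousAt.continuousWithinAt
  have hVC1 : ContDiffOn ℝ 1 V (Ioo 0 1) := by
    have h01 : ContDiffOn ℝ (0 + 1) V (Ioo 0 1) := by
      refine (contDiffOn_succ_iff_deriv_of_isOpen isOpen_Ioo).2
        ⟨fun w hw => (hV w hw).2.2.differentiableAt.differentiableWithinAt, by simp, ?_⟩
      rw [contDiffOn_zero]
      refine ContinuousOn.congr ?_ fun w hw => (hV w hw).2.2.deriv
      exact continuousOn_const.sub ((F.f_C1.continuousOn.mono Ioo_subset_Icc_self).div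
        (F.continuousOn_perturbedInv_comp hε Ioo_subset_Icc_self hVc fun w hw => (hVpos w hw).le)
        fun w hw => (hp w hw).ne')
    rwa [zero_add] at h01
  obtain ⟨D, hD, hVD⟩ := F.exists_linear_bound hε hk hW hW0 hW1 hV
  have hpV : ∀ w ∈ Ioo (0 : ℝ) 1, F.perturbedInv ε w (V w) ≤ V w / ε := fun w hw =>
    F.perturbedInv_le hε (Ioo_subset_Icc_self hw) (hVpos w hw).le
  obtain ⟨u, hu2, hu, hud, hu0, hu1⟩ := exists_heteroclinic
    (p := fun w => F.perturbedInv ε w (V w)) (B := D / ε)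
    (fun w hw => (F.contDiffAt_perturbedInv_comp hε hw
      (hVC1.contDiffAt (isOpen_Ioo.mem_nhds hw)) hVpos hVc).contDiffWithinAt) (by positivity) hp
    (fun w hw => (hpV w hw).trans (by
      rw [div_mul_eq_mul_div]
      exact div_le_div_of_nonneg_right (hVD w hw).1 hε.le))
    (fun w hw => (hpV w hw).trans (by
      rw [div_mul_eq_mul_div]
      exact div_le_div_of_nonneg_right (hVD w hw).2 hε.le))
  have hderiv : ∀ ξ, deriv u ξ = F.perturbedInv ε (u ξ) (V (u ξ)) := fun ξ => (hud ξ).deriv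
  refine ⟨u, hu2, hu, fun ξ => ?_, hu0, hu1, fun ξ => ?_⟩
  · rw [hderiv]
    have hξ := hu ξ
    exact ⟨hp _ hξ, (F.mem_iff (Ioo_subset_Icc_self hξ) (hp _ hξ).le).1 (hspec _ hξ).2.1⟩
  · have h1 : (fun t => F.a (u t) (deriv u t) + ε * deriv u t) = V ∘ u := by
      funext t
      rw [hderiv]
      exact (hspec _ (hu t)).2.2
    rw [h1]
    have h2 := (hV _ (hu ξ)).2.2.comp ξ (hud ξ)
    rwa [sub_mul, div_mul_cancel₀ _ (hp _ (hu ξ)).ne', ← hderiv] at h2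

/-- The extended solution vanishes at `0` for every speed of a perturbed traveling wave. -/
theorem Vsol_zero_of_classicTW {W u : ℝ → ℝ} {σ : ℝ} (hε : 0 < ε) (hW : IsVsol F σ W)
    (hu : IsClassicTW F (fun w s => F.a w s + ε * s) σ u) : W 0 = 0 := by
  obtain ⟨hWc, hW1, hWpos, hWd⟩ := hW
  obtain ⟨hu2, hu01, hu', hu0, hu1, heq⟩ := hu
  have hud : ∀ ξ, HasDerivAt u (deriv u ξ) ξ := fun ξ =>
    ((hu2.differentiable (by norm_num)) ξ).hasDerivAt
  have huI : ∀ ξ, u ξ ∈ Icc (0 : ℝ) 1 := fun ξ => Ioo_subset_Icc_self (hu01 ξ)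
  have hmem : ∀ ξ, (u ξ, deriv u ξ) ∈ OmegaSet F.ω := fun ξ =>
    (F.mem_iff (huI ξ) (hu' ξ).1.le).2 (hu' ξ).2
  have hle : ∀ ξ, W (u ξ) ≤ F.a (u ξ) (deriv u ξ) + ε * deriv u ξ := by
    intro ξ
    by_contra! hlt
    have hdZ : ∀ t, HasDerivAt (fun t => W (u t) - (F.a (u t) (deriv u t) + ε * deriv u t))
        ((σ - F.f (u t) * Hfun F (u t) (W (u t))) * deriv u t
          - (σ * deriv u t - F.f (u t))) t := fun t =>
      ((hWd _ (hu01 t)).comp t (hud t)).sub (heq t)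
    have hmono : ∀ η, ξ ≤ η → W (u ξ) - (F.a (u ξ) (deriv u ξ) + ε * deriv u ξ) ≤ W (u η) := by
      intro η hη
      have h1 := le_of_deriv_nonneg_of_pos hη
        (fun t _ => (hdZ t).continuousAt.continuousWithinAt) (fun t _ ht => by
          refine ⟨_, ?_, hdZ t⟩
          have hs := (hu' t).1
          have hf := F.f_pos _ (hu01 t)
          have hH : Hfun F (u t) (W (u t)) * deriv u t ≤ 1 := by
            unfold Hfun
            split_ifs with hlt'
            · obtain ⟨hg0, hgm, hga⟩ := F.g_spec_of_pos (huI t) (hWpos _ (hu01 t)) hlt'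
              rw [one_div_mul_eq_div, div_le_one hg0]
              by_contra! h
              have := F.a_lt_a hg0.le h (hmem t)
              nlinarith
            · simp
          nlinarith) (sub_pos.2 hlt)
      have h2 := F.a_nonneg (hu' η).1.le (hmem η)
      have h3 := mul_pos hε (hu' η).1
      linarith
    have hlim : Tendsto (fun η => W (u η)) atTop (𝓝 0) := by
      have h1 := (hWc 1 (right_mem_Icc.2 zero_le_one)).tendsto
      rw [hW1] at h1
      exact h1.comp (tendsto_nhdsWithin_iff.2 ⟨hu1, Eventually.of_forall huI⟩)
    have := ge_of_tendsto hlim ((eventually_ge_atTop ξ).mono hmono)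
    linarith
  have hmvt : ∀ n : ℕ, ∃ ξ ∈ Ioo (-(n : ℝ) - 1) (-n), deriv u ξ = u (-n) - u (-n - 1) := by
    intro n
    obtain ⟨ξ, hξ, h⟩ := exists_hasDerivAt_eq_slope u (deriv u) (show -(n : ℝ) - 1 < -n by linarith)
      (fun t _ => (hud t).continuousAt.continuousWithinAt) (fun t _ => hud t)
    exact ⟨ξ, hξ, by rw [h]; simp⟩
  choose ξ hξ hξd using hmvt
  have hn : Tendsto (fun n : ℕ => -(n : ℝ)) atTop atBot :=
    tendsto_neg_atTop_atBot.comp tendsto_natCast_atTop_atTop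
  have hξlim : Tendsto ξ atTop atBot := tendsto_atBot_mono (fun n => (hξ n).2.le) hn
  have hdlim : Tendsto (fun n => deriv u (ξ n)) atTop (𝓝 0) := by
    simp only [hξd]
    have h1 := (hu0.comp hn).sub
      (hu0.comp (tendsto_atBot_mono (fun n : ℕ => (sub_le_self (-(n : ℝ)) zero_le_one)) hn))
    simpa using h1
  have h0I : (0 : ℝ) ∈ Icc (0 : ℝ) 1 := left_mem_Icc.2 zero_le_one
  have huξ : Tendsto (fun n => u (ξ n)) atTop (𝓝 0) := hu0.comp hξlim
  have halim : Tendsto (fun n => F.a (u (ξ n)) (deriv u (ξ n)) + ε * deriv u (ξ n)) atTop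
      (𝓝 0) := by
    have h1 : Tendsto (fun n => (u (ξ n), deriv u (ξ n))) atTop
        (𝓝[OmegaSet F.ω] ((0 : ℝ), (0 : ℝ))) :=
      tendsto_nhdsWithin_iff.2 ⟨huξ.prodMk_nhds hdlim, Eventually.of_forall fun n => hmem _⟩
    have h2 := (F.a_C1.continuousOn _ (F.zero_mem h0I)).tendsto.comp h1
    simp only [F.a_zero h0I] at h2
    simpa using h2.add (hdlim.const_mul ε)
  have hWlim : Tendsto (fun n => W (u (ξ n))) atTop (𝓝 (W 0)) :=
    (hWc 0 h0I).tendsto.comp (tendsto_nhdsWithin_iff.2 ⟨huξ, Eventually.of_forall fun n => huI _⟩)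
  exact le_antisymm (le_of_tendsto_of_tendsto' hWlim halim fun n => hle _)
    (ge_of_tendsto' hWlim fun n => (hWpos _ (hu01 _)).le)

/-- Every speed exceeding one whose extended solution vanishes at `0` is attained by perturbed
waves once `ε` is small. -/
theorem exists_forall_classicTW {W : ℝ → ℝ} {σ₁ σ : ℝ} (hσ₁ : 0 ≤ σ₁) (hσ : σ₁ < σ)
    (hW : IsVsol F σ₁ W) (hW0 : W 0 = 0) :
    ∃ ε₀ > 0, ∀ ε ∈ Ioo 0 ε₀, ∃ u : ℝ → ℝ,
      IsClassicTW F (fun w s => F.a w s + ε * s) σ u := by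
  obtain ⟨ε₀, hε₀, h⟩ := F.eventually_forall_perturbed_slope_le hσ₁ (sub_pos.2 hσ) hW
  obtain ⟨hWc, hW1, hWpos, hWd⟩ := hW
  refine ⟨ε₀, hε₀, fun ε hε => ?_⟩
  obtain ⟨V, k, hk, hV⟩ := F.exists_perturbed_sol hε.1 (hσ₁.trans_lt hσ) hWc hW1 hWpos
    fun u hu => ⟨_, hWd u hu, by linarith [h ε hε u hu]⟩
  exact F.exists_classicTW_of_sol hε.1 hk hWc hW0 hW1 hV

end FluxData

theorem stmt8 (F : FluxData) (hc : ContinuousOn F.aplus (Set.Icc (0:ℝ) 1))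
    (𝒱 : ℝ → ℝ → ℝ) (h𝒱 : ∀ σ : ℝ, 0 ≤ σ → IsVsol F σ (𝒱 σ))
    (σs : ℝ) (hσs : σs = sInf {σ : ℝ | 0 ≤ σ ∧ 𝒱 σ 0 = 0})
    (hne : {σ : ℝ | 0 ≤ σ ∧ 𝒱 σ 0 = 0}.Nonempty) :
    Filter.Tendsto
      (fun ε : ℝ => sInf {σ : ℝ | 0 < σ ∧
        ∃ u : ℝ → ℝ, IsClassicTW F (fun w s => F.a w s + ε * s) σ u})
      (nhdsWithin 0 (Set.Ioi 0)) (nhds σs) := by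
  have hbdd : ∀ S : Set ℝ, (∀ x ∈ S, 0 ≤ x) → BddBelow S := fun S hS => ⟨0, hS⟩
  have hsub : ∀ ε > 0, {σ : ℝ | 0 < σ ∧
      ∃ u : ℝ → ℝ, IsClassicTW F (fun w s => F.a w s + ε * s) σ u} ⊆
        {σ : ℝ | 0 ≤ σ ∧ 𝒱 σ 0 = 0} := by
    rintro ε hε σ ⟨hσ, u, hu⟩
    exact ⟨hσ.le, F.Vsol_zero_of_classicTW hε (h𝒱 σ hσ.le) hu⟩
  have key : ∀ b > σs, ∃ σ < b, ∃ ε₀ > 0, ∀ ε ∈ Ioo 0 ε₀, σ ∈ {σ : ℝ | 0 < σ ∧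
      ∃ u : ℝ → ℝ, IsClassicTW F (fun w s => F.a w s + ε * s) σ u} := by
    intro b hb
    rw [hσs] at hb
    obtain ⟨σ₁, ⟨hσ₁, hV₁⟩, hlt⟩ := exists_lt_of_csInf_lt hne hb
    obtain ⟨σ, h1, h2⟩ := exists_between hlt
    obtain ⟨ε₀, hε₀, h⟩ := F.exists_forall_classicTW hσ₁ h1 (h𝒱 σ₁ hσ₁) hV₁
    exact ⟨σ, h2, ε₀, hε₀, fun ε hε => ⟨hσ₁.trans_lt h1, h ε hε⟩⟩
  refine tendsto_order.2 ⟨fun b hb => ?_, fun b hb => ?_⟩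
  · obtain ⟨σ, -, ε₀, hε₀, h⟩ := key (σs + 1) (lt_add_one σs)
    filter_upwards [Ioo_mem_nhdsGT hε₀] with ε hε
    refine hb.trans_le ?_
    rw [hσs]
    exact csInf_le_csInf (hbdd _ fun x hx => hx.1) ⟨σ, h ε hε⟩ (hsub ε hε.1)
  · obtain ⟨σ, hσ, ε₀, hε₀, h⟩ := key b hb
    filter_upwards [Ioo_mem_nhdsGT hε₀] with ε hε
    exact (csInf_le (hbdd _ fun x hx => hx.1.le) (h ε hε)).trans_lt hσ
end
end

section
/- Assume (H_c). Set γ₀ := (∂a/∂s)(0,0) · f'(0) and let σ ≥ σ_s satisfy σ > 2√γ₀. Then the limit w_σ := lim_{u→0⁺} 𝒱_σ(u)/u exists, and σ = σ_s if and only if w_σ = σ/2 + √(σ²/4 − γ₀). -/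
open Set Filter Topology
open scoped ENNReal

noncomputable section

theorem zero_mem_Icc_zero_one : (0:ℝ) ∈ Set.Icc (0:ℝ) 1 := ⟨le_rfl, zero_le_one⟩

theorem FluxData.mem_omega_of_abs_le (F : FluxData) {u s t : ℝ} (h : (u, s) ∈ OmegaSet F.ω)
    (hts : |t| ≤ |s|) : (u, t) ∈ OmegaSet F.ω :=
  ⟨h.1, (ENNReal.ofReal_le_ofReal hts).trans_lt h.2⟩

theorem FluxData.zero_mem_omega (F : FluxData) {u : ℝ} (hu : u ∈ Set.Icc (0:ℝ) 1) :
    (u, 0) ∈ OmegaSet F.ω :=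
  ⟨hu, by simpa using F.ω_pos u hu⟩

theorem FluxData.a_zero_s17 (F : FluxData) {u : ℝ} (hu : u ∈ Set.Icc (0:ℝ) 1) : F.a u 0 = 0 := by
  have h := F.a_odd u 0 (F.zero_mem_omega hu)
  rw [neg_zero] at h
  linarith

theorem FluxData.strictMonoOn_a (F : FluxData) (u : ℝ) :
    StrictMonoOn (F.a u) {s | (u, s) ∈ OmegaSet F.ω} := by
  apply strictMonoOn_of_deriv_pos
  · apply Set.OrdConnected.convex
    refine ⟨fun x hx y hy z hz => ?_⟩
    rcases le_total |x| |y| with h | h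
    · exact F.mem_omega_of_abs_le hy (by
        rcases abs_cases x with hx | hx <;> rcases abs_cases y with hy | hy <;>
        rcases abs_cases z with hz' | hz' <;> linarith [hz.1, hz.2])
    · exact F.mem_omega_of_abs_le hx (by
        rcases abs_cases x with hx | hx <;> rcases abs_cases y with hy | hy <;>
        rcases abs_cases z with hz' | hz' <;> linarith [hz.1, hz.2])
  · intro s hs
    obtain ⟨d, -, hd⟩ := F.a_deriv_pos u s hs
    exact hd.continuousAt.continuousWithinAt
  · intro s hs
    obtain ⟨d, hd0, hd⟩ := F.a_deriv_pos u s (interior_subset (s := {s | (u, s) ∈ OmegaSet F.ω}) hs)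
    rwa [hd.deriv]

theorem FluxData.mem_DSet (F : FluxData) {u v : ℝ} (hu : u ∈ Set.Icc (0:ℝ) 1) (hv : 0 < v)
    (h : ENNReal.ofReal v < F.aplus u) : (u, v) ∈ DSet F.aplus :=
  ⟨hu, by simpa [abs_of_pos hv] using h⟩

theorem FluxData.g_lt_g (F : FluxData) {u v w : ℝ} (hv : (u, v) ∈ DSet F.aplus)
    (hw : (u, w) ∈ DSet F.aplus) (h : v < w) : F.g u v < F.g u w := by
  obtain ⟨h1, h2⟩ := F.g_spec _ hv
  obtain ⟨h3, h4⟩ := F.g_spec _ hw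
  dsimp only at h1 h2 h3 h4
  rw [← (F.strictMonoOn_a u).lt_iff_lt h1 h3, h2, h4]
  exact h

theorem FluxData.g_pos (F : FluxData) {u v : ℝ} (hu : u ∈ Set.Icc (0:ℝ) 1) (hv : 0 < v)
    (h : ENNReal.ofReal v < F.aplus u) : 0 < F.g u v := by
  obtain ⟨h1, h2⟩ := F.g_spec _ (F.mem_DSet hu hv h)
  dsimp only at h1 h2
  rw [← (F.strictMonoOn_a u).lt_iff_lt (F.zero_mem_omega hu) h1, h2, F.a_zero_s17 hu]
  exact hv

theorem Hfun_anti (F : FluxData) {u v w : ℝ} (hu : u ∈ Set.Icc (0:ℝ) 1) (hv : 0 < v)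
    (hvw : v ≤ w) : Hfun F u w ≤ Hfun F u v := by
  rcases hvw.eq_or_lt with rfl | hlt
  · exact le_rfl
  unfold Hfun
  split_ifs with h1 h2 h2
  · exact one_div_le_one_div_of_le (F.g_pos hu hv h2)
      (F.g_lt_g (F.mem_DSet hu hv h2) (F.mem_DSet hu (hv.trans hlt) h1) hlt).le
  · exact absurd ((ENNReal.ofReal_le_ofReal hvw).trans_lt h1) h2
  · exact (one_div_pos.2 (F.g_pos hu hv h2)).le
  · exact le_rfl

theorem FluxData.eventually_mem_omega (F : FluxData) :
    ∀ᶠ p in 𝓝[Set.Icc (0:ℝ) 1] (0:ℝ) ×ˢ 𝓝 (0:ℝ), p ∈ OmegaSet F.ω := by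
  obtain ⟨r, -, hr0, hr⟩ := ENNReal.lt_iff_exists_real_btwn.1 (F.ω_pos 0 zero_mem_Icc_zero_one)
  have hr0 : 0 < r := ENNReal.ofReal_pos.1 hr0
  have h1 := F.ω_lsc 0 zero_mem_Icc_zero_one _ hr
  have h2 : ∀ᶠ s in 𝓝 (0:ℝ), |s| < r := by
    have : ∀ᶠ s in 𝓝 (0:ℝ), s ∈ Set.Ioo (-r) r := Ioo_mem_nhds (by linarith) hr0
    filter_upwards [this] with s hs using abs_lt.2 hs
  filter_upwards [(h1.and eventually_mem_nhdsWithin).prod_mk h2] with p hp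
  exact ⟨hp.1.2, (ENNReal.ofReal_le_ofReal hp.2.le).trans_lt hp.1.1⟩

theorem FluxData.tendsto_a_div (F : FluxData) {d : ℝ} (hd : HasDerivAt (F.a 0) d 0) :
    Tendsto (fun p : ℝ × ℝ => F.a p.1 p.2 / p.2) (𝓝[Set.Icc (0:ℝ) 1] (0:ℝ) ×ˢ 𝓝[>] (0:ℝ))
      (𝓝 d) := by
  have hmem := F.zero_mem_omega zero_mem_Icc_zero_one
  obtain ⟨U, hU, -, -, f', hf', hcont⟩ :=
    (contDiffWithinAt_succ_iff_hasFDerivWithinAt' (n := 0) (by simp)).1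
      ((zero_add (1 : WithTop ℕ∞)).symm ▸ F.a_C1 (0, 0) hmem)
  rw [Set.insert_eq_of_mem hmem] at hU
  have hD : ∀ p ∈ U, p ∈ OmegaSet F.ω → HasDerivAt (F.a p.1) (f' p (0, 1)) p.2 := by
    rintro ⟨u, s⟩ hp hpΩ
    have h1 : HasDerivAt (fun t : ℝ => (u, t)) ((0:ℝ), (1:ℝ)) s :=
      (hasDerivAt_const s u).prodMk (hasDerivAt_id s)
    have h2 : {t : ℝ | (u, t) ∈ OmegaSet F.ω} ∈ 𝓝 s := by
      have hc : Continuous fun t : ℝ => ENNReal.ofReal |t| :=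
        ENNReal.continuous_ofReal.comp continuous_abs
      filter_upwards [(hc.tendsto s).eventually_lt_const hpΩ.2] with t ht
      exact ⟨hpΩ.1, ht⟩
    have h3 := (hf' (u, s) hp).comp_hasDerivWithinAt_of_eq s
      (h1.hasDerivWithinAt (s := {t : ℝ | (u, t) ∈ OmegaSet F.ω})) (fun t ht => ht) rfl
    exact h3.hasDerivAt h2
  have hid : Tendsto id (𝓝[Set.Icc (0:ℝ) 1] (0:ℝ) ×ˢ 𝓝 (0:ℝ)) (𝓝[OmegaSet F.ω] ((0:ℝ), (0:ℝ))) := by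
    refine tendsto_nhdsWithin_iff.2 ⟨?_, F.eventually_mem_omega⟩
    rw [nhds_prod_eq]
    exact Filter.prod_mono nhdsWithin_le_nhds le_rfl
  have hf0 : f' (0, 0) (0, 1) = d := (hD _ (mem_of_mem_nhdsWithin hmem hU) hmem).unique hd
  have hlim : Tendsto (fun p => f' p (0, 1)) (𝓝[OmegaSet F.ω] ((0:ℝ), (0:ℝ))) (𝓝 d) := by
    rw [← hf0]
    exact (hcont.continuousWithinAt.clm_apply continuousWithinAt_const :
      ContinuousWithinAt (fun p => f' p (0, 1)) _ _)
  rw [Metric.tendsto_nhds]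
  intro η hη
  have hgood := (hid.eventually ((Metric.tendsto_nhds.1 hlim η hη).and hU)).and
    F.eventually_mem_omega
  obtain ⟨pa, hpa, pb, hpb, H⟩ := Filter.eventually_prod_iff.1 hgood
  obtain ⟨ε, hε, hball⟩ := Metric.eventually_nhds_iff.1 hpb
  have hs : ∀ᶠ s in 𝓝[>] (0:ℝ), s ∈ Set.Ioo 0 ε := Ioo_mem_nhdsGT hε
  filter_upwards [(hpa.and eventually_mem_nhdsWithin).prod_mk hs]
  rintro ⟨u, s⟩ ⟨⟨hu, huI⟩, hs0, hsε⟩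
  dsimp only at hu huI hs0 hsε ⊢
  have hx : ∀ x ∈ Set.Icc 0 s, dist (f' (u, x) (0, 1)) d < η ∧
      HasDerivAt (F.a u) (f' (u, x) (0, 1)) x := by
    intro x hx
    have := H hu (hball (y := x) (by
      rw [Real.dist_eq, sub_zero, abs_of_nonneg hx.1]; linarith [hx.2]))
    exact ⟨this.1.1, hD (u, x) this.1.2 this.2⟩
  obtain ⟨c, hc, hc'⟩ := exists_hasDerivAt_eq_slope (F.a u) (fun x => f' (u, x) (0, 1)) hs0
    (fun x hx' => (hx x hx').2.continuousAt.continuousWithinAt)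
    (fun x hx' => (hx x (Set.Ioo_subset_Icc_self hx')).2)
  have := (hx c (Set.Ioo_subset_Icc_self hc)).1
  rw [hc', F.a_zero_s17 huI] at this
  simpa using this

theorem FluxData.eventually_lt_aplus (F : FluxData)
    (hc : ContinuousOn F.aplus (Set.Icc (0:ℝ) 1)) :
    ∀ᶠ p : ℝ × ℝ in 𝓝[Set.Icc (0:ℝ) 1] (0:ℝ) ×ˢ 𝓝[>] (0:ℝ),
      ENNReal.ofReal p.2 < F.aplus p.1 := by
  obtain ⟨r, -, hr0, hr⟩ := ENNReal.lt_iff_exists_real_btwn.1 (F.aplus_pos 0 zero_mem_Icc_zero_one)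
  have hr0 : 0 < r := ENNReal.ofReal_pos.1 hr0
  have h1 := (hc 0 zero_mem_Icc_zero_one).eventually_const_lt hr
  have h2 : ∀ᶠ s in 𝓝[>] (0:ℝ), s ∈ Set.Ioo 0 r := Ioo_mem_nhdsGT hr0
  filter_upwards [h1.prod_mk h2] with p hp
  exact (ENNReal.ofReal_le_ofReal hp.2.2.le).trans_lt hp.1

theorem FluxData.tendsto_g (F : FluxData) (hc : ContinuousOn F.aplus (Set.Icc (0:ℝ) 1)) :
    Tendsto (fun p : ℝ × ℝ => F.g p.1 p.2) (𝓝[Set.Icc (0:ℝ) 1] (0:ℝ) ×ˢ 𝓝[>] (0:ℝ))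
      (𝓝[>] (0:ℝ)) := by
  have hIoi : ∀ᶠ p : ℝ × ℝ in 𝓝[Set.Icc (0:ℝ) 1] (0:ℝ) ×ˢ 𝓝[>] (0:ℝ),
      p.1 ∈ Set.Icc (0:ℝ) 1 ∧ 0 < p.2 :=
    eventually_mem_nhdsWithin.prod_mk eventually_mem_nhdsWithin
  have hpos : ∀ᶠ p : ℝ × ℝ in 𝓝[Set.Icc (0:ℝ) 1] (0:ℝ) ×ˢ 𝓝[>] (0:ℝ), 0 < F.g p.1 p.2 := by
    filter_upwards [hIoi, F.eventually_lt_aplus hc] with p h1 h2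
    exact F.g_pos h1.1 h1.2 h2
  refine tendsto_nhdsWithin_iff.2 ⟨?_, hpos⟩
  rw [Metric.tendsto_nhds]
  intro ε hε
  obtain ⟨pa, hpa, pb, hpb, H⟩ := Filter.eventually_prod_iff.1 F.eventually_mem_omega
  obtain ⟨δ, hδ, hball⟩ := Metric.eventually_nhds_iff.1 hpb
  set η := min ε δ / 2 with hη
  have hmin : 0 < min ε δ := lt_min hε hδ
  have hη0 : 0 < η := by positivity
  have hηε : η < ε := by have := min_le_left ε δ; linarith
  have hηδ : η < δ := by have := min_le_right ε δ; linarith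
  have hpbη : pb η := hball (by rw [Real.dist_eq, sub_zero, abs_of_pos hη0]; exact hηδ)
  have hmem : ((0:ℝ), η) ∈ OmegaSet F.ω :=
    H (hpa.self_of_nhdsWithin zero_mem_Icc_zero_one) hpbη
  have ha0 : 0 < F.a 0 η := by
    have := F.strictMonoOn_a 0 (F.zero_mem_omega zero_mem_Icc_zero_one) hmem hη0
    rwa [F.a_zero_s17 zero_mem_Icc_zero_one] at this
  have hcont : Tendsto (fun u => F.a u η) (𝓝[Set.Icc (0:ℝ) 1] 0) (𝓝 (F.a 0 η)) := by
    have h1 := F.a_C1.continuousOn (0, η) hmem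
    refine Tendsto.comp (f := fun u : ℝ => (u, η)) h1 (tendsto_nhdsWithin_iff.2 ⟨?_, ?_⟩)
    · exact (Continuous.tendsto (by fun_prop) 0).mono_left nhdsWithin_le_nhds
    · filter_upwards [hpa] with u hu using H hu hpbη
  have h1 := hcont.eventually_const_lt (half_lt_self ha0)
  have h2 : ∀ᶠ s in 𝓝[>] (0:ℝ), s ∈ Set.Ioo 0 (F.a 0 η / 2) := Ioo_mem_nhdsGT (half_pos ha0)
  filter_upwards [(h1.and hpa).prod_mk h2, hpos, hIoi, F.eventually_lt_aplus hc]
  rintro ⟨u, v⟩ ⟨⟨h1, h2⟩, -, h3⟩ h4 h5 h6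
  dsimp only at h1 h2 h3 h4 h5 h6 ⊢
  obtain ⟨h7, h8⟩ := F.g_spec _ (F.mem_DSet h5.1 h5.2 h6)
  dsimp only at h7 h8
  have : F.g u v < η := by
    rw [← (F.strictMonoOn_a u).lt_iff_lt h7 (H h2 hpbη), h8]
    linarith
  rw [Real.dist_eq, sub_zero, abs_of_pos h4]
  linarith

theorem tendsto_mul_Hfun (F : FluxData) (hc : ContinuousOn F.aplus (Set.Icc (0:ℝ) 1))
    {d : ℝ} (hd : HasDerivAt (F.a 0) d 0) :
    Tendsto (fun p : ℝ × ℝ => p.2 * Hfun F p.1 p.2)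
      (𝓝[Set.Icc (0:ℝ) 1] (0:ℝ) ×ˢ 𝓝[>] (0:ℝ)) (𝓝 d) := by
  have h := (F.tendsto_a_div hd).comp (tendsto_fst.prodMk (F.tendsto_g hc))
  refine h.congr' ?_
  have hIoi : ∀ᶠ p : ℝ × ℝ in 𝓝[Set.Icc (0:ℝ) 1] (0:ℝ) ×ˢ 𝓝[>] (0:ℝ),
      p.1 ∈ Set.Icc (0:ℝ) 1 ∧ 0 < p.2 :=
    eventually_mem_nhdsWithin.prod_mk eventually_mem_nhdsWithin
  filter_upwards [hIoi, F.eventually_lt_aplus hc]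
  rintro ⟨u, v⟩ h5 h6
  obtain ⟨h7, h8⟩ := F.g_spec _ (F.mem_DSet h5.1 h5.2 h6)
  dsimp only [Function.comp] at h7 h8 h6 ⊢
  rw [h8, Hfun, if_pos h6]
  ring

/-- Along a positive function vanishing at `0`, `V · f · ℋ(·, V)` is equivalent to `γ₀ u`. -/
theorem tendsto_reaction (F : FluxData) (hc : ContinuousOn F.aplus (Set.Icc (0:ℝ) 1))
    {d e : ℝ} (hd : HasDerivAt (F.a 0) d 0)
    (he : HasDerivWithinAt F.f e (Set.Icc (0:ℝ) 1) 0)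
    {V : ℝ → ℝ} (hV : Tendsto V (𝓝[>] 0) (𝓝[>] 0)) :
    Tendsto (fun u => F.f u / u * (V u * Hfun F u (V u))) (𝓝[>] 0) (𝓝 (d * e)) := by
  have hle : 𝓝[>] (0:ℝ) ≤ 𝓝[Set.Icc (0:ℝ) 1] 0 := by
    rw [nhdsWithin_le_iff]
    exact Icc_mem_nhdsGT zero_lt_one
  have h1 := (tendsto_mul_Hfun F hc hd).comp ((tendsto_id.mono_left hle).prodMk hV)
  have h2 : Tendsto (fun u => F.f u / u) (𝓝[>] 0) (𝓝 e) := by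
    have h3 : HasDerivWithinAt F.f e (Set.Ioi 0) 0 :=
      he.mono_of_mem_nhdsWithin (nhdsWithin_le_iff.1 hle)
    rw [hasDerivWithinAt_iff_tendsto_slope' (by simp)] at h3
    refine h3.congr' ?_
    filter_upwards with u
    simp [slope_def_field, F.f_zero]
  rw [mul_comm d e]
  exact h2.mul h1

theorem IsVsol.le_of_lt {F : FluxData} {σ₁ σ₂ : ℝ} {V W : ℝ → ℝ} (hV : IsVsol F σ₁ V)
    (hW : IsVsol F σ₂ W) (hσ : σ₁ < σ₂) : ∀ u ∈ Set.Icc (0:ℝ) 1, W u ≤ V u := by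
  have key : ∀ u ∈ Set.Ioo (0:ℝ) 1, W u ≤ V u := by
    intro u hu
    by_contra! hlt
    have hsub : Set.Icc u 1 ⊆ Set.Icc 0 1 := Set.Icc_subset_Icc_left hu.1.le
    have hsub' : ∀ x ∈ Set.Ico u 1, x ∈ Set.Ioo (0:ℝ) 1 :=
      fun x hx => ⟨hu.1.trans_le hx.1, hx.2⟩
    have := image_le_of_deriv_right_lt_deriv_boundary' (a := u) (b := 1)
      (f := fun _ => W u - V u) (f' := fun _ => 0) (B := fun x => W x - V x)
      (B' := fun x => (σ₂ - F.f x * Hfun F x (W x)) - (σ₁ - F.f x * Hfun F x (V x)))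
      continuousOn_const (fun x _ => hasDerivWithinAt_const _ _ _) le_rfl
      ((hW.1.sub hV.1).mono hsub)
      (fun x hx => ((hW.2.2.2 x (hsub' x hx)).sub (hV.2.2.2 x (hsub' x hx))).hasDerivWithinAt)
      (fun x hx heq => by
        have hx' := hsub' x hx
        have hH := Hfun_anti F (Set.Ioo_subset_Icc_self hx') (hV.2.2.1 x hx')
          (show V x ≤ W x by linarith)
        have := mul_le_mul_of_nonneg_left hH (F.f_pos x hx').le
        linarith)
      (Set.right_mem_Icc.2 hu.2.le)
    simp only [hW.2.1, hV.2.1] at this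
    linarith
  have hcl := closure_Ioo (zero_ne_one (α := ℝ))
  intro u hu
  rw [← hcl] at hu
  exact le_on_closure key (hcl ▸ hW.1) (hcl ▸ hV.1) hu

theorem IsVsol.le_add_of_lt {F : FluxData} {σ₁ σ₂ : ℝ} {V W : ℝ → ℝ} (hV : IsVsol F σ₁ V)
    (hW : IsVsol F σ₂ W) (hσ : σ₁ < σ₂) :
    ∀ u ∈ Set.Icc (0:ℝ) 1, V u ≤ W u + (σ₂ - σ₁) := by
  have hder : ∀ x ∈ Set.Ioo (0:ℝ) 1, HasDerivAt (fun x => V x - W x + (σ₂ - σ₁) * x)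
      ((σ₁ - F.f x * Hfun F x (V x)) - (σ₂ - F.f x * Hfun F x (W x)) + (σ₂ - σ₁) * 1) x :=
    fun x hx => ((hV.2.2.2 x hx).sub (hW.2.2.2 x hx)).add ((hasDerivAt_id x).const_mul _)
  have hmono : MonotoneOn (fun x => V x - W x + (σ₂ - σ₁) * x) (Set.Icc 0 1) := by
    apply monotoneOn_of_deriv_nonneg (convex_Icc 0 1)
    · exact (hV.1.sub hW.1).add (by fun_prop)
    · rw [interior_Icc]
      exact fun x hx => (hder x hx).differentiableAt.differentiableWithinAt
    · rw [interior_Icc]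
      intro x hx
      rw [(hder x hx).deriv]
      have hH := Hfun_anti F (Set.Ioo_subset_Icc_self hx) (hW.2.2.1 x hx)
        (hV.le_of_lt hW hσ x (Set.Ioo_subset_Icc_self hx))
      have := mul_le_mul_of_nonneg_left hH (F.f_pos x hx).le
      linarith
  intro u hu
  have := hmono hu (Set.right_mem_Icc.2 zero_le_one) hu.2
  simp only [hV.2.1, hW.2.1] at this
  nlinarith [hu.1]

theorem IsVsol.apply_zero_nonneg {F : FluxData} {σ : ℝ} {V : ℝ → ℝ} (hV : IsVsol F σ V) :
    0 ≤ V 0 := by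
  have hcl := closure_Ioo (zero_ne_one (α := ℝ))
  exact le_on_closure (f := fun _ => (0:ℝ)) (fun x hx => (hV.2.2.1 x hx).le)
    continuousOn_const (hcl ▸ hV.1) (hcl ▸ zero_mem_Icc_zero_one)

theorem IsVsol.tendsto_zero {F : FluxData} {σ : ℝ} {V : ℝ → ℝ} (hV : IsVsol F σ V) :
    Tendsto V (𝓝[>] 0) (𝓝 (V 0)) :=
  (hV.1 0 zero_mem_Icc_zero_one).mono_left (nhdsWithin_le_iff.2 (Icc_mem_nhdsGT zero_lt_one))

theorem Hfun_nonneg (F : FluxData) {u v : ℝ} (hu : u ∈ Set.Icc (0:ℝ) 1) (hv : 0 < v) :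
    0 ≤ Hfun F u v := by
  unfold Hfun
  split_ifs with h
  · exact (one_div_pos.2 (F.g_pos hu hv h)).le
  · exact le_rfl

theorem tendsto_reaction_line (F : FluxData) (hc : ContinuousOn F.aplus (Set.Icc (0:ℝ) 1))
    {d e : ℝ} (hd : HasDerivAt (F.a 0) d 0)
    (he : HasDerivWithinAt F.f e (Set.Icc (0:ℝ) 1) 0) {m : ℝ} (hm : 0 < m) :
    Tendsto (fun u => F.f u * Hfun F u (m * u)) (𝓝[>] 0) (𝓝 (d * e / m)) := by
  have hV : Tendsto (fun u => m * u) (𝓝[>] 0) (𝓝[>] 0) := by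
    refine tendsto_nhdsWithin_iff.2 ⟨?_, ?_⟩
    · have : Tendsto (fun u : ℝ => m * u) (𝓝 0) (𝓝 (m * 0)) := Continuous.tendsto (by fun_prop) 0
      rw [mul_zero] at this
      exact this.mono_left nhdsWithin_le_nhds
    · filter_upwards [eventually_mem_nhdsWithin] with u hu using mul_pos hm hu
  refine ((tendsto_reaction F hc hd he hV).div_const m).congr' ?_
  filter_upwards [eventually_mem_nhdsWithin] with u hu
  have : u ≠ 0 := ne_of_gt hu
  field_simp

theorem IsVsol.line_le {F : FluxData} {σ : ℝ} {V : ℝ → ℝ} (hV : IsVsol F σ V) {m δ : ℝ}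
    (hδ : δ ≤ 1) (H : ∀ u ∈ Set.Ioo 0 δ, F.f u * Hfun F u (m * u) < σ - m) {u₁ u : ℝ}
    (hu₁ : 0 < u₁) (h₁ : m * u₁ ≤ V u₁) (hle : u₁ ≤ u) (hu : u < δ) : m * u ≤ V u := by
  have hmem : ∀ x ∈ Set.Ico u₁ u, x ∈ Set.Ioo 0 δ :=
    fun x hx => ⟨hu₁.trans_le hx.1, hx.2.trans hu⟩
  exact image_le_of_deriv_right_lt_deriv_boundary' (a := u₁) (b := u)
    (f := fun x => m * x) (f' := fun _ => m * 1) (B := V)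
    (B' := fun x => σ - F.f x * Hfun F x (V x))
    (by fun_prop) (fun x _ => ((hasDerivAt_id x).const_mul m).hasDerivWithinAt) h₁
    (hV.1.mono (Set.Icc_subset_Icc hu₁.le (hu.le.trans hδ)))
    (fun x hx => (hV.2.2.2 x (Set.Ioo_subset_Ioo_right hδ (hmem x hx))).hasDerivWithinAt)
    (fun x hx heq => by
      have := H x (hmem x hx)
      rw [← heq]
      linarith)
    (Set.right_mem_Icc.2 hle)

theorem IsVsol.le_line {F : FluxData} {σ : ℝ} {V : ℝ → ℝ} (hV : IsVsol F σ V) {m δ : ℝ}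
    (hδ : δ ≤ 1) (H : ∀ u ∈ Set.Ioo 0 δ, σ - m < F.f u * Hfun F u (m * u)) {u₁ u : ℝ}
    (hu₁ : 0 < u₁) (h₁ : V u₁ ≤ m * u₁) (hle : u₁ ≤ u) (hu : u < δ) : V u ≤ m * u := by
  have hmem : ∀ x ∈ Set.Ico u₁ u, x ∈ Set.Ioo 0 δ :=
    fun x hx => ⟨hu₁.trans_le hx.1, hx.2.trans hu⟩
  exact image_le_of_deriv_right_lt_deriv_boundary' (a := u₁) (b := u)
    (f := V) (f' := fun x => σ - F.f x * Hfun F x (V x)) (B := fun x => m * x)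
    (B' := fun _ => m * 1)
    (hV.1.mono (Set.Icc_subset_Icc hu₁.le (hu.le.trans hδ)))
    (fun x hx => (hV.2.2.2 x (Set.Ioo_subset_Ioo_right hδ (hmem x hx))).hasDerivWithinAt) h₁
    (by fun_prop) (fun x _ => ((hasDerivAt_id x).const_mul m).hasDerivWithinAt)
    (fun x hx heq => by
      have := H x (hmem x hx)
      rw [heq]
      linarith)
    (Set.right_mem_Icc.2 hle)

theorem exists_Ioo_of_eventually_nhdsGT {p : ℝ → Prop} (h : ∀ᶠ u in 𝓝[>] (0:ℝ), p u) :
    ∃ δ, 0 < δ ∧ δ ≤ 1 ∧ ∀ u ∈ Set.Ioo 0 δ, p u := by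
  obtain ⟨δ, hδ, hsub⟩ := mem_nhdsGT_iff_exists_Ioo_subset.1 h
  exact ⟨min δ 1, lt_min hδ one_pos, min_le_right _ _,
    fun u hu => hsub ⟨hu.1, hu.2.trans_le (min_le_left _ _)⟩⟩

theorem IsVsol.le_mul {F : FluxData} {σ : ℝ} {V : ℝ → ℝ} (hV : IsVsol F σ V) (h0 : V 0 = 0) :
    ∀ u ∈ Set.Icc (0:ℝ) 1, V u ≤ σ * u := by
  have hder : ∀ x ∈ Set.Ioo (0:ℝ) 1, HasDerivAt (fun x => V x - σ * x)
      ((σ - F.f x * Hfun F x (V x)) - σ * 1) x :=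
    fun x hx => (hV.2.2.2 x hx).sub ((hasDerivAt_id x).const_mul _)
  have hanti : AntitoneOn (fun x => V x - σ * x) (Set.Icc 0 1) := by
    apply antitoneOn_of_deriv_nonpos (convex_Icc 0 1)
    · exact hV.1.sub (by fun_prop)
    · rw [interior_Icc]
      exact fun x hx => (hder x hx).differentiableAt.differentiableWithinAt
    · rw [interior_Icc]
      intro x hx
      rw [(hder x hx).deriv]
      have := mul_nonneg (F.f_pos x hx).le
        (Hfun_nonneg F (Set.Ioo_subset_Icc_self hx) (hV.2.2.1 x hx))
      linarith
  intro u hu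
  have := hanti zero_mem_Icc_zero_one hu hu.1
  simp only [h0, mul_zero, sub_zero] at this
  linarith

theorem IsVsol.not_frequently {F : FluxData} {r₁ r₂ : ℝ} {V : ℝ → ℝ}
    (hV : IsVsol F (r₁ + r₂) V) (hc : ContinuousOn F.aplus (Set.Icc (0:ℝ) 1))
    {d e : ℝ} (hd : HasDerivAt (F.a 0) d 0)
    (he : HasDerivWithinAt F.f e (Set.Icc (0:ℝ) 1) 0) (hprod : d * e = r₁ * r₂) {m : ℝ}
    (hm : 0 < m) (h₁ : m ≠ r₁) (h₂ : m ≠ r₂)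
    (hlt : ∃ᶠ u in 𝓝[>] 0, V u / u < m) (hgt : ∃ᶠ u in 𝓝[>] 0, m < V u / u) : False := by
  have hlim := tendsto_reaction_line F hc hd he hm
  have hne : (m - r₁) * (m - r₂) ≠ 0 := mul_ne_zero (sub_ne_zero.2 h₁) (sub_ne_zero.2 h₂)
  have hid : r₁ + r₂ - m - d * e / m = -((m - r₁) * (m - r₂)) / m := by
    rw [hprod]
    field_simp
    ring
  rcases hne.lt_or_gt with hneg | hpos
  · have h : d * e / m < r₁ + r₂ - m := by
      have : 0 < -((m - r₁) * (m - r₂)) / m := div_pos (by linarith) hm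
      linarith
    obtain ⟨δ, hδ, hδ1, H⟩ := exists_Ioo_of_eventually_nhdsGT (hlim.eventually_lt_const h)
    obtain ⟨u, hu, hu0, huδ⟩ := (hlt.and_eventually (Ioo_mem_nhdsGT hδ)).exists
    obtain ⟨v, hv, hv0, hvu⟩ := (hgt.and_eventually (Ioo_mem_nhdsGT hu0)).exists
    rw [lt_div_iff₀ hv0] at hv
    rw [div_lt_iff₀ hu0] at hu
    have := hV.line_le hδ1 H hv0 hv.le hvu.le huδ
    linarith
  · have h : r₁ + r₂ - m < d * e / m := by
      have : -((m - r₁) * (m - r₂)) / m < 0 := div_neg_of_neg_of_pos (by linarith) hm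
      linarith
    obtain ⟨δ, hδ, hδ1, H⟩ := exists_Ioo_of_eventually_nhdsGT (hlim.eventually_const_lt h)
    obtain ⟨u, hu, hu0, huδ⟩ := (hgt.and_eventually (Ioo_mem_nhdsGT hδ)).exists
    obtain ⟨v, hv, hv0, hvu⟩ := (hlt.and_eventually (Ioo_mem_nhdsGT hu0)).exists
    rw [lt_div_iff₀ hu0] at hu
    rw [div_lt_iff₀ hv0] at hv
    have := hV.le_line hδ1 H hv0 hv.le hvu.le huδ
    linarith

theorem IsVsol.exists_tendsto_div {F : FluxData} {r₁ r₂ : ℝ} {V : ℝ → ℝ}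
    (hV : IsVsol F (r₁ + r₂) V) (h0 : V 0 = 0)
    (hc : ContinuousOn F.aplus (Set.Icc (0:ℝ) 1))
    {d e : ℝ} (hd : HasDerivAt (F.a 0) d 0)
    (he : HasDerivWithinAt F.f e (Set.Icc (0:ℝ) 1) 0) (hprod : d * e = r₁ * r₂)
    (hr₁ : 0 ≤ r₁) (hr₂ : 0 ≤ r₂) :
    ∃ w, Tendsto (fun u => V u / u) (𝓝[>] 0) (𝓝 w) ∧ (w = r₁ ∨ w = r₂) := by
  have hIoo : ∀ᶠ u in 𝓝[>] (0:ℝ), u ∈ Set.Ioo (0:ℝ) 1 := Ioo_mem_nhdsGT one_pos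
  have hpos : ∀ᶠ u in 𝓝[>] (0:ℝ), 0 < V u / u := by
    filter_upwards [hIoo] with u hu using div_pos (hV.2.2.1 u hu) hu.1
  have hbdd : ∀ᶠ u in 𝓝[>] (0:ℝ), V u / u ≤ r₁ + r₂ := by
    filter_upwards [hIoo] with u hu
    rw [div_le_iff₀ hu.1]
    exact hV.le_mul h0 u (Set.Ioo_subset_Icc_self hu)
  obtain ⟨w, hw⟩ : ∃ w, Tendsto (fun u => V u / u) (𝓝[>] 0) (𝓝 w) := by
    refine tendsto_of_no_upcrossings (s := Set.univ \ {r₁, r₂})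
      (dense_univ.sdiff_finite (Set.toFinite _)) ?_ ⟨r₁ + r₂, hbdd⟩
      ⟨0, eventually_map.2 (hpos.mono fun u hu => hu.le)⟩
    rintro a ha b - hab ⟨hlt, hgt⟩
    simp only [Set.mem_sdiff, Set.mem_univ, Set.mem_insert_iff, Set.mem_singleton_iff, true_and,
      not_or] at ha
    obtain ⟨u, hu, hu0⟩ := (hlt.and_eventually hpos).exists
    exact hV.not_frequently hc hd he hprod (hu0.trans hu) ha.1 ha.2 hlt
      (hgt.mono fun u hu => hab.trans hu)
  refine ⟨w, hw, ?_⟩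
  have hVlim : Tendsto V (𝓝[>] 0) (𝓝 0) := by
    have := hV.tendsto_zero
    rwa [h0] at this
  have hreact := tendsto_reaction F hc hd he (tendsto_nhdsWithin_iff.2
    ⟨hVlim, by filter_upwards [hIoo] with u hu using hV.2.2.1 u hu⟩)
  have hw0 : 0 ≤ w := ge_of_tendsto hw (hpos.mono fun u hu => hu.le)
  have hdiv : ∀ᶠ u in 𝓝[>] (0:ℝ), F.f u / u * (V u * Hfun F u (V u)) =
      F.f u * Hfun F u (V u) * (V u / u) := by
    filter_upwards with u
    ring
  have hroot : w * (r₁ + r₂ - w) = r₁ * r₂ := by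
    rcases hw0.eq_or_lt with rfl | hwpos
    · rw [zero_mul]
      by_contra hne
      have hγ : 0 < r₁ * r₂ := (mul_nonneg hr₁ hr₂).lt_of_ne hne
      have hσ : 0 < r₁ + r₂ + 1 := by positivity
      rw [hprod] at hreact
      have h1 := hreact.eventually_const_lt (half_lt_self hγ)
      have h2 := hw.eventually_lt_const (show 0 < r₁ * r₂ / 2 / (r₁ + r₂ + 1) by positivity)
      obtain ⟨δ, hδ, hδ1, H⟩ := exists_Ioo_of_eventually_nhdsGT
        ((h1.and h2).and (hpos.and hdiv))
      have hmem : δ / 2 ∈ Set.Ioo (0:ℝ) 1 := ⟨by linarith, by linarith⟩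
      obtain ⟨c, hcI, hc'⟩ := exists_hasDerivAt_eq_slope V
        (fun x => r₁ + r₂ - F.f x * Hfun F x (V x)) hmem.1
        (hV.1.mono (Set.Icc_subset_Icc_right hmem.2.le))
        (fun x hx => hV.2.2.2 x ⟨hx.1, hx.2.trans hmem.2⟩)
      obtain ⟨⟨h3, h4⟩, h5, h6⟩ := H c ⟨hcI.1, by linarith [hcI.2]⟩
      have h7 : 0 < (V (δ / 2) - V 0) / (δ / 2 - 0) := by
        rw [h0, sub_zero, sub_zero]
        exact div_pos (hV.2.2.1 _ hmem) hmem.1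
      rw [← hc'] at h7
      rw [h6] at h3
      rw [lt_div_iff₀ hσ] at h4
      nlinarith
    · have h1 : Tendsto (fun u => F.f u * Hfun F u (V u)) (𝓝[>] 0) (𝓝 (d * e / w)) := by
        refine (hreact.div hw hwpos.ne').congr' ?_
        filter_upwards [hdiv, hpos] with u hu hu0
        simp only [Pi.div_apply]
        rw [hu, mul_div_assoc, div_self hu0.ne', mul_one]
      have h2 := HasDerivAt.lhopital_zero_nhdsGT (f := V) (g := fun u => u) (g' := fun _ => 1)
        (f' := fun x => r₁ + r₂ - F.f x * Hfun F x (V x)) (l := 𝓝 (r₁ + r₂ - d * e / w)) (a := 0)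
        (by filter_upwards [hIoo] with u hu using hV.2.2.2 u hu)
        (by filter_upwards with u using hasDerivAt_id u)
        (by simp) hVlim (tendsto_id.mono_left nhdsWithin_le_nhds)
        (by simpa using tendsto_const_nhds.sub h1)
      have h3 := tendsto_nhds_unique hw h2
      rw [hprod] at h3
      field_simp at h3
      linarith
  have : (w - r₁) * (w - r₂) = 0 := by linear_combination -hroot
  rcases mul_eq_zero.1 this with h | h
  · exact Or.inl (sub_eq_zero.1 h)
  · exact Or.inr (sub_eq_zero.1 h)

/-- At the threshold speed the solution stays above every line whose slope lies strictly between
the two characteristic slopes. -/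
theorem line_le_of_forall_lt {F : FluxData} {r₁ r₂ : ℝ} {𝒱 : ℝ → ℝ → ℝ}
    (h𝒱 : ∀ σ : ℝ, 0 ≤ σ → IsVsol F σ (𝒱 σ))
    (hpos : ∀ σ, 0 ≤ σ → σ < r₁ + r₂ → 0 < 𝒱 σ 0)
    (hc : ContinuousOn F.aplus (Set.Icc (0:ℝ) 1))
    {d e : ℝ} (hd : HasDerivAt (F.a 0) d 0)
    (he : HasDerivWithinAt F.f e (Set.Icc (0:ℝ) 1) 0) (hprod : d * e = r₁ * r₂)
    (hr₁ : 0 ≤ r₁) {m : ℝ} (h₁ : r₁ < m) (h₂ : m < r₂) :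
    ∀ᶠ u in 𝓝[>] 0, m * u ≤ 𝒱 (r₁ + r₂) u := by
  have hm : 0 < m := hr₁.trans_lt h₁
  have h : d * e / m + m < r₁ + r₂ := by
    rw [hprod, ← lt_sub_iff_add_lt, div_lt_iff₀ hm]
    nlinarith
  obtain ⟨τ, hτ, hτ'⟩ := exists_between h
  have hde : 0 ≤ d * e / m := by
    rw [hprod]
    exact div_nonneg (mul_nonneg hr₁ (hm.trans h₂).le) hm.le
  obtain ⟨δ, hδ, hδ1, H⟩ := exists_Ioo_of_eventually_nhdsGT
    ((tendsto_reaction_line F hc hd he hm).eventually_lt_const (lt_sub_iff_add_lt.2 hτ))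
  have key : ∀ σ, τ < σ → σ < r₁ + r₂ → ∀ u ∈ Set.Ioo 0 δ, m * u ≤ 𝒱 σ u := by
    intro σ h1 h2 u hu
    have hσ : 0 ≤ σ := by linarith
    have h3 := (h𝒱 σ hσ).tendsto_zero
    have h4 : Tendsto (fun u => m * u) (𝓝[>] 0) (𝓝 0) := by
      have : Tendsto (fun u : ℝ => m * u) (𝓝 0) (𝓝 (m * 0)) :=
        Continuous.tendsto (by fun_prop) 0
      rw [mul_zero] at this
      exact this.mono_left nhdsWithin_le_nhds
    obtain ⟨v, hv, hv0, hvu⟩ :=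
      ((h4.eventually_lt h3 (hpos σ hσ h2)).and (Ioo_mem_nhdsGT hu.1)).exists
    exact (h𝒱 σ hσ).line_le hδ1 (fun x hx => (H x hx).trans (by linarith)) hv0 hv.le hvu.le hu.2
  filter_upwards [Ioo_mem_nhdsGT hδ] with u hu
  refine le_of_forall_pos_le_add fun ε hε => ?_
  obtain ⟨σ, h1, h2⟩ := exists_between (max_lt hτ' (show r₁ + r₂ - ε < r₁ + r₂ by linarith))
  have h3 := (le_max_left _ _).trans_lt h1
  have h4 := (le_max_right _ _).trans_lt h1
  have h5 := (h𝒱 σ (by linarith)).le_add_of_lt (h𝒱 (r₁ + r₂) (by linarith)) h2 u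
    ⟨hu.1.le, hu.2.le.trans hδ1⟩
  linarith [key σ h3 h2 u hu]

theorem stmt17 (F : FluxData) (hc : ContinuousOn F.aplus (Set.Icc (0:ℝ) 1))
    (𝒱 : ℝ → ℝ → ℝ) (h𝒱 : ∀ σ : ℝ, 0 ≤ σ → IsVsol F σ (𝒱 σ))
    (σs : ℝ) (hσs : σs = sInf {σ : ℝ | 0 ≤ σ ∧ 𝒱 σ 0 = 0})
    (hne : {σ : ℝ | 0 ≤ σ ∧ 𝒱 σ 0 = 0}.Nonempty)
    (da0 df0 : ℝ) (hda0 : HasDerivAt (F.a 0) da0 0)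
    (hdf0 : HasDerivWithinAt F.f df0 (Set.Icc (0:ℝ) 1) 0)
    (γ0 : ℝ) (hγ0 : γ0 = da0 * df0)
    (σ : ℝ) (hσ : σs ≤ σ) (hσγ : 2 * Real.sqrt γ0 < σ) :
    ∃ w : ℝ, Filter.Tendsto (fun u => 𝒱 σ u / u) (nhdsWithin 0 (Set.Ioi 0)) (nhds w) ∧
      (σ = σs ↔ w = σ / 2 + Real.sqrt (σ ^ 2 / 4 - γ0)) := by
  have hda0_pos : 0 < da0 := by
    obtain ⟨d, hd, hd'⟩ := F.a_deriv_pos 0 0 (F.zero_mem_omega zero_mem_Icc_zero_one)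
    exact hda0.unique hd' ▸ hd
  have hIoo : ∀ᶠ u in 𝓝[>] (0:ℝ), u ∈ Set.Ioo (0:ℝ) 1 := Ioo_mem_nhdsGT one_pos
  have hdf0_nonneg : 0 ≤ df0 := by
    have h : HasDerivWithinAt F.f df0 (Set.Ioi 0) 0 :=
      hdf0.mono_of_mem_nhdsWithin (Icc_mem_nhdsGT one_pos)
    rw [hasDerivWithinAt_iff_tendsto_slope' (by simp)] at h
    refine ge_of_tendsto h ?_
    filter_upwards [hIoo] with u hu
    rw [slope_def_field, F.f_zero, sub_zero, sub_zero]
    exact (div_pos (F.f_pos u hu) hu.1).le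
  have hγ_nonneg : 0 ≤ γ0 := hγ0 ▸ mul_nonneg hda0_pos.le hdf0_nonneg
  have hbdd : BddBelow {σ : ℝ | 0 ≤ σ ∧ 𝒱 σ 0 = 0} := ⟨0, fun x hx => hx.1⟩
  have hσs_nonneg : 0 ≤ σs := hσs ▸ le_csInf hne fun x hx => hx.1
  have hbelow : ∀ τ, 0 ≤ τ → τ < σs → 0 < 𝒱 τ 0 := by
    intro τ h1 h2
    refine (h𝒱 τ h1).apply_zero_nonneg.lt_of_ne fun h => ?_
    exact notMem_of_lt_csInf (hσs ▸ h2) hbdd ⟨h1, h.symm⟩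
  have habove : ∀ τ, σs < τ → 𝒱 τ 0 = 0 := by
    intro τ h1
    obtain ⟨ρ, hρ, hρτ⟩ := exists_lt_of_csInf_lt hne (hσs ▸ h1)
    have h2 := (h𝒱 τ (hρ.1.trans hρτ.le))
    have := (h𝒱 ρ hρ.1).le_of_lt h2 hρτ 0 zero_mem_Icc_zero_one
    rw [hρ.2] at this
    exact this.antisymm h2.apply_zero_nonneg
  have hat : ∀ τ, σs ≤ τ → 𝒱 τ 0 = 0 := by
    intro τ h1
    rcases h1.eq_or_lt with rfl | h1
    · refine le_antisymm (le_of_forall_pos_le_add fun ε hε => ?_)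
        (h𝒱 _ hσs_nonneg).apply_zero_nonneg
      have := (h𝒱 _ hσs_nonneg).le_add_of_lt (h𝒱 (σs + ε) (by linarith)) (by linarith) 0
        zero_mem_Icc_zero_one
      rw [habove (σs + ε) (by linarith)] at this
      linarith
    · exact habove τ h1
  -- the two characteristic slopes of a speed
  have hroots : ∀ τ, 2 * Real.sqrt γ0 < τ →
      0 < Real.sqrt (τ ^ 2 / 4 - γ0) ∧ Real.sqrt (τ ^ 2 / 4 - γ0) ≤ τ / 2 ∧
      Real.sqrt (τ ^ 2 / 4 - γ0) ^ 2 = τ ^ 2 / 4 - γ0 := by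
    intro τ h
    have h1 := Real.sqrt_nonneg γ0
    have h2 := Real.sq_sqrt hγ_nonneg
    have h3 : 0 < τ ^ 2 / 4 - γ0 := by nlinarith
    exact ⟨Real.sqrt_pos.2 h3, Real.sqrt_le_iff.2 ⟨by linarith, by nlinarith⟩, Real.sq_sqrt h3.le⟩
  have hlimit : ∀ τ, σs ≤ τ → 2 * Real.sqrt γ0 < τ → ∃ w,
      Tendsto (fun u => 𝒱 τ u / u) (𝓝[>] 0) (𝓝 w) ∧
      (w = τ / 2 - Real.sqrt (τ ^ 2 / 4 - γ0) ∨ w = τ / 2 + Real.sqrt (τ ^ 2 / 4 - γ0)) := by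
    intro τ h1 h2
    obtain ⟨h3, h4, h5⟩ := hroots τ h2
    have hV := h𝒱 τ (hσs_nonneg.trans h1)
    have hsum : τ / 2 - Real.sqrt (τ ^ 2 / 4 - γ0) + (τ / 2 + Real.sqrt (τ ^ 2 / 4 - γ0)) = τ := by
      ring
    exact IsVsol.exists_tendsto_div (hsum.symm ▸ hV) (hat τ h1) hc hda0 hdf0
      (by rw [← hγ0]; linear_combination h5) (by linarith) (by linarith)
  obtain ⟨w, hw, hw'⟩ := hlimit σ hσ hσγ
  obtain ⟨hs0, hs1, hs2⟩ := hroots σ hσγ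
  refine ⟨w, hw, fun heq => ?_, fun heq => ?_⟩
  · refine hw'.resolve_left fun hcon => ?_
    have hsum : σ / 2 - Real.sqrt (σ ^ 2 / 4 - γ0) + (σ / 2 + Real.sqrt (σ ^ 2 / 4 - γ0)) = σ := by
      ring
    have h := line_le_of_forall_lt (r₁ := σ / 2 - Real.sqrt (σ ^ 2 / 4 - γ0))
      (r₂ := σ / 2 + Real.sqrt (σ ^ 2 / 4 - γ0)) (m := σ / 2) h𝒱
      (fun τ h1 h2 => hbelow τ h1 (by linarith)) hc hda0 hdf0
      (by rw [← hγ0]; linear_combination hs2) (by linarith) (by linarith) (by linarith)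
    rw [hsum] at h
    have : σ / 2 ≤ w := by
      refine ge_of_tendsto hw ?_
      filter_upwards [h, hIoo] with u hu hu0
      rwa [le_div_iff₀ hu0.1]
    linarith
  · by_contra hne'
    have hlt : σs < σ := hσ.lt_of_ne (Ne.symm hne')
    obtain ⟨τ, h1, h2⟩ := exists_between (max_lt hlt hσγ)
    have h3 := (le_max_left _ _).trans_lt h1
    have h4 := (le_max_right _ _).trans_lt h1
    obtain ⟨ht0, ht1, ht2⟩ := hroots τ h4
    obtain ⟨w', hlim, hw''⟩ := hlimit τ h3.le h4
    have hle : w ≤ w' := by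
      refine le_of_tendsto_of_tendsto hw hlim ?_
      filter_upwards [hIoo] with u hu
      exact div_le_div_of_nonneg_right ((h𝒱 τ (hσs_nonneg.trans h3.le)).le_of_lt
        (h𝒱 σ (hσs_nonneg.trans hσ)) h2 u (Set.Ioo_subset_Icc_self hu)) hu.1.le
    have hsqrt : Real.sqrt (τ ^ 2 / 4 - γ0) ≤ Real.sqrt (σ ^ 2 / 4 - γ0) :=
      Real.sqrt_le_sqrt (by nlinarith)
    rcases hw'' with h | h <;> linarith
end
end

section
/- Let δ > 0 and let γ : [0,δ]² → (0,∞) be continuous and Lipschitz in its second variable, set γ₀ := γ(0,0), γ̄ := max γ, and let σ > 2√γ₀. Let V̄ : [0,ε) → [0,δ] be the solution of V' = σ − (u/V)·γ(u,V), V(0) = 0, with lim_{u→0⁺} V̄(u)/u = (σ + √(σ² − 4γ₀))/2, and assume ε < σδ/γ̄. Fix u₀ ∈ (0,ε) and 0 < V₀ < δ, and let V be a continuous function on an interval (β,u₀] with 0 ≤ β, taking values in (0,δ], differentiable with V'(u) = σ − (u/V(u))·γ(u,V(u)) on (β,u₀), V(u₀) = V₀, and maximal to the left among such solutions. Then β =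 0 and V extends continuously to [0,u₀]; moreover, if V₀ > V̄(u₀) then V(0) > 0, while if V₀ < V̄(u₀) then V(0) = 0 and lim_{u→0⁺} V(u)/u = (σ − √(σ² − 4γ₀))/2. -/
open Set Filter Topology
open scoped ENNReal

noncomputable section

/-- A solution to the right of the singular problem `V' = σ - (u/V)·γ(u,V)`, `V(0)=0`,
on `[0,ε)`, with values in `[0,δ]`, positive on `(0,ε)`. -/
def IsSingSol (δ : ℝ) (γ : ℝ → ℝ → ℝ) (σ ε : ℝ) (V : ℝ → ℝ) : Prop :=
  ContinuousOn V (Set.Ico 0 ε) ∧ V 0 = 0 ∧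
  (∀ u ∈ Set.Ico (0:ℝ) ε, V u ∈ Set.Icc (0:ℝ) δ) ∧
  (∀ u ∈ Set.Ioo (0:ℝ) ε, 0 < V u) ∧
  (∀ u ∈ Set.Ioo (0:ℝ) ε, HasDerivAt V (σ - u / V u * γ u (V u)) u)

/-- A solution to the left of `V' = σ - (u/V)·γ(u,V)` with `V(u₀) = V₀`, defined on
`(β,u₀]`, with values in `(0,δ]`. -/
def IsLeftSol (δ : ℝ) (γ : ℝ → ℝ → ℝ) (σ u₀ V₀ β : ℝ) (W : ℝ → ℝ) : Prop :=
  0 ≤ β ∧ β < u₀ ∧ ContinuousOn W (Set.Ioc β u₀) ∧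
  (∀ u ∈ Set.Ioc β u₀, W u ∈ Set.Ioc (0:ℝ) δ) ∧ W u₀ = V₀ ∧
  (∀ u ∈ Set.Ioo β u₀, HasDerivAt W (σ - u / W u * γ u (W u)) u)

/-- If `f` lies strictly below the level `ρ` at the right endpoint and can only cross that level
upwards, then `f` stays strictly below it on the whole interval. -/
lemma lt_of_right_lt_of_deriv_pos {f f' : ℝ → ℝ} {a b ρ : ℝ}
    (hf : ContinuousOn f (Ioc a b)) (hd : ∀ x ∈ Ioo a b, HasDerivAt f (f' x) x)
    (hb : f b < ρ) (hpos : ∀ x ∈ Ioo a b, f x = ρ → 0 < f' x) :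
    ∀ x ∈ Ioc a b, f x < ρ := by
  intro x hx
  by_contra! hxρ
  have hsub : Icc x b ⊆ Ioc a b := fun t ht => ⟨hx.1.trans_le ht.1, ht.2⟩
  have hfc : ContinuousOn f (Icc x b) := hf.mono hsub
  have hcl : IsClosed (Icc x b ∩ f ⁻¹' Ici ρ) :=
    hfc.preimage_isClosed_of_isClosed isClosed_Icc isClosed_Ici
  obtain ⟨y, ⟨hy, hyρ⟩, hymax⟩ :=
    (isCompact_Icc.of_isClosed_subset hcl inter_subset_left).exists_isGreatest
      ⟨x, ⟨le_rfl, hx.2⟩, hxρ⟩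
  have hyb : y < b := by
    rcases hy.2.lt_or_eq with h | h
    · exact h
    · subst h; exact absurd hb (not_lt.2 hyρ)
  have hy' : y ∈ Ioo a b := ⟨hx.1.trans_le hy.1, hyb⟩
  have hright : ∀ᶠ t in 𝓝[>] y, f t < ρ := by
    filter_upwards [Ioo_mem_nhdsGT hyb] with t ht
    by_contra! h
    exact absurd (hymax ⟨⟨hy.1.trans ht.1.le, ht.2.le⟩, h⟩) (not_le.2 ht.1)
  have hle : f y ≤ ρ :=
    le_of_tendsto ((hd y hy').continuousAt.tendsto.mono_left nhdsWithin_le_nhds)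
      (hright.mono fun _ h => h.le)
  have hslope : Tendsto (slope f y) (𝓝[>] y) (𝓝 (f' y)) :=
    (hasDerivAt_iff_tendsto_slope.1 (hd y hy')).mono_left
      (nhdsWithin_mono _ fun t ht => ne_of_gt ht)
  obtain ⟨t, ht, hlt, hyt⟩ :=
    ((hslope.eventually_const_lt (hpos y hy' (le_antisymm hle hyρ))).and
      (hright.and self_mem_nhdsWithin)).exists
  rw [slope_def_field, div_pos_iff_of_pos_right (sub_pos.2 hyt)] at ht
  have : ρ ≤ f y := hyρ
  linarith

/-- If `r` starts below `ρ` and satisfies `u r' ≥ k > 0` as long as `a ≤ r ≤ ρ`, then a function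
`r` bounded from below is eventually smaller than `a` as `u → 0⁺`. -/
lemma eventually_lt_of_le_mul_deriv {r r' : ℝ → ℝ} {b k a ρ M : ℝ} (hb : 0 < b) (hk : 0 < k)
    (haρ : a ≤ ρ) (hd : ∀ u ∈ Ioc 0 b, HasDerivAt r (r' u) u)
    (h : ∀ u ∈ Ioc 0 b, a ≤ r u → r u ≤ ρ → k ≤ u * r' u)
    (hM : ∀ u ∈ Ioc 0 b, M ≤ r u) (hrb : r b < ρ) :
    ∀ᶠ u in 𝓝[>] 0, r u < a := by
  have hpos : ∀ u ∈ Ioc 0 b, a ≤ r u → r u ≤ ρ → 0 < r' u := fun u hu h1 h2 =>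
    pos_of_mul_pos_right (hk.trans_le (h u hu h1 h2)) hu.1.le
  have hcont : ContinuousOn r (Ioc 0 b) := fun u hu => (hd u hu).continuousAt.continuousWithinAt
  have hρ : ∀ u ∈ Ioc 0 b, r u < ρ :=
    lt_of_right_lt_of_deriv_pos hcont (fun u hu => hd u ⟨hu.1, hu.2.le⟩) hrb
      fun u hu he => hpos u ⟨hu.1, hu.2.le⟩ (haρ.trans he.ge) he.le
  obtain ⟨c, hc, hca⟩ : ∃ c ∈ Ioc 0 b, r c < a := by
    by_contra! hcon
    have hd' : ∀ u ∈ Ioc 0 b, HasDerivAt (fun u => r u - k * Real.log u) (r' u - k * u⁻¹) u :=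
      fun u hu => (hd u hu).sub ((Real.hasDerivAt_log hu.1.ne').const_mul k)
    have hmono : MonotoneOn (fun u => r u - k * Real.log u) (Ioc 0 b) := by
      refine monotoneOn_of_hasDerivWithinAt_nonneg (f' := fun u => r' u - k * u⁻¹)
        (convex_Ioc 0 b)
        (fun u hu => (hd' u hu).continuousAt.continuousWithinAt)
        (fun u hu => (hd' u (interior_subset hu)).hasDerivWithinAt) fun u hu => ?_
      have hu := interior_subset hu
      have := h u hu (hcon u hu) (hρ u hu).le
      rw [sub_nonneg, ← div_eq_mul_inv, div_le_iff₀ hu.1]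
      linarith
    have hlim : ∀ᶠ u in 𝓝[>] (0 : ℝ), k * Real.log u < M - r b + k * Real.log b :=
      (Real.tendsto_log_nhdsGT_zero.const_mul_atBot hk).eventually_lt_atBot _
    obtain ⟨u, hu, hub⟩ := (hlim.and (Ioc_mem_nhdsGT hb)).exists
    have h1 := hmono hub ⟨hb, le_rfl⟩ hub.2
    have h2 := hM u hub
    simp only at h1
    linarith
  have hsub : Ioc 0 c ⊆ Ioc 0 b := Ioc_subset_Ioc_right hc.2
  have hlt := lt_of_right_lt_of_deriv_pos (hcont.mono hsub)
    (fun u hu => hd u (hsub ⟨hu.1, hu.2.le⟩)) hca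
    fun u hu he => hpos u (hsub ⟨hu.1, hu.2.le⟩) he.ge (he.le.trans haρ)
  filter_upwards [Ioc_mem_nhdsGT hc.1] with u hu using hlt u hu

lemma abs_div_mul_sub_div_mul_le {t c v₁ v₂ g₁ g₂ G L : ℝ} (ht : 0 ≤ t) (hc : 0 < c)
    (h₁ : c ≤ v₁) (h₂ : c ≤ v₂) (hg : 0 ≤ g₁) (hG : g₁ ≤ G)
    (hL : |g₂ - g₁| ≤ L * |v₂ - v₁|) :
    |t / v₂ * g₂ - t / v₁ * g₁| ≤ t * (G / c ^ 2 + L / c) * |v₂ - v₁| := by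
  have p₁ := hc.trans_le h₁
  have p₂ := hc.trans_le h₂
  have e : t / v₂ * g₂ - t / v₁ * g₁
      = t * (-(g₁ / (v₁ * v₂) * (v₂ - v₁)) + (g₂ - g₁) / v₂) := by
    field_simp; ring
  rw [e, abs_mul, abs_of_nonneg ht, mul_assoc]
  refine mul_le_mul_of_nonneg_left ((abs_add_le _ _).trans ?_) ht
  rw [add_mul, abs_neg, abs_mul, abs_div, abs_of_nonneg hg, abs_of_pos (mul_pos p₁ p₂), abs_div,
    abs_of_pos p₂, div_mul_eq_mul_div L]
  have hcv : c ^ 2 ≤ v₁ * v₂ := by nlinarith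
  have := (abs_nonneg _).trans hL
  have := hg.trans hG
  gcongr

/-- Left solutions exist on `(τ, u₀]` for every `τ > 0`. -/
lemma exists_isLeftSol {δ : ℝ} {γ : ℝ → ℝ → ℝ} {L m G σ u₀ V₀ τ : ℝ}
    (hγc : ContinuousOn (fun p : ℝ × ℝ => γ p.1 p.2) (Icc 0 δ ×ˢ Icc 0 δ))
    (hm : 0 < m) (hγm : ∀ u ∈ Icc 0 δ, ∀ v ∈ Icc 0 δ, m ≤ γ u v)
    (hγG : ∀ u ∈ Icc 0 δ, ∀ v ∈ Icc 0 δ, γ u v ≤ G) (hL : 0 < L)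
    (hlip : ∀ u ∈ Icc 0 δ, ∀ V₁ ∈ Icc 0 δ, ∀ V₂ ∈ Icc 0 δ, |γ u V₂ - γ u V₁| ≤ L * |V₂ - V₁|)
    (hσ : 0 < σ) (hu₀δ : u₀ ≤ δ) (hG : u₀ * G < σ * δ) (hV₀ : 0 < V₀) (hV₀δ : V₀ < δ)
    (hτ : 0 < τ) (hτu : τ < u₀) : ∃ W, IsLeftSol δ γ σ u₀ V₀ τ W := by
  have hδ : 0 < δ := hV₀.trans hV₀δ
  have hG0 : 0 < G := hm.trans_le ((hγm 0 ⟨le_rfl, hδ.le⟩ 0 ⟨le_rfl, hδ.le⟩).trans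
    (hγG 0 ⟨le_rfl, hδ.le⟩ 0 ⟨le_rfl, hδ.le⟩))
  obtain ⟨c, hc, hcV, hcm⟩ : ∃ c, 0 < c ∧ c < V₀ ∧ c * σ < τ * m := by
    have h : 0 < min V₀ (τ * m / σ) := lt_min hV₀ (by positivity)
    refine ⟨min V₀ (τ * m / σ) / 2, by positivity,
      (half_lt_self h).trans_le (min_le_left _ _), ?_⟩
    rw [← lt_div_iff₀ hσ]
    exact (half_lt_self h).trans_le (min_le_right _ _)
  have hcδ : c ≤ δ := (hcV.trans hV₀δ).le
  let cl : ℝ → ℝ := fun x => max (min x δ) c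
  have hcl : ∀ x, c ≤ cl x ∧ cl x ≤ δ := fun x =>
    ⟨le_max_right _ _, max_le (min_le_right _ _) hcδ⟩
  have hclm : ∀ x, cl x ∈ Icc 0 δ := fun x => ⟨hc.le.trans (hcl x).1, (hcl x).2⟩
  have hclid : ∀ x, c ≤ x → x ≤ δ → cl x = x := fun x h1 h2 => by
    simp only [cl]; rw [min_eq_left h2, max_eq_left h1]
  have hcllip : ∀ x y, |cl x - cl y| ≤ |x - y| := fun x y => by
    refine (abs_max_sub_max_le_abs _ _ _).trans ((abs_min_sub_min_le_max _ _ _ _).trans ?_)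
    simp
  have htm : ∀ t ∈ Icc τ u₀, t ∈ Icc 0 δ := fun t ht => ⟨hτ.le.trans ht.1, ht.2.trans hu₀δ⟩
  let F : ℝ → ℝ → ℝ := fun t x => σ - t / cl x * γ t (cl x)
  let K : ℝ := δ * (G / c ^ 2 + L / c)
  let B : ℝ := σ + δ / c * G
  have hK : 0 ≤ K := by positivity
  have hB : 0 ≤ B := by positivity
  have hA : 0 ≤ B * (u₀ - τ) := mul_nonneg hB (sub_nonneg.2 hτu.le)
  have hPL : IsPicardLindelof F (tmin := τ) (tmax := u₀) ⟨u₀, hτu.le, le_rfl⟩ V₀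
      ⟨B * (u₀ - τ), hA⟩ 0 ⟨B, hB⟩ ⟨K, hK⟩ := by
    refine ⟨fun t ht => ?_, fun x _ => ?_, fun t ht x _ => ?_, ?_⟩
    · refine (LipschitzWith.of_dist_le_mul fun x y => ?_).lipschitzOnWith
      rw [Real.dist_eq, Real.dist_eq]
      have e : F t x - F t y = -(t / cl x * γ t (cl x) - t / cl y * γ t (cl y)) := by
        simp only [F]; ring
      have ht' := htm t ht
      rw [e, abs_neg]
      refine (abs_div_mul_sub_div_mul_le ht'.1 hc (hcl y).1 (hcl x).1
        (hm.le.trans (hγm t ht' _ (hclm y))) (hγG t ht' _ (hclm y))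
        (hlip t ht' _ (hclm y) _ (hclm x))).trans ?_
      change _ ≤ δ * (G / c ^ 2 + L / c) * |x - y|
      have := ht'.2
      have := hcllip x y
      gcongr
    · have : ContinuousOn (fun t => γ t (cl x)) (Icc τ u₀) :=
        hγc.comp (f := fun t : ℝ => (t, cl x)) (by fun_prop) fun t ht => ⟨htm t ht, hclm x⟩
      simp only [F]
      fun_prop
    · have ht' := htm t ht
      have h1 := hγm t ht' _ (hclm x)
      have h2 := hγG t ht' _ (hclm x)
      have h3 := (hcl x).1
      have h4 : 0 < cl x := hc.trans_le h3
      have h0 : 0 ≤ t / cl x * γ t (cl x) :=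
        mul_nonneg (div_nonneg ht'.1 h4.le) (hm.le.trans h1)
      have h5 : t / cl x * γ t (cl x) ≤ δ / c * G := by
        have := ht'.2
        have := hm.le.trans h1
        gcongr
      change |σ - t / cl x * γ t (cl x)| ≤ σ + δ / c * G
      rw [abs_le]
      constructor <;> linarith
    · change B * max (u₀ - u₀) (u₀ - τ) ≤ B * (u₀ - τ) - 0
      rw [sub_self, max_eq_right (sub_nonneg.2 hτu.le), sub_zero]
  obtain ⟨W, hW0, hW⟩ := hPL.exists_eq_forall_mem_Icc_hasDerivWithinAt₀
  simp only at hW0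
  have hWc : ContinuousOn W (Ioc τ u₀) := fun t ht =>
    (hW t (Ioc_subset_Icc_self ht)).continuousWithinAt.mono Ioc_subset_Icc_self
  have hWd : ∀ t ∈ Ioo τ u₀, HasDerivAt W (F t (W t)) t := fun t ht =>
    (hW t (Ioo_subset_Icc_self ht)).hasDerivAt (Icc_mem_nhds ht.1 ht.2)
  have hup : ∀ t ∈ Ioc τ u₀, W t < δ := by
    refine lt_of_right_lt_of_deriv_pos hWc hWd (by rwa [hW0]) fun t ht he => ?_
    have ht' := htm t (Ioo_subset_Icc_self ht)
    simp only [F]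
    rw [he, hclid δ hcδ le_rfl, sub_pos, div_mul_eq_mul_div, div_lt_iff₀ hδ]
    refine lt_of_le_of_lt ?_ hG
    exact mul_le_mul ht.2.le (hγG t ht' δ ⟨hδ.le, le_rfl⟩)
      (hm.le.trans (hγm t ht' δ ⟨hδ.le, le_rfl⟩)) (ht'.1.trans ht.2.le)
  have hlow : ∀ t ∈ Ioc τ u₀, -W t < -c := by
    refine lt_of_right_lt_of_deriv_pos (f := fun t => -W t) hWc.neg
      (fun t ht => (hWd t ht).neg) (by rw [hW0]; linarith) fun t ht he => ?_
    have ht' := htm t (Ioo_subset_Icc_self ht)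
    have he' : W t = c := neg_injective he
    simp only [F]
    rw [he', hclid c le_rfl hcδ, neg_sub, sub_pos, div_mul_eq_mul_div, lt_div_iff₀ hc]
    rw [mul_comm]
    exact hcm.trans_le (mul_le_mul ht.1.le (hγm t ht' c ⟨hc.le, hcδ⟩) hm.le ht'.1)
  have hWcl : ∀ t ∈ Ioc τ u₀, cl (W t) = W t := fun t ht =>
    hclid _ (neg_lt_neg_iff.1 (hlow t ht)).le (hup t ht).le
  refine ⟨W, hτ.le, hτu, hWc, fun t ht =>
    ⟨hc.trans (neg_lt_neg_iff.1 (hlow t ht)), (hup t ht).le⟩, hW0, fun t ht => ?_⟩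
  have := hWd t ht
  simp only [F] at this
  rwa [hWcl t ⟨ht.1, ht.2.le⟩] at this

/-- Positive solutions of the singular equation do not cross. -/
lemma lt_of_right_lt_of_hasDerivAt {δ : ℝ} {γ : ℝ → ℝ → ℝ} {L G σ b : ℝ} {W₁ W₂ : ℝ → ℝ}
    (hγ0 : ∀ u ∈ Icc 0 δ, ∀ v ∈ Icc 0 δ, 0 ≤ γ u v)
    (hγG : ∀ u ∈ Icc 0 δ, ∀ v ∈ Icc 0 δ, γ u v ≤ G) (hL : 0 < L)
    (hlip : ∀ u ∈ Icc 0 δ, ∀ V₁ ∈ Icc 0 δ, ∀ V₂ ∈ Icc 0 δ, |γ u V₂ - γ u V₁| ≤ L * |V₂ - V₁|)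
    (hbδ : b ≤ δ) (hc₁ : ContinuousOn W₁ (Ioc 0 b)) (hc₂ : ContinuousOn W₂ (Ioc 0 b))
    (hW₁ : ∀ u ∈ Ioc 0 b, W₁ u ∈ Ioc 0 δ) (hW₂ : ∀ u ∈ Ioc 0 b, W₂ u ∈ Ioc 0 δ)
    (hd₁ : ∀ u ∈ Ioo 0 b, HasDerivAt W₁ (σ - u / W₁ u * γ u (W₁ u)) u)
    (hd₂ : ∀ u ∈ Ioo 0 b, HasDerivAt W₂ (σ - u / W₂ u * γ u (W₂ u)) u)
    (hlt : W₁ b < W₂ b) : ∀ u ∈ Ioc 0 b, W₁ u < W₂ u := by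
  intro s hs
  by_contra! hcon
  have hsub : ∀ z, s ≤ z → Icc z b ⊆ Ioc 0 b := fun z hz t ht =>
    ⟨hs.1.trans_le (hz.trans ht.1), ht.2⟩
  have hDc : ContinuousOn (fun u => W₂ u - W₁ u) (Ioc 0 b) := hc₂.sub hc₁
  obtain ⟨z, hz, hDz⟩ : ∃ z ∈ Icc s b, W₂ z - W₁ z = 0 :=
    intermediate_value_Icc hs.2 (hDc.mono (hsub s le_rfl))
      ⟨sub_nonpos.2 hcon, (sub_pos.2 hlt).le⟩
  have hzsub := hsub z hz.1
  have hne : (Icc z b).Nonempty := ⟨z, le_rfl, hz.2⟩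
  obtain ⟨x₁, hx₁, hmin₁⟩ := isCompact_Icc.exists_isMinOn hne (hc₁.mono hzsub)
  obtain ⟨x₂, hx₂, hmin₂⟩ := isCompact_Icc.exists_isMinOn hne (hc₂.mono hzsub)
  set c := min (W₁ x₁) (W₂ x₂)
  have hc : 0 < c := lt_min (hW₁ x₁ (hzsub hx₁)).1 (hW₂ x₂ (hzsub hx₂)).1
  have hzero := eq_zero_of_abs_deriv_le_mul_abs_self_of_eq_zero_right
    (f := fun u => W₂ u - W₁ u) (K := δ * (G / c ^ 2 + L / c)) (hDc.mono hzsub)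
    (fun u hu => ((hd₂ u ⟨(hzsub ⟨hu.1, hu.2.le⟩).1, hu.2⟩).sub
      (hd₁ u ⟨(hzsub ⟨hu.1, hu.2.le⟩).1, hu.2⟩)).hasDerivWithinAt) hDz (fun u hu => by
      have hu' := hzsub ⟨hu.1, hu.2.le⟩
      have huδ : u ∈ Icc 0 δ := ⟨hu'.1.le, hu'.2.trans hbδ⟩
      have m₁ := Ioc_subset_Icc_self (hW₁ u hu')
      have m₂ := Ioc_subset_Icc_self (hW₂ u hu')
      have e : σ - u / W₂ u * γ u (W₂ u) - (σ - u / W₁ u * γ u (W₁ u))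
          = -(u / W₂ u * γ u (W₂ u) - u / W₁ u * γ u (W₁ u)) := by ring
      rw [Real.norm_eq_abs, Real.norm_eq_abs, e, abs_neg]
      refine (abs_div_mul_sub_div_mul_le huδ.1 hc
        ((min_le_left _ _).trans (hmin₁ ⟨hu.1, hu.2.le⟩))
        ((min_le_right _ _).trans (hmin₂ ⟨hu.1, hu.2.le⟩)) (hγ0 u huδ _ m₁) (hγG u huδ _ m₁)
        (hlip u huδ _ m₁ _ m₂)).trans ?_
      have := huδ.2
      have : 0 ≤ G := (hγ0 u huδ _ m₁).trans (hγG u huδ _ m₁)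
      gcongr) b ⟨hz.2, le_rfl⟩
  linarith

/-- Two distinct ordered solutions cannot both have slopes above `√γ(0,0)` near `0`. -/
lemma false_of_lt_of_mul_le {δ : ℝ} {γ : ℝ → ℝ → ℝ} {L σ b ρ C : ℝ} {W₁ W₂ : ℝ → ℝ}
    (hγ0 : ∀ u ∈ Icc 0 δ, ∀ v ∈ Icc 0 δ, 0 ≤ γ u v)
    (hlip : ∀ u ∈ Icc 0 δ, ∀ V₁ ∈ Icc 0 δ, ∀ V₂ ∈ Icc 0 δ, |γ u V₂ - γ u V₁| ≤ L * |V₂ - V₁|)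
    (hb : 0 < b) (hbδ : b ≤ δ)
    (hd₁ : ∀ u ∈ Ioc 0 b, HasDerivAt W₁ (σ - u / W₁ u * γ u (W₁ u)) u)
    (hd₂ : ∀ u ∈ Ioc 0 b, HasDerivAt W₂ (σ - u / W₂ u * γ u (W₂ u)) u)
    (hlt : ∀ u ∈ Ioc 0 b, W₁ u < W₂ u) (hρ : 0 < ρ) (hρW : ∀ u ∈ Ioc 0 b, ρ * u ≤ W₁ u)
    (hWC : ∀ u ∈ Ioc 0 b, W₂ u ≤ C * u) (hWδ : ∀ u ∈ Ioc 0 b, W₂ u ≤ δ)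
    (hγρ : γ 0 0 < ρ ^ 2)
    (hγ : Tendsto (fun u => γ u (W₁ u)) (𝓝[>] 0) (𝓝 (γ 0 0))) : False := by
  obtain ⟨g, hg0, hgρ⟩ := exists_between hγρ
  have hk : 0 < 1 - g / ρ ^ 2 := by rw [sub_pos, div_lt_one (by positivity)]; exact hgρ
  set k := (1 - g / ρ ^ 2) / 2 with hkdef
  have hk' : 0 < k := by positivity
  have hsmall : ∀ᶠ u in 𝓝[>] (0 : ℝ), u * (L / ρ) < k := by
    have : Tendsto (fun u : ℝ => u * (L / ρ)) (𝓝[>] 0) (𝓝 (0 * (L / ρ))) :=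
      (tendsto_nhdsWithin_of_tendsto_nhds tendsto_id).mul_const _
    rw [zero_mul] at this
    exact this.eventually_lt_const hk'
  obtain ⟨η, hη, hηs⟩ := mem_nhdsGT_iff_exists_Ioc_subset.1
    ((hγ.eventually_lt_const hg0).and (hsmall.and (Ioc_mem_nhdsGT hb)))
  have hsub : ∀ u ∈ Ioc 0 η, u ∈ Ioc 0 b := fun u hu => (hηs hu).2.2
  have hDpos : ∀ u ∈ Ioc 0 η, 0 < (W₂ u - W₁ u) / u := fun u hu =>
    div_pos (sub_pos.2 (hlt u (hsub u hu))) hu.1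
  have hDC : ∀ u ∈ Ioc 0 η, (W₂ u - W₁ u) / u ≤ C := fun u hu => by
    rw [div_le_iff₀ hu.1]
    have := hρW u (hsub u hu)
    have := hWC u (hsub u hu)
    have := mul_pos hρ hu.1
    linarith
  have hη0 : 0 < η := hη
  set q₀ := (W₂ η - W₁ η) / η with hq₀
  have hq₀pos : 0 < q₀ := hDpos η ⟨hη0, le_rfl⟩
  have hC : 0 < C := hq₀pos.trans_le (hDC η ⟨hη0, le_rfl⟩)
  have hev := eventually_lt_of_le_mul_deriv (r := fun u => -((W₂ u - W₁ u) / u)) (a := -C - 1)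
    (M := -C) (ρ := -(q₀ / 2)) (k := k * (q₀ / 2)) hη0 (by positivity)
    (by have := hDC η ⟨hη0, le_rfl⟩; linarith)
    (fun u hu => (((hd₂ u (hsub u hu)).sub (hd₁ u (hsub u hu))).div (hasDerivAt_id u)
      hu.1.ne').neg)
    (fun u hu _ h2 => by
      have hub := hsub u hu
      have hu0 := hu.1
      have huδ : u ∈ Icc 0 δ := ⟨hu.1.le, hub.2.trans hbδ⟩
      have p₁ : 0 < W₁ u := (mul_pos hρ hu.1).trans_le (hρW u hub)
      have hl := hlt u hub
      have m₁ : W₁ u ∈ Icc 0 δ := ⟨p₁.le, hl.le.trans (hWδ u hub)⟩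
      have m₂ : W₂ u ∈ Icc 0 δ := ⟨p₁.le.trans hl.le, hWδ u hub⟩
      have key := abs_div_mul_sub_div_mul_le huδ.1 (mul_pos hρ hu.1) (hρW u hub)
        ((hρW u hub).trans hl.le) (hγ0 u huδ _ m₁) (hηs hu).1.le (hlip u huδ _ m₁ _ m₂)
      rw [abs_of_pos (sub_pos.2 hl)] at key
      have hs := (hηs hu).2.1
      set q := (W₂ u - W₁ u) / u with hq
      have hDq : W₂ u - W₁ u = q * u := by rw [hq]; field_simp
      have e1 : u * (g / (ρ * u) ^ 2 + L / (ρ * u)) * (W₂ u - W₁ u)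
          = (g / ρ ^ 2 + u * (L / ρ)) * q := by
        rw [hDq]; field_simp
      have hq0 : 0 < q := hDpos u hu
      have key2 := (abs_le.1 (key.trans_eq e1)).1
      have e2 : u * -(((σ - u / W₂ u * γ u (W₂ u) - (σ - u / W₁ u * γ u (W₁ u))) * id u
          - (W₂ u - W₁ u) * 1) / id u ^ 2)
          = q + (u / W₂ u * γ u (W₂ u) - u / W₁ u * γ u (W₁ u)) := by
        simp only [id]
        rw [hDq]
        field_simp
        ring
      change _ ≤ u * -(((σ - u / W₂ u * γ u (W₂ u) - (σ - u / W₁ u * γ u (W₁ u))) * id u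
          - (W₂ u - W₁ u) * 1) / id u ^ 2)
      rw [e2]
      have h3 : q₀ / 2 ≤ q := by linarith
      have h4 : k * (q₀ / 2) ≤ k * q := by gcongr
      have h5 : u * (L / ρ) * q ≤ k * q := by gcongr
      have h6 : g / ρ ^ 2 = 1 - 2 * k := by rw [hkdef]; ring
      rw [h6] at key2
      linarith)
    (fun u hu => neg_le_neg (hDC u hu)) (by rw [← hq₀]; linarith)
  obtain ⟨u, hu, huη⟩ := (hev.and (Ioc_mem_nhdsGT hη0)).exists
  have := hDC u huη
  linarith

lemma hasDerivAt_div_self {σ g u : ℝ} {V : ℝ → ℝ} (hu : 0 < u) (hVu : 0 < V u)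
    (hd : HasDerivAt V (σ - u / V u * g) u) :
    HasDerivAt (fun t => V t / t) ((σ - g / (V u / u) - V u / u) / u) u := by
  have e : (σ - g / (V u / u) - V u / u) / u
      = ((σ - u / V u * g) * id u - V u * 1) / id u ^ 2 := by
    simp only [id]
    field_simp
  rw [e]
  exact hd.div (hasDerivAt_id u) hu.ne'

/-- A solution whose slope is not eventually above `ρ ∈ (λ₋, λ₊)` has slope `λ₋` at `0`, where
`λ₋ < λ₊` are the roots of `x² - σ x + g₀` and `g₀` is the limit of the coefficient. -/
lemma tendsto_div_of_frequently_lt {σ b ρ C l₁ l₂ : ℝ} {V g : ℝ → ℝ} (hb : 0 < b)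
    (hd : ∀ u ∈ Ioc 0 b, HasDerivAt V (σ - u / V u * g u) u)
    (hpos : ∀ u ∈ Ioc 0 b, 0 < V u) (hC : ∀ u ∈ Ioc 0 b, V u / u ≤ C)
    (hl₁ : 0 < l₁) (h₁ρ : l₁ < ρ) (hρ₂ : ρ < l₂) (hsum : l₁ + l₂ = σ)
    (hg : Tendsto g (𝓝[>] 0) (𝓝 (l₁ * l₂)))
    (hfreq : ∃ᶠ u in 𝓝[>] 0, V u / u < ρ) :
    Tendsto (fun u => V u / u) (𝓝[>] 0) (𝓝 l₁) := by
  have hnear : ∀ m > 0, ∃ η > 0, η ≤ b ∧ V η / η < ρ ∧ ∀ u ∈ Ioc 0 η, |g u - l₁ * l₂| < m := by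
    intro m hm
    obtain ⟨η, hη, hηs⟩ := mem_nhdsGT_iff_exists_Ioc_subset.1
      ((hg.eventually (Metric.ball_mem_nhds _ hm)).and (Ioc_mem_nhdsGT hb))
    obtain ⟨ζ, hζ, hζη⟩ := (hfreq.and_eventually (Ioc_mem_nhdsGT hη)).exists
    exact ⟨ζ, hζη.1, (hηs hζη).2.2, hζ, fun u hu => (hηs ⟨hu.1, hu.2.trans hζη.2⟩).1⟩
  have hr : ∀ u ∈ Ioc 0 b, 0 < V u / u := fun u hu => div_pos (hpos u hu) hu.1
  rw [tendsto_order]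
  constructor
  · intro a ha
    set a' := max a (l₁ / 2)
    have ha' : a' < l₁ := max_lt ha (half_lt_self hl₁)
    have ha0 : 0 < a' := (half_pos hl₁).trans_le (le_max_right _ _)
    set m := (l₁ - a') * (l₂ - l₁)
    have hm : 0 < m := mul_pos (sub_pos.2 ha') (by linarith)
    obtain ⟨η, hη, hηb, -, hηg⟩ := hnear (m / 2) (half_pos hm)
    have hsub : ∀ u ∈ Ioc 0 η, u ∈ Ioc 0 b := fun u hu => ⟨hu.1, hu.2.trans hηb⟩
    have hev := eventually_lt_of_le_mul_deriv (r := fun u => -(V u / u)) (a := -a') (ρ := 0)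
      (k := m / 2 / l₁) (M := -C) hη (by positivity) (by linarith)
      (fun u hu => (hasDerivAt_div_self hu.1 (hpos u (hsub u hu)) (hd u (hsub u hu))).neg)
      (fun u hu h1 _ => by
        have hru := hr u (hsub u hu)
        have hgu := (abs_lt.1 (hηg u hu)).1
        have h1' : V u / u ≤ a' := neg_le_neg_iff.1 h1
        set r := V u / u
        have e : u * -((σ - g u / r - r) / u) = (g u - σ * r + r ^ 2) / r := by
          have := hu.1.ne'
          field_simp
          ring
        rw [e, div_le_div_iff₀ hl₁ hru]
        have h3 : m ≤ (l₁ - r) * (l₂ - r) :=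
          mul_le_mul (by linarith) (by linarith) (by linarith) (by linarith)
        have h4 : m / 2 ≤ g u - σ * r + r ^ 2 := by rw [← hsum]; linarith
        exact mul_le_mul h4 (by linarith) hru.le ((half_pos hm).le.trans h4))
      (fun u hu => neg_le_neg (hC u (hsub u hu)))
      (neg_lt_zero.2 (hr η (hsub η ⟨hη, le_rfl⟩)))
    filter_upwards [hev] with u hu
    exact (le_max_left _ _).trans_lt (neg_lt_neg_iff.1 hu)
  · intro a ha
    set a' := min a ρ
    have ha' : l₁ < a' := lt_min ha h₁ρ
    have haρ : a' ≤ ρ := min_le_right _ _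
    set m := (a' - l₁) * (l₂ - ρ)
    have hm : 0 < m := mul_pos (sub_pos.2 ha') (sub_pos.2 hρ₂)
    obtain ⟨η, hη, hηb, hηρ, hηg⟩ := hnear (m / 2) (half_pos hm)
    have hsub : ∀ u ∈ Ioc 0 η, u ∈ Ioc 0 b := fun u hu => ⟨hu.1, hu.2.trans hηb⟩
    have hρ0 : 0 < ρ := hl₁.trans h₁ρ
    have hev := eventually_lt_of_le_mul_deriv (r := fun u => V u / u) (a := a') (ρ := ρ)
      (k := m / 2 / ρ) (M := 0) hη (by positivity) haρ
      (fun u hu => hasDerivAt_div_self hu.1 (hpos u (hsub u hu)) (hd u (hsub u hu)))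
      (fun u hu h1 h2 => by
        have hru := hr u (hsub u hu)
        have hgu := (abs_lt.1 (hηg u hu)).2
        set r := V u / u
        have e : u * ((σ - g u / r - r) / u) = (σ * r - r ^ 2 - g u) / r := by
          have := hu.1.ne'
          field_simp
          ring
        rw [e, div_le_div_iff₀ hρ0 hru]
        have h3 : m ≤ (r - l₁) * (l₂ - r) :=
          mul_le_mul (by linarith) (by linarith) (by linarith) (by linarith)
        have h4 : m / 2 ≤ σ * r - r ^ 2 - g u := by rw [← hsum]; linarith
        exact mul_le_mul h4 h2 hru.le ((half_pos hm).le.trans h4))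
      (fun u hu => (hr u (hsub u hu)).le) hηρ
    filter_upwards [hev] with u hu
    exact lt_of_lt_of_le hu (min_le_left _ _)

/-- A solution with bounded range has a limit at `0`, because `V - σ u` is nonincreasing. -/
lemma exists_tendsto_of_hasDerivAt_sub {σ b M : ℝ} {V h : ℝ → ℝ} (hb : 0 < b)
    (hd : ∀ u ∈ Ioo 0 b, HasDerivAt V (σ - h u) u) (hh : ∀ u ∈ Ioo 0 b, 0 ≤ h u)
    (hM : ∀ u ∈ Ioo 0 b, V u - σ * u ≤ M) :
    ∃ l, Tendsto V (𝓝[>] 0) (𝓝 l) ∧ ∀ u ∈ Ioo 0 b, V u ≤ l + σ * u := by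
  have hd' : ∀ u ∈ Ioo 0 b, HasDerivAt (fun u => V u - σ * u) (σ - h u - σ * 1) u :=
    fun u hu => (hd u hu).sub ((hasDerivAt_id u).const_mul σ)
  have hanti : AntitoneOn (fun u => V u - σ * u) (Ioo 0 b) := by
    refine antitoneOn_of_hasDerivWithinAt_nonpos (f' := fun u => σ - h u - σ * 1)
      (convex_Ioo 0 b) (fun u hu => (hd' u hu).continuousAt.continuousWithinAt)
      (fun u hu => (hd' u (interior_subset hu)).hasDerivWithinAt) fun u hu => ?_
    have := hh u (interior_subset hu)
    linarith
  have hbdd : BddAbove ((fun u => V u - σ * u) '' Ioo 0 b) :=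
    ⟨M, by rintro _ ⟨u, hu, rfl⟩; exact hM u hu⟩
  have hlim := hanti.tendsto_nhdsWithin_Ioo_right (nonempty_Ioo.2 hb) hbdd
  have hσ : Tendsto (fun u : ℝ => σ * u) (𝓝[>] 0) (𝓝 (σ * 0)) :=
    (tendsto_nhdsWithin_of_tendsto_nhds tendsto_id).const_mul σ
  refine ⟨_, by simpa using hlim.add hσ, fun u hu => ?_⟩
  have := le_csSup hbdd (mem_image_of_mem _ hu)
  linarith

lemma tendsto_apply_nhdsGT_zero {δ : ℝ} {γ : ℝ → ℝ → ℝ} {b : ℝ} {W : ℝ → ℝ} (hδ : 0 < δ)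
    (hγc : ContinuousOn (fun p : ℝ × ℝ => γ p.1 p.2) (Icc 0 δ ×ˢ Icc 0 δ)) (hb : 0 < b)
    (hW : ∀ u ∈ Ioc 0 b, W u ∈ Ioc 0 δ) (hlim : Tendsto W (𝓝[>] 0) (𝓝 0)) :
    Tendsto (fun u => γ u (W u)) (𝓝[>] 0) (𝓝 (γ 0 0)) := by
  have h0 : ((0 : ℝ), (0 : ℝ)) ∈ Icc 0 δ ×ˢ Icc 0 δ := ⟨⟨le_rfl, hδ.le⟩, ⟨le_rfl, hδ.le⟩⟩
  have hp : Tendsto (fun u => (u, W u)) (𝓝[>] 0) (𝓝[Icc 0 δ ×ˢ Icc 0 δ] (0, 0)) := by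
    refine tendsto_nhdsWithin_iff.2
      ⟨(tendsto_nhdsWithin_of_tendsto_nhds tendsto_id).prodMk_nhds hlim, ?_⟩
    filter_upwards [Ioc_mem_nhdsGT hb, Ioc_mem_nhdsGT hδ] with u hu hu'
    exact ⟨Ioc_subset_Icc_self hu', Ioc_subset_Icc_self (hW u hu)⟩
  exact (hγc _ h0).tendsto.comp hp

theorem stmt19 (δ : ℝ) (hδ : 0 < δ) (γ : ℝ → ℝ → ℝ)
    (hγc : ContinuousOn (fun p : ℝ × ℝ => γ p.1 p.2) (Set.Icc 0 δ ×ˢ Set.Icc 0 δ))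
    (hγpos : ∀ u ∈ Set.Icc (0:ℝ) δ, ∀ v ∈ Set.Icc (0:ℝ) δ, 0 < γ u v)
    (L : ℝ) (hL : 0 < L)
    (hlip : ∀ u ∈ Set.Icc (0:ℝ) δ, ∀ V₁ ∈ Set.Icc (0:ℝ) δ, ∀ V₂ ∈ Set.Icc (0:ℝ) δ,
      |γ u V₂ - γ u V₁| ≤ L * |V₂ - V₁|)
    (γbar : ℝ)
    (hγbar : IsGreatest (Set.image (fun p : ℝ × ℝ => γ p.1 p.2) (Set.Icc 0 δ ×ˢ Set.Icc 0 δ)) γbar)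
    (σ : ℝ) (hσ : 2 * Real.sqrt (γ 0 0) < σ)
    (ε : ℝ) (hε0 : 0 < ε) (hεδ : ε ≤ δ) (hεbound : ε < σ * δ / γbar)
    (Vbar : ℝ → ℝ) (hVbar : IsSingSol δ γ σ ε Vbar)
    (hVbarslope : Filter.Tendsto (fun u => Vbar u / u) (nhdsWithin 0 (Set.Ioi 0))
      (nhds ((σ + Real.sqrt (σ ^ 2 - 4 * γ 0 0)) / 2)))
    (u₀ V₀ : ℝ) (hu₀ : u₀ ∈ Set.Ioo 0 ε) (hV₀ : 0 < V₀) (hV₀δ : V₀ < δ)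
    (β : ℝ) (V : ℝ → ℝ) (hV : IsLeftSol δ γ σ u₀ V₀ β V)
    (hmax : ∀ β2 : ℝ, ∀ W : ℝ → ℝ, IsLeftSol δ γ σ u₀ V₀ β2 W → β ≤ β2) :
    β = 0 ∧ ∃ Lv : ℝ,
      Filter.Tendsto V (nhdsWithin 0 (Set.Ioi 0)) (nhds Lv) ∧
      (Vbar u₀ < V₀ → 0 < Lv) ∧
      (V₀ < Vbar u₀ → Lv = 0 ∧
        Filter.Tendsto (fun u => V u / u) (nhdsWithin 0 (Set.Ioi 0))
          (nhds ((σ - Real.sqrt (σ ^ 2 - 4 * γ 0 0)) / 2))) := by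
  have h00 : (0 : ℝ) ∈ Icc 0 δ := ⟨le_rfl, hδ.le⟩
  have hγ00 : 0 < γ 0 0 := hγpos 0 h00 0 h00
  have hγG : ∀ u ∈ Icc (0 : ℝ) δ, ∀ v ∈ Icc (0 : ℝ) δ, γ u v ≤ γbar := fun u hu v hv =>
    hγbar.2 ⟨(u, v), ⟨hu, hv⟩, rfl⟩
  have hγ0 : ∀ u ∈ Icc (0 : ℝ) δ, ∀ v ∈ Icc (0 : ℝ) δ, 0 ≤ γ u v := fun u hu v hv =>
    (hγpos u hu v hv).le
  have hGpos : 0 < γbar := hγ00.trans_le (hγG 0 h00 0 h00)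
  obtain ⟨m, hm, hγm⟩ : ∃ m, 0 < m ∧ ∀ u ∈ Icc (0 : ℝ) δ, ∀ v ∈ Icc (0 : ℝ) δ, m ≤ γ u v := by
    obtain ⟨p, hp, hmin⟩ := (isCompact_Icc.prod isCompact_Icc).exists_isMinOn
      ⟨((0 : ℝ), (0 : ℝ)), h00, h00⟩ hγc
    exact ⟨γ p.1 p.2, hγpos _ hp.1 _ hp.2, fun u hu v hv =>
      hmin (show (u, v) ∈ Icc 0 δ ×ˢ Icc 0 δ from ⟨hu, hv⟩)⟩
  have hσpos : 0 < σ := (by positivity : 0 ≤ 2 * √(γ 0 0)).trans_lt hσ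
  have hdisc : 0 < σ ^ 2 - 4 * γ 0 0 := by
    nlinarith [Real.sq_sqrt hγ00.le, Real.sqrt_nonneg (γ 0 0)]
  set s := √(σ ^ 2 - 4 * γ 0 0) with hs
  have hspos : 0 < s := Real.sqrt_pos.2 hdisc
  have hssq : s ^ 2 = σ ^ 2 - 4 * γ 0 0 := Real.sq_sqrt hdisc.le
  have hsσ : s < σ := by nlinarith
  obtain ⟨hu₀0, hu₀ε⟩ := hu₀
  have hu₀δ : u₀ ≤ δ := hu₀ε.le.trans hεδ
  obtain ⟨hβ0, -, hVc, hVm, hVu₀, hVd⟩ := hV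
  obtain rfl : β = 0 := by
    refine le_antisymm (le_of_forall_gt fun τ hτ => ?_) hβ0
    have hτ' : 0 < min (τ / 2) (u₀ / 2) := by positivity
    obtain ⟨W, hW⟩ := exists_isLeftSol hγc hm hγm hγG hL hlip hσpos hu₀δ
      (((mul_lt_mul_iff_left₀ hGpos).2 hu₀ε).trans ((lt_div_iff₀ hGpos).1 hεbound)) hV₀ hV₀δ hτ'
      ((min_le_right _ _).trans_lt (half_lt_self hu₀0))
    exact (hmax _ W hW).trans_lt ((min_le_left _ _).trans_lt (half_lt_self hτ))
  refine ⟨rfl, ?_⟩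
  obtain ⟨hBc, hB0, hBm, hBpos, hBd⟩ := hVbar
  have hBm' : ∀ u ∈ Ioc 0 u₀, Vbar u ∈ Ioc 0 δ := fun u hu =>
    ⟨hBpos u ⟨hu.1, hu.2.trans_lt hu₀ε⟩, (hBm u ⟨hu.1.le, hu.2.trans_lt hu₀ε⟩).2⟩
  have hBc' : ContinuousOn Vbar (Ioc 0 u₀) :=
    hBc.mono fun u hu => ⟨hu.1.le, hu.2.trans_lt hu₀ε⟩
  have hBd' : ∀ u ∈ Ioo 0 u₀, HasDerivAt Vbar (σ - u / Vbar u * γ u (Vbar u)) u :=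
    fun u hu => hBd u ⟨hu.1, hu.2.trans hu₀ε⟩
  have hBlim : Tendsto Vbar (𝓝[>] 0) (𝓝 0) := by
    have := hBc 0 ⟨le_rfl, hε0⟩
    rw [ContinuousWithinAt, hB0] at this
    exact this.mono_left (nhdsWithin_le_of_mem (mem_of_superset (Ioo_mem_nhdsGT hε0)
      Ioo_subset_Ico_self))
  obtain ⟨Lv, hLv, hVle⟩ := exists_tendsto_of_hasDerivAt_sub (M := δ) hu₀0 hVd
    (fun u hu => mul_nonneg (div_nonneg hu.1.le (hVm u ⟨hu.1, hu.2.le⟩).1.le)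
      (hγ0 u ⟨hu.1.le, hu.2.le.trans hu₀δ⟩ _ (Ioc_subset_Icc_self (hVm u ⟨hu.1, hu.2.le⟩))))
    (fun u hu => by
      have := (hVm u ⟨hu.1, hu.2.le⟩).2
      have := mul_pos hσpos hu.1
      linarith)
  have hLv0 : 0 ≤ Lv := ge_of_tendsto hLv <| by
    filter_upwards [Ioc_mem_nhdsGT hu₀0] with u hu using (hVm u hu).1.le
  set ρ := (σ + s / 2) / 2 with hρdef
  have hρpos : 0 < ρ := by positivity
  have hρsq : γ 0 0 < ρ ^ 2 := by rw [hρdef]; nlinarith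
  have hBρ : ∀ᶠ u in 𝓝[>] 0, ρ < Vbar u / u :=
    hVbarslope.eventually_const_lt (by rw [hρdef]; linarith)
  have hBC : ∀ᶠ u in 𝓝[>] 0, Vbar u / u < σ + s := hVbarslope.eventually_lt_const (by linarith)
  refine ⟨Lv, hLv, fun hlt => ?_, fun hlt => ?_⟩
  · have hlt' := lt_of_right_lt_of_hasDerivAt hγ0 hγG hL hlip hu₀δ hBc' hVc hBm' hVm hBd' hVd
      (by rwa [hVu₀])
    refine lt_of_le_of_ne hLv0 fun hzero => ?_
    obtain ⟨η, hη, hηs⟩ := mem_nhdsGT_iff_exists_Ioc_subset.1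
      (hBρ.and (Ioo_mem_nhdsGT hu₀0))
    have hsub : ∀ u ∈ Ioc 0 η, u ∈ Ioc 0 u₀ := fun u hu => Ioo_subset_Ioc_self (hηs hu).2
    exact false_of_lt_of_mul_le (C := σ) hγ0 hlip hη ((hηs ⟨hη, le_rfl⟩).2.2.le.trans hu₀δ)
      (fun u hu => hBd' u (hηs hu).2) (fun u hu => hVd u (hηs hu).2)
      (fun u hu => hlt' u (hsub u hu)) hρpos
      (fun u hu => ((lt_div_iff₀ hu.1).1 (hηs hu).1).le)
      (fun u hu => by simpa [← hzero] using hVle u (hηs hu).2)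
      (fun u hu => (hVm u (hsub u hu)).2) hρsq
      (tendsto_apply_nhdsGT_zero hδ hγc hu₀0 hBm' hBlim)
  · have hlt' := lt_of_right_lt_of_hasDerivAt hγ0 hγG hL hlip hu₀δ hVc hBc' hVm hBm' hVd hBd'
      (by rwa [hVu₀])
    have hVlim : Tendsto V (𝓝[>] 0) (𝓝 0) := by
      refine tendsto_of_tendsto_of_tendsto_of_le_of_le' tendsto_const_nhds hBlim ?_ ?_
      · filter_upwards [Ioc_mem_nhdsGT hu₀0] with u hu using (hVm u hu).1.le
      · filter_upwards [Ioc_mem_nhdsGT hu₀0] with u hu using (hlt' u hu).le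
    refine ⟨tendsto_nhds_unique hLv hVlim, ?_⟩
    have hγV := tendsto_apply_nhdsGT_zero hδ hγc hu₀0 hVm hVlim
    obtain ⟨η, hη, hηs⟩ := mem_nhdsGT_iff_exists_Ioc_subset.1
      (hBC.and (Ioo_mem_nhdsGT hu₀0))
    have hsub : ∀ u ∈ Ioc 0 η, u ∈ Ioc 0 u₀ := fun u hu => Ioo_subset_Ioc_self (hηs hu).2
    have hprod : (σ - s) / 2 * ((σ + s) / 2) = γ 0 0 := by linear_combination -hssq / 4
    refine tendsto_div_of_frequently_lt (C := σ + s) (ρ := ρ) (l₂ := (σ + s) / 2) hη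
      (fun u hu => hVd u (hηs hu).2) (fun u hu => (hVm u (hsub u hu)).1)
      (fun u hu => (div_le_div_of_nonneg_right (hlt' u (hsub u hu)).le hu.1.le).trans
        (hηs hu).1.le)
      (by linarith) (by rw [hρdef]; linarith) (by rw [hρdef]; linarith) (by ring)
      (by rwa [hprod]) fun hcon => ?_
    obtain ⟨ζ, hζ, hζs⟩ := mem_nhdsGT_iff_exists_Ioc_subset.1
      (hcon.and (Ioc_mem_nhdsGT hη))
    have hsub' : ∀ u ∈ Ioc 0 ζ, u ∈ Ioc 0 η := fun u hu => (hζs hu).2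
    exact false_of_lt_of_mul_le (C := σ + s) hγ0 hlip hζ
      ((hsub ζ (hsub' ζ ⟨hζ, le_rfl⟩)).2.trans hu₀δ)
      (fun u hu => hVd u (hηs (hsub' u hu)).2) (fun u hu => hBd' u (hηs (hsub' u hu)).2)
      (fun u hu => hlt' u (hsub u (hsub' u hu))) hρpos
      (fun u hu => (le_div_iff₀ hu.1).1 (not_lt.1 (hζs hu).1))
      (fun u hu => ((div_lt_iff₀ hu.1).1 (hηs (hsub' u hu)).1).le)
      (fun u hu => (hBm' u (hsub u (hsub' u hu))).2) hρsq hγV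
end
end
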